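/- Decay of the potential energy for finite Morse index solutions (Euclidean version): let n ≥ 1, s ∈ (0,1), m ∈ ℕ, and set β := min((1-s)/2, s) > 0. There exist constants C > 0 and ε₀ ∈ (0,1), depending only on n, s and m, such that for every R > 0, every ε ∈ (0, ε₀·R], every p ∈ ℝ^n, and every continuously differentiable solution u : ℝ^n → (-1,1) of the fractional Allen–Cahn equation with parameters s, ε in B_R(p) ⊆ ℝ^n with bounded gradient and Morse index at most m in B_R(p), one has ε^{-s}·∫_{B_{R/2}(p)} W(u) dx ≤ C·R^{n-s}·(ε/R)^β. -/

import Mathlib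

open MeasureTheory Real Set Metric Filter Topology

noncomputable section

/-- Euclidean `n`-space. -/
abbrev Rn (n : ℕ) : Type := EuclideanSpace ℝ (Fin n)

/-- The normalizing constant `α_{n,s}` of the fractional Laplacian kernel. -/
def alphaC (n : ℕ) (s : ℝ) : ℝ :=
  s * 2 ^ (s - 1) * Real.Gamma (((n : ℝ) + s) / 2) /
    (Real.pi ^ ((n : ℝ) / 2) * Real.Gamma (1 - s / 2))

/-- The fractional kernel `α_{n,s} |x-y|^{-(n+s)}`. -/
def fracKer (n : ℕ) (s : ℝ) (x y : Rn n) : ℝ :=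
  alphaC n s * ‖x - y‖ ^ (-((n : ℝ) + s))

/-- The double-well potential `W(t) = (1-t²)²/4`. -/
def Wpot (t : ℝ) : ℝ := (1 - t ^ 2) ^ 2 / 4

/-- `u` solves the fractional Allen–Cahn equation
`(-Δ)^{s/2} u + ε^{-s} W'(u) = 0` (with `W'(t) = t³ - t`) in the open set `O`. -/
def IsACSol (n : ℕ) (s ε : ℝ) (u : Rn n → ℝ) (O : Set (Rn n)) : Prop :=
  ∀ x ∈ O, (∫ y, (u x - u y) * fracKer n s x y) + ε ^ (-s) * (u x ^ 3 - u x) = 0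

/-- The second-variation quadratic form of the fractional Allen–Cahn energy at `u` in `Ω`,
with `W''(t) = 3t² - 1`. -/
def Qform (n : ℕ) (s ε : ℝ) (u : Rn n → ℝ) (Ω : Set (Rn n)) (ξ : Rn n → ℝ) : ℝ :=
  (1 / 4) * (∫ p in ((Ωᶜ ×ˢ Ωᶜ)ᶜ : Set (Rn n × Rn n)),
      (ξ p.1 - ξ p.2) ^ 2 * fracKer n s p.1 p.2) +
    ε ^ (-s) * ∫ x in Ω, (3 * u x ^ 2 - 1) * ξ x ^ 2

/-- `ξ` is a `C¹` function compactly supported in `Ω`. -/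
def IsCc1On (n : ℕ) (Ω : Set (Rn n)) (ξ : Rn n → ℝ) : Prop :=
  ContDiff ℝ 1 ξ ∧ HasCompactSupport ξ ∧ tsupport ξ ⊆ Ω

/-- The Morse index of `u` in `Ω` is at most `m`: there is no `(m+1)`-dimensional subspace
of `C_c¹(Ω)` on which the second variation is negative definite. -/
def ACMorseIndexLE (n : ℕ) (s ε : ℝ) (u : Rn n → ℝ) (Ω : Set (Rn n)) (m : ℕ) : Prop :=
  ∀ ξ : Fin (m + 1) → Rn n → ℝ, (∀ i, IsCc1On n Ω (ξ i)) → LinearIndependent ℝ ξ →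
    ∃ a : Fin (m + 1) → ℝ, a ≠ 0 ∧ 0 ≤ Qform n s ε u Ω (fun x => ∑ i, a i * ξ i x)

/-- `u` is `Λ`-almost stable in `Ω`: `Q_Ω(ξ) ≥ -Λ (∫_Ω |ξ|)²` for all `ξ ∈ C_c¹(Ω)`. -/
def AlmostStable (n : ℕ) (s ε Λ : ℝ) (u : Rn n → ℝ) (Ω : Set (Rn n)) : Prop :=
  ∀ ξ : Rn n → ℝ, IsCc1On n Ω ξ → -(Λ * (∫ x in Ω, |ξ x|) ^ 2) ≤ Qform n s ε u Ω ξ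

end

noncomputable section

lemma alphaC_pos {n : ℕ} (hn : 1 ≤ n) {s : ℝ} (hs : s ∈ Ioo (0 : ℝ) 1) : 0 < alphaC n s := by
  have h1 : (1 : ℝ) ≤ n := by exact_mod_cast hn
  have := hs.1
  have := hs.2
  unfold alphaC
  have g1 : 0 < Real.Gamma (((n : ℝ) + s) / 2) := Real.Gamma_pos_of_pos (by linarith)
  have g2 : 0 < Real.Gamma (1 - s / 2) := Real.Gamma_pos_of_pos (by linarith)
  positivity

/-- The translation-invariant profile of `fracKer`. -/
def radKer (n : ℕ) (s : ℝ) (z : Rn n) : ℝ := alphaC n s * ‖z‖ ^ (-((n : ℝ) + s))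

/-- The profile of `fracKer` truncated at distance `1/8` from the origin. -/
def farKer (n : ℕ) (s : ℝ) (z : Rn n) : ℝ := alphaC n s * max ‖z‖ (1 / 8) ^ (-((n : ℝ) + s))

/-- The short-range part of the kernel, supported in the ball of radius `1/8`. -/
def nearKer (n : ℕ) (s : ℝ) (z : Rn n) : ℝ := radKer n s z - farKer n s z

lemma fracKer_eq (n : ℕ) (s : ℝ) (x y : Rn n) : fracKer n s x y = radKer n s (x - y) := rfl

lemma radKer_neg (n : ℕ) (s : ℝ) (z : Rn n) : radKer n s (-z) = radKer n s z := by
  simp [radKer]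

lemma farKer_neg (n : ℕ) (s : ℝ) (z : Rn n) : farKer n s (-z) = farKer n s z := by
  simp [farKer]

lemma nearKer_neg (n : ℕ) (s : ℝ) (z : Rn n) : nearKer n s (-z) = nearKer n s z := by
  simp [nearKer, radKer_neg, farKer_neg]

lemma measurable_radKer (n : ℕ) (s : ℝ) : Measurable (radKer n s) := by
  unfold radKer; fun_prop

lemma measurable_farKer (n : ℕ) (s : ℝ) : Measurable (farKer n s) := by
  unfold farKer; fun_prop

lemma measurable_nearKer (n : ℕ) (s : ℝ) : Measurable (nearKer n s) :=
  (measurable_radKer n s).sub (measurable_farKer n s)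

lemma ae_ne_zero {n : ℕ} (hn : 1 ≤ n) : ∀ᵐ z : Rn n, z ≠ 0 := by
  have : Nonempty (Fin n) := ⟨⟨0, hn⟩⟩
  have : Nontrivial (Rn n) := inferInstance
  exact Measure.ae_ne volume 0

section
variable {n : ℕ} (hn : 1 ≤ n) {s : ℝ} (hs : s ∈ Ioo (0 : ℝ) 1)
include hn hs

lemma radKer_nonneg (z : Rn n) : 0 ≤ radKer n s z := by
  have := alphaC_pos hn hs
  unfold radKer; positivity

lemma farKer_nonneg (z : Rn n) : 0 ≤ farKer n s z := by
  have := alphaC_pos hn hs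
  unfold farKer; positivity

lemma nearKer_le_radKer (z : Rn n) : nearKer n s z ≤ radKer n s z := by
  have := farKer_nonneg hn hs z
  unfold nearKer; linarith

lemma nearKer_nonneg {z : Rn n} (hz : z ≠ 0) : 0 ≤ nearKer n s z := by
  have h := alphaC_pos hn hs
  have h1 : 0 < ‖z‖ := norm_pos_iff.2 hz
  have := hs.1
  have h2 : max ‖z‖ (1 / 8) ^ (-((n : ℝ) + s)) ≤ ‖z‖ ^ (-((n : ℝ) + s)) :=
    Real.rpow_le_rpow_of_nonpos h1 (le_max_left _ _) (by have : (0:ℝ) ≤ n := by positivity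
                                                         linarith)
  unfold nearKer radKer farKer
  nlinarith

omit hn hs in
lemma nearKer_eq_zero {z : Rn n} (hz : 1 / 8 ≤ ‖z‖) : nearKer n s z = 0 := by
  simp only [nearKer, radKer, farKer, max_eq_left hz, sub_self]

lemma nearKer_lower {z : Rn n} (hz : z ≠ 0) {τ : ℝ} (hτ : ‖z‖ ≤ τ) (hτ' : τ ≤ 1 / 16) :
    alphaC n s / 2 * τ ^ (-((n : ℝ) + s)) ≤ nearKer n s z := by
  have h := alphaC_pos hn hs
  have h1 : 0 < ‖z‖ := norm_pos_iff.2 hz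
  have hn1 : (1 : ℝ) ≤ n := by exact_mod_cast hn
  have hs0 := hs.1
  have hτ0 : 0 < τ := h1.trans_le hτ
  have a1 : τ ^ (-((n : ℝ) + s)) ≤ ‖z‖ ^ (-((n : ℝ) + s)) :=
    Real.rpow_le_rpow_of_nonpos h1 hτ (by linarith)
  have a2 : (1 / 8 : ℝ) ^ (-((n : ℝ) + s)) ≤ 1 / 2 * τ ^ (-((n : ℝ) + s)) := by
    calc (1 / 8 : ℝ) ^ (-((n : ℝ) + s)) ≤ (2 * τ) ^ (-((n : ℝ) + s)) :=
          Real.rpow_le_rpow_of_nonpos (by linarith) (by linarith) (by linarith)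
      _ = 2 ^ (-((n : ℝ) + s)) * τ ^ (-((n : ℝ) + s)) := Real.mul_rpow (by norm_num) hτ0.le
      _ ≤ 1 / 2 * τ ^ (-((n : ℝ) + s)) := by
          gcongr
          calc (2 : ℝ) ^ (-((n : ℝ) + s)) ≤ 2 ^ (-1 : ℝ) :=
                Real.rpow_le_rpow_of_exponent_le (by norm_num) (by linarith)
            _ = 1 / 2 := by rw [Real.rpow_neg_one]; norm_num
  have a3 : max ‖z‖ (1 / 8) = 1 / 8 := max_eq_right (by linarith)
  unfold nearKer radKer farKer
  rw [a3]
  nlinarith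

lemma integrable_min_mul_radKer : Integrable (fun z : Rn n => min 1 ‖z‖ * radKer n s z) := by
  have : Nonempty (Fin n) := ⟨⟨0, hn⟩⟩
  have : Nontrivial (Rn n) := inferInstance
  have hs0 := hs.1
  have hs1 := hs.2
  have key := integrable_fun_norm_addHaar (volume : Measure (Rn n))
    (f := fun t : ℝ => min 1 t * (alphaC n s * t ^ (-((n : ℝ) + s))))
  unfold radKer
  rw [key, finrank_euclideanSpace, Fintype.card_fin, ← Ioc_union_Ioi_eq_Ioi (zero_le_one' ℝ)]
  have e : ∀ t : ℝ, 0 < t → t ^ (n - 1) * t ^ (-((n : ℝ) + s)) = t ^ (-1 - s) := by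
    intro t ht
    rw [← Real.rpow_natCast, ← Real.rpow_add ht]
    congr 1
    push_cast [hn]
    ring
  refine IntegrableOn.union ?_ ?_
  · have : IntegrableOn (fun t : ℝ => alphaC n s * t ^ (-s)) (Ioc 0 1) := by
      apply Integrable.const_mul
      have := intervalIntegral.intervalIntegrable_rpow' (a := 0) (b := 1) (r := -s) (by linarith)
      rwa [intervalIntegrable_iff_integrableOn_Ioc_of_le zero_le_one] at this
    refine this.congr_fun (fun t ht => ?_) measurableSet_Ioc
    have := e t ht.1
    simp only [smul_eq_mul, min_eq_right ht.2]
    rw [show t ^ (n - 1) * (t * (alphaC n s * t ^ (-((n : ℝ) + s)))) =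
      alphaC n s * (t * (t ^ (n - 1) * t ^ (-((n : ℝ) + s)))) by ring, this]
    congr 1
    rw [show -s = 1 + (-1 - s) by ring, Real.rpow_add ht.1, Real.rpow_one]
  · have : IntegrableOn (fun t : ℝ => alphaC n s * t ^ (-1 - s)) (Ioi 1) :=
      (integrableOn_Ioi_rpow_of_lt (by linarith) one_pos).const_mul _
    refine this.congr_fun (fun t ht => ?_) measurableSet_Ioi
    have ht' : (1 : ℝ) < t := ht
    have := e t (by linarith)
    simp only [smul_eq_mul, min_eq_left ht'.le]
    rw [← this]; ring

lemma integrable_mul_radKer {f : Rn n → ℝ} (hf : AEStronglyMeasurable f) {C : ℝ}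
    (hC : ∀ z, |f z| ≤ C * min 1 ‖z‖) : Integrable (fun z => f z * radKer n s z) := by
  refine ((integrable_min_mul_radKer hn hs).const_mul C).mono'
    (hf.mul (measurable_radKer n s).aestronglyMeasurable) (ae_of_all _ fun z => ?_)
  have := radKer_nonneg hn hs z
  rw [norm_mul, Real.norm_eq_abs, Real.norm_eq_abs, abs_of_nonneg this, ← mul_assoc]
  gcongr
  exact hC z

lemma integrable_mul_nearKer {f : Rn n → ℝ} (hf : AEStronglyMeasurable f) {C : ℝ}
    (hC : ∀ z, |f z| ≤ C * min 1 ‖z‖) : Integrable (fun z => f z * nearKer n s z) := by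
  refine (integrable_mul_radKer hn hs hf hC).mono
    (hf.mul (measurable_nearKer n s).aestronglyMeasurable) ?_
  filter_upwards [ae_ne_zero hn] with z hz
  rw [norm_mul, norm_mul, Real.norm_eq_abs (nearKer n s z), Real.norm_eq_abs (radKer n s z),
    abs_of_nonneg (nearKer_nonneg hn hs hz), abs_of_nonneg (radKer_nonneg hn hs z)]
  gcongr
  exact nearKer_le_radKer hn hs z

lemma integrable_farKer : Integrable (farKer n s) := by
  have hs0 := hs.1
  have hn1 : (1 : ℝ) ≤ n := by exact_mod_cast hn
  have hα := alphaC_pos hn hs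
  have h := (integrable_one_add_norm (E := Rn n) (μ := volume) (r := (n : ℝ) + s)
    (by simp; linarith)).const_mul (alphaC n s * 16 ^ ((n : ℝ) + s))
  refine h.mono' (measurable_farKer n s).aestronglyMeasurable (ae_of_all _ fun z => ?_)
  rw [Real.norm_eq_abs, abs_of_nonneg (farKer_nonneg hn hs z), farKer, mul_assoc]
  gcongr
  have h0 := norm_nonneg z
  have e : (16 : ℝ) ^ ((n : ℝ) + s) = (1 / 16) ^ (-((n : ℝ) + s)) := by
    rw [Real.rpow_neg (by norm_num), one_div, Real.inv_rpow (by norm_num), inv_inv]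
  rw [e, ← Real.mul_rpow (by norm_num) (by linarith)]
  apply Real.rpow_le_rpow_of_nonpos (by linarith) _ (by linarith)
  rcases le_total ‖z‖ (1/8) with h | h
  · rw [max_eq_right h]; linarith
  · rw [max_eq_left h]; linarith

lemma farKer_translate : ∃ C : ℝ, 0 ≤ C ∧ ∀ z h : Rn n, ‖h‖ ≤ 1 / 16 →
    |farKer n s (z - h) - farKer n s z| ≤ C * ‖h‖ * farKer n s z := by
  have hs0 := hs.1
  have hn1 : (1 : ℝ) ≤ n := by exact_mod_cast hn
  have hα := alphaC_pos hn hs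
  set γ : ℝ := (n : ℝ) + s with hγ
  refine ⟨γ * 2 ^ (γ + 1) * 8, by positivity, fun z h hh => ?_⟩
  have main : ∀ a b : ℝ, 1 / 8 ≤ a → 1 / 8 ≤ b → |b - a| ≤ ‖h‖ →
      |b ^ (-γ) - a ^ (-γ)| ≤ γ * 2 ^ (γ + 1) * 8 * ‖h‖ * a ^ (-γ) := by
    intro a b ha hb hab
    have hmv := (convex_Ici (a / 2)).norm_image_sub_le_of_norm_hasDerivWithin_le
      (f := fun t : ℝ => t ^ (-γ)) (f' := fun t => -γ * t ^ (-γ - 1))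
      (C := γ * (a / 2) ^ (-γ - 1)) (x := a) (y := b)
      (fun t ht => (Real.hasDerivAt_rpow_const (Or.inl (by
        have : a / 2 ≤ t := ht
        linarith))).hasDerivWithinAt)
      (fun t ht => by
        have ht' : a / 2 ≤ t := ht
        have ht0 : 0 < t := by linarith
        have ha2 : 0 < a / 2 := by linarith
        have hmono : t ^ (-γ - 1) ≤ (a / 2) ^ (-γ - 1) :=
          Real.rpow_le_rpow_of_nonpos ha2 ht' (by linarith)
        rw [norm_mul, norm_neg, Real.norm_eq_abs, Real.norm_eq_abs, abs_of_nonneg (by positivity),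
          abs_of_nonneg (by positivity)]
        gcongr)
      (by simp only [mem_Ici]; linarith) (by
        simp only [mem_Ici]
        have := abs_le.1 hab
        linarith)
    rw [Real.norm_eq_abs, Real.norm_eq_abs] at hmv
    refine hmv.trans ?_
    have e1 : (a / 2) ^ (-γ - 1) = 2 ^ (γ + 1) * (a ^ (-γ) * a⁻¹) := by
      rw [Real.div_rpow (by linarith) (by norm_num), Real.rpow_sub (by linarith), Real.rpow_one,
        show -γ - 1 = -(γ + 1) by ring, Real.rpow_neg (by norm_num : (0:ℝ) ≤ 2), div_inv_eq_mul]
      ring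
    have e2 : a⁻¹ ≤ 8 := by
      rw [inv_le_comm₀ (by linarith) (by norm_num)]; linarith
    have ha0 : 0 < a := by linarith
    rw [e1]
    calc γ * (2 ^ (γ + 1) * (a ^ (-γ) * a⁻¹)) * |b - a|
        ≤ γ * (2 ^ (γ + 1) * (a ^ (-γ) * 8)) * ‖h‖ := by gcongr
      _ = _ := by ring
  have := main (max ‖z‖ (1 / 8)) (max ‖z - h‖ (1 / 8)) (le_max_right _ _) (le_max_right _ _) (by
    refine (abs_max_sub_max_le_abs _ _ _).trans ?_
    refine (abs_norm_sub_norm_le _ _).trans ?_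
    simp)
  unfold farKer
  rw [← hγ, ← mul_sub, abs_mul, abs_of_pos hα]
  calc _ ≤ alphaC n s * (γ * 2 ^ (γ + 1) * 8 * ‖h‖ * max ‖z‖ (1 / 8) ^ (-γ)) := by gcongr
    _ = _ := by ring

end
end

noncomputable section

/-- The squared `L²` distance between `f` and its translate by `z`. -/
def sqDiff {n : ℕ} (f : Rn n → ℝ) (z : Rn n) : ℝ := ∫ x, (f (x + z) - f x) ^ 2

section
variable {n : ℕ}

lemma sqDiff_nonneg (f : Rn n → ℝ) (z : Rn n) : 0 ≤ sqDiff f z :=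
  integral_nonneg fun _ => sq_nonneg _

lemma stronglyMeasurable_sqDiff {f : Rn n → ℝ} (hf : Continuous f) :
    StronglyMeasurable (sqDiff f) := by
  have : Continuous (fun p : Rn n × Rn n => (f (p.2 + p.1) - f p.2) ^ 2) := by fun_prop
  exact this.stronglyMeasurable.integral_prod_right

lemma integrable_mul_of_compact {f g : Rn n → ℝ} (hf : Continuous f) (hg : Continuous g)
    (hc : HasCompactSupport f) : Integrable (fun x => f x * g x) :=
  (hf.mul hg).integrable_of_hasCompactSupport (hc.mul_right)

lemma integrable_sq_of_compact {f : Rn n → ℝ} (hf : Continuous f) (hc : HasCompactSupport f) :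
    Integrable (fun x => f x ^ 2) := by
  simpa only [sq] using integrable_mul_of_compact hf hf hc

lemma integrable_sqDiff_integrand {f : Rn n → ℝ} (hf : Continuous f) (hc : HasCompactSupport f)
    (z : Rn n) : Integrable (fun x => (f (x + z) - f x) ^ 2) := by
  have h1 := (integrable_sq_of_compact hf hc).comp_add_right z
  have h2 := integrable_sq_of_compact hf hc
  have h3 := integrable_mul_of_compact (g := fun x => f (x + z)) hf (by fun_prop) hc
  refine ((h1.add h2).sub (h3.const_mul 2)).congr (ae_of_all _ fun x => ?_)
  simp only [Pi.add_apply, Pi.sub_apply]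
  ring

lemma sqDiff_le_four_mul {f : Rn n → ℝ} (hf : Continuous f) (hc : HasCompactSupport f)
    (z : Rn n) : sqDiff f z ≤ 4 * ∫ x, f x ^ 2 := by
  have h1 := (integrable_sq_of_compact hf hc).comp_add_right z
  have h2 := integrable_sq_of_compact hf hc
  calc sqDiff f z ≤ ∫ x, (2 * f (x + z) ^ 2 + 2 * f x ^ 2) := by
        refine integral_mono (integrable_sqDiff_integrand hf hc z)
          ((h1.const_mul 2).add (h2.const_mul 2)) fun x => ?_
        simp only
        nlinarith [sq_nonneg (f (x + z) + f x)]
    _ = 4 * ∫ x, f x ^ 2 := by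
        rw [integral_add (h1.const_mul 2) (h2.const_mul 2), integral_const_mul, integral_const_mul,
          integral_add_right_eq_self (fun x => f x ^ 2) z]
        ring

lemma sqDiff_le_min {f : Rn n → ℝ} (hf : Continuous f) (hc : HasCompactSupport f) {L : ℝ}
    (hL : ∀ x y, |f x - f y| ≤ L * ‖x - y‖) :
    ∃ C, ∀ z, |sqDiff f z| ≤ C * min 1 ‖z‖ := by
  have hi : Integrable f := hf.integrable_of_hasCompactSupport hc
  refine ⟨max (4 * ∫ x, f x ^ 2) (2 * L * ∫ x, |f x|), fun z => ?_⟩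
  rw [abs_of_nonneg (sqDiff_nonneg f z)]
  have hb : sqDiff f z ≤ 2 * L * (∫ x, |f x|) * ‖z‖ := by
    have h1 := hi.abs.comp_add_right z
    calc sqDiff f z ≤ ∫ x, (L * ‖z‖ * |f (x + z)| + L * ‖z‖ * |f x|) := by
          refine integral_mono (integrable_sqDiff_integrand hf hc z)
            ((h1.const_mul _).add (hi.abs.const_mul _)) fun x => ?_
          simp only
          have h2 := hL (x + z) x
          rw [add_sub_cancel_left] at h2
          have h3 := abs_sub (f (x + z)) (f x)
          rw [← sq_abs]
          nlinarith [abs_nonneg (f (x + z) - f x)]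
      _ = _ := by
          rw [integral_add (h1.const_mul _) (hi.abs.const_mul _), integral_const_mul,
            integral_const_mul, integral_add_right_eq_self (fun x => |f x|) z]
          ring
  rcases le_total 1 ‖z‖ with h | h
  · rw [min_eq_left h, mul_one]
    exact (sqDiff_le_four_mul hf hc z).trans (le_max_left _ _)
  · rw [min_eq_right h]
    exact hb.trans (mul_le_mul_of_nonneg_right (le_max_right _ _) (norm_nonneg _))

/-- The pairing of `η² w` with the increment of `w` in the direction `z`. -/
def wPair (η w : Rn n → ℝ) (z : Rn n) : ℝ := ∫ x, η x ^ 2 * w x * (w x - w (x + z))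

/-- The commutator term created by moving a cutoff inside the difference quotient. -/
def wComm (η w : Rn n → ℝ) (z : Rn n) : ℝ := ∫ x, w x * w (x + z) * (η (x + z) - η x) ^ 2

lemma wPair_symm {η w : Rn n → ℝ} (hη : Continuous η) (hc : HasCompactSupport η)
    (hw : Continuous w) (z : Rn n) :
    wPair η w z + wPair η w (-z) = sqDiff (fun x => η x * w x) z - wComm η w z := by
  have hf : Continuous fun x => η x * w x := by fun_prop
  have hfc : HasCompactSupport fun x => η x * w x := hc.mul_right
  have i1 : ∀ z, Integrable (fun x => η x ^ 2 * w x * (w x - w (x + z))) := fun z => by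
    have := integrable_mul_of_compact (g := fun x => η x * w x * (w x - w (x + z))) hη
      (by fun_prop) hc
    refine this.congr (ae_of_all _ fun x => ?_)
    simp only
    ring
  have e2 : wPair η w (-z) = ∫ x, η (x + z) ^ 2 * w (x + z) * (w (x + z) - w x) := by
    unfold wPair
    rw [← integral_add_right_eq_self _ z]
    simp only [add_neg_cancel_right]
  have i2 : Integrable (fun x => η (x + z) ^ 2 * w (x + z) * (w (x + z) - w x)) := by
    have := (i1 (-z)).comp_add_right z
    simpa only [add_neg_cancel_right] using this
  have i3 := integrable_sqDiff_integrand hf hfc z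
  have e4 : ∀ x, w x * w (x + z) * (η (x + z) - η x) ^ 2 =
      (η (x + z) * w (x + z) - η x * w x) ^ 2 - (η x ^ 2 * w x * (w x - w (x + z)) +
        η (x + z) ^ 2 * w (x + z) * (w (x + z) - w x)) := fun x => by ring
  have e5 : wComm η w z = sqDiff (fun x => η x * w x) z - (wPair η w z + wPair η w (-z)) := by
    rw [e2]
    unfold wComm wPair sqDiff
    simp_rw [e4]
    rw [← integral_add (i1 z) i2]
    exact integral_sub i3 ((i1 z).add i2)
  linarith

lemma stronglyMeasurable_wPair {η w : Rn n → ℝ} (hη : Continuous η) (hw : Continuous w) :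
    StronglyMeasurable (wPair η w) := by
  have : Continuous (fun p : Rn n × Rn n => η p.2 ^ 2 * w p.2 * (w p.2 - w (p.2 + p.1))) := by
    fun_prop
  exact this.stronglyMeasurable.integral_prod_right

lemma abs_sub_le_min {w : Rn n → ℝ} {B L : ℝ} (hB : ∀ x, |w x| ≤ B)
    (hL : ∀ x y, |w x - w y| ≤ L * ‖x - y‖) (x z : Rn n) :
    |w x - w (x + z)| ≤ max (2 * B) L * min 1 ‖z‖ := by
  have h2 := hL x (x + z)
  rw [sub_add_cancel_left, norm_neg] at h2
  have h3 := abs_sub (w x) (w (x + z))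
  rcases le_total 1 ‖z‖ with h | h
  · rw [min_eq_left h, mul_one]
    exact (by linarith [hB x, hB (x + z)] : _ ≤ 2 * B).trans (le_max_left _ _)
  · rw [min_eq_right h]
    exact h2.trans (mul_le_mul_of_nonneg_right (le_max_right _ _) (norm_nonneg _))

lemma wPair_le_min {η w : Rn n → ℝ} (hη : Continuous η) (hc : HasCompactSupport η)
    (hw : Continuous w) {B L : ℝ} (hB : ∀ x, |w x| ≤ B)
    (hL : ∀ x y, |w x - w y| ≤ L * ‖x - y‖) :
    ∃ C, ∀ z, |wPair η w z| ≤ C * min 1 ‖z‖ := by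
  have hi : Integrable (fun x => |η x ^ 2 * w x|) := by
    have := (integrable_mul_of_compact (g := fun x => η x * w x) hη (by fun_prop) hc).abs
    refine this.congr (ae_of_all _ fun x => ?_)
    simp only
    ring_nf
  refine ⟨(∫ x, |η x ^ 2 * w x|) * max (2 * B) L, fun z => ?_⟩
  unfold wPair
  rw [← Real.norm_eq_abs]
  refine (norm_integral_le_of_norm_le (hi.mul_const (max (2 * B) L * min 1 ‖z‖))
    (ae_of_all _ fun x => ?_)).trans_eq ?_
  · rw [norm_mul, Real.norm_eq_abs, Real.norm_eq_abs]
    gcongr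
    exact abs_sub_le_min hB hL x z
  · rw [integral_mul_const]; ring

lemma wComm_le {η w : Rn n → ℝ} (hη : Continuous η)
    (hw : Continuous w) {L : ℝ} (hL : ∀ x y, |η x - η y| ≤ L * ‖x - y‖)
    (hs : ∀ x, 3 / 8 < ‖x‖ → η x = 0) {z : Rn n} (hz : ‖z‖ < 1 / 8) :
    wComm η w z ≤ L ^ 2 * ‖z‖ ^ 2 * ∫ x in ball 0 (1 / 2), w x ^ 2 := by
  have key : ∀ z : Rn n, ‖z‖ < 1 / 8 → Integrable (fun x => w x ^ 2 * (η (x + z) - η x) ^ 2) ∧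
      ∫ x, w x ^ 2 * (η (x + z) - η x) ^ 2 ≤
        L ^ 2 * ‖z‖ ^ 2 * ∫ x in ball 0 (1 / 2), w x ^ 2 := by
    intro z hz
    have hz0 : ∀ x, x ∉ ball (0 : Rn n) (1 / 2) → w x ^ 2 * (η (x + z) - η x) ^ 2 = 0 := by
      intro x hx
      rw [mem_ball_zero_iff, not_lt] at hx
      have := norm_sub_norm_le x (-z)
      rw [sub_neg_eq_add, norm_neg] at this
      rw [hs x (by linarith), hs (x + z) (by linarith)]
      simp
    have hint : Integrable (fun x => w x ^ 2 * (η (x + z) - η x) ^ 2) := by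
      have hcont : Continuous (fun x => w x ^ 2 * (η (x + z) - η x) ^ 2) := by fun_prop
      refine hcont.integrable_of_hasCompactSupport
        (HasCompactSupport.intro (isCompact_closedBall (0 : Rn n) (1 / 2)) fun x hx => hz0 x ?_)
      exact fun h => hx (ball_subset_closedBall h)
    have hw2 : IntegrableOn (fun x => w x ^ 2) (ball (0 : Rn n) (1 / 2)) :=
      ((hw.pow 2).continuousOn.integrableOn_compact
        (isCompact_closedBall (0 : Rn n) (1 / 2))).mono_set ball_subset_closedBall
    refine ⟨hint, ?_⟩
    rw [← setIntegral_eq_integral_of_forall_compl_eq_zero hz0, ← integral_const_mul]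
    refine setIntegral_mono hint.integrableOn (hw2.const_mul _) fun x => ?_
    have h2 := hL (x + z) x
    rw [add_sub_cancel_left] at h2
    have h3 : (η (x + z) - η x) ^ 2 ≤ (L * ‖z‖) ^ 2 := by
      rw [← sq_abs]; gcongr
    calc w x ^ 2 * (η (x + z) - η x) ^ 2 ≤ w x ^ 2 * (L * ‖z‖) ^ 2 := by gcongr
      _ = _ := by ring
  obtain ⟨i1, b1⟩ := key z hz
  obtain ⟨i2, b2⟩ := key (-z) (by simpa using hz)
  have i2' := i2.comp_add_right z
  have e2 := integral_add_right_eq_self (μ := volume) (fun x => w x ^ 2 * (η (x + -z) - η x) ^ 2) z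
  simp only [add_neg_cancel_right] at i2' e2
  rw [← e2, norm_neg] at b2
  have hb : wComm η w z ≤ ∫ x, (1 / 2 * (w x ^ 2 * (η (x + z) - η x) ^ 2) +
      1 / 2 * (w (x + z) ^ 2 * (η x - η (x + z)) ^ 2)) := by
    unfold wComm
    by_cases hi : Integrable (fun x => w x * w (x + z) * (η (x + z) - η x) ^ 2)
    · refine integral_mono hi ((i1.const_mul _).add (i2'.const_mul _)) fun x => ?_
      simp only
      nlinarith [mul_nonneg (sq_nonneg (w x - w (x + z))) (sq_nonneg (η (x + z) - η x))]
    · rw [integral_undef hi]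
      exact integral_nonneg fun x => by positivity
  rw [integral_add (i1.const_mul _) (i2'.const_mul _), integral_const_mul,
    integral_const_mul] at hb
  linarith
end
end

noncomputable section

/-- `η` is a `C¹` cutoff, equal to `1` on `B_a` and to `0` outside `B_b`, with Lipschitz
constant `L`. -/
structure IsCutoff {n : ℕ} (η : Rn n → ℝ) (a b L : ℝ) : Prop where
  contDiff : ContDiff ℝ 1 η
  nonneg : ∀ x, 0 ≤ η x
  le_one : ∀ x, η x ≤ 1
  eq_one : ∀ x, ‖x‖ ≤ a → η x = 1
  eq_zero : ∀ x, b ≤ ‖x‖ → η x = 0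
  lip_nonneg : 0 ≤ L
  lip : ∀ x y, |η x - η y| ≤ L * ‖x - y‖

/-- The second variation controls half of the kinetic energy up to an `L²` error. -/
def StableInUnitBall (n : ℕ) (s ε Λ : ℝ) (u : Rn n → ℝ) : Prop :=
  ∀ ξ : Rn n → ℝ, IsCc1On n (ball 0 1) ξ →
    ε ^ (-s) * ∫ x, (1 - 3 * u x ^ 2) * ξ x ^ 2 ≤
      1 / 4 * (∫ z, sqDiff ξ z * radKer n s z) + Λ * ∫ x, ξ x ^ 2

section
variable {n : ℕ}

lemma exists_isCutoff (n : ℕ) {a b : ℝ} (ha : 0 < a) (hab : a < b) :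
    ∃ (η : Rn n → ℝ) (L : ℝ), IsCutoff η a b L := by
  let f : ContDiffBump (0 : Rn n) := ⟨a, b, ha, hab⟩
  have hf : ContDiff ℝ 1 (f : Rn n → ℝ) := f.contDiff
  obtain ⟨L, hL⟩ := hf.lipschitzWith_of_hasCompactSupport f.hasCompactSupport one_ne_zero
  refine ⟨f, L, hf, fun x => f.nonneg, fun x => f.le_one, fun x hx => ?_, fun x hx => ?_,
    L.2, fun x y => ?_⟩
  · exact f.one_of_mem_closedBall (by simpa using hx)
  · exact f.zero_of_le_dist (by simpa using hx)
  · have := hL.dist_le_mul x y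
    rwa [Real.dist_eq, dist_eq_norm] at this

namespace IsCutoff
variable {η : Rn n → ℝ} {a b L : ℝ} (h : IsCutoff η a b L)
include h

lemma tsupport_subset : tsupport η ⊆ closedBall 0 b := by
  refine closure_minimal (fun x hx => ?_) isClosed_closedBall
  by_contra hx'
  rw [mem_closedBall_zero_iff, not_le] at hx'
  exact hx (h.eq_zero x hx'.le)

lemma hasCompactSupport : HasCompactSupport η :=
  (isCompact_closedBall (0 : Rn n) b).of_isClosed_subset (isClosed_tsupport _) h.tsupport_subset

lemma continuous : Continuous η := h.contDiff.continuous

lemma sq_le_one (x : Rn n) : η x ^ 2 ≤ 1 := by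
  have := h.nonneg x
  have := h.le_one x
  nlinarith

lemma isCc1On_mul (hb : b < 1) {f : Rn n → ℝ} (hf : ContDiff ℝ 1 f) :
    IsCc1On n (ball 0 1) fun x => η x * f x :=
  ⟨h.contDiff.mul hf, h.hasCompactSupport.mul_right,
    (closure_mono (Function.support_mul_subset_left _ _)).trans
      (h.tsupport_subset.trans (closedBall_subset_ball hb))⟩

lemma integral_sq_mul_le {f : Rn n → ℝ} (hf : Continuous f) {r : ℝ} (hbr : b ≤ r) :
    ∫ x, (η x * f x) ^ 2 ≤ ∫ x in ball 0 r, f x ^ 2 := by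
  have hz : ∀ x, x ∉ ball (0 : Rn n) r → (η x * f x) ^ 2 = 0 := fun x hx => by
    rw [mem_ball_zero_iff, not_lt] at hx
    rw [h.eq_zero x (hbr.trans hx)]; simp
  have hf2 : IntegrableOn (fun x => f x ^ 2) (ball (0 : Rn n) r) :=
    ((hf.pow 2).continuousOn.integrableOn_compact
      (isCompact_closedBall (0 : Rn n) r)).mono_set ball_subset_closedBall
  have hi : Integrable (fun x => (η x * f x) ^ 2) :=
    integrable_sq_of_compact (h.continuous.mul hf) h.hasCompactSupport.mul_right
  rw [← setIntegral_eq_integral_of_forall_compl_eq_zero hz]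
  refine setIntegral_mono hi.integrableOn hf2 fun x => ?_
  rw [mul_pow]
  exact mul_le_of_le_one_left (sq_nonneg _) (h.sq_le_one x)

end IsCutoff

variable (hn : 1 ≤ n) {s : ℝ} (hs : s ∈ Ioo (0 : ℝ) 1)
include hn hs

lemma farKer_convolution_lipschitz : ∃ C : ℝ, 0 ≤ C ∧ ∀ u : Rn n → ℝ, Continuous u →
    (∀ x, |u x| ≤ 1) → ∀ h x : Rn n, ‖h‖ ≤ 1 / 16 →
    |∫ z, (u (x + z + h) - u (x + z)) * farKer n s z| ≤ C * ‖h‖ := by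
  obtain ⟨C, hC0, hC⟩ := farKer_translate hn hs
  have hF := integrable_farKer hn hs
  refine ⟨C * ∫ z, farKer n s z,
    mul_nonneg hC0 (integral_nonneg (farKer_nonneg hn hs)), fun u hu hu1 h x hh => ?_⟩
  have i0 : ∀ (g : Rn n → ℝ), Integrable g → ∀ y : Rn n, Integrable (fun z => u (y + z) * g z) :=
    fun g hg y => hg.bdd_mul (c := 1) (by fun_prop) (ae_of_all _ fun z => hu1 _)
  have i1 : Integrable (fun z => u (x + z + h) * farKer n s z) := by
    have := i0 _ hF (x + h)
    refine this.congr (ae_of_all _ fun z => ?_)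
    simp only
    rw [add_right_comm]
  have i2 := i0 _ hF x
  have i3 := i0 _ (hF.comp_sub_right h) x
  have e : ∫ z, (u (x + z + h) - u (x + z)) * farKer n s z =
      ∫ z, u (x + z) * (farKer n s (z - h) - farKer n s z) := by
    simp_rw [sub_mul, mul_sub]
    rw [integral_sub i1 i2, integral_sub i3 i2]
    congr 1
    rw [← integral_add_right_eq_self (fun z => u (x + z) * farKer n s (z - h)) h]
    simp only [add_sub_cancel_right, add_assoc]
  rw [e, ← Real.norm_eq_abs]
  refine (norm_integral_le_of_norm_le (hF.const_mul (C * ‖h‖)) (ae_of_all _ fun z => ?_)).trans_eq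
    ?_
  · rw [norm_mul]
    exact (mul_le_of_le_one_left (norm_nonneg _) (hu1 _)).trans (hC z h hh)
  · rw [integral_const_mul]; ring

omit hn hs in
lemma integral_sub_mul_fracKer (u : Rn n → ℝ) (x : Rn n) :
    ∫ y, (u x - u y) * fracKer n s x y = ∫ z, (u x - u (x + z)) * radKer n s z := by
  rw [← integral_add_left_eq_self _ x]
  simp only [fracKer_eq, sub_add_cancel_left, radKer_neg]

lemma increment_equation {ε : ℝ} {u : Rn n → ℝ} (hu : Continuous u) (hu1 : ∀ x, |u x| ≤ 1) {K : ℝ}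
    (hK : ∀ x y, |u x - u y| ≤ K * ‖x - y‖) (hsol : IsACSol n s ε u (ball 0 1)) {h x : Rn n}
    (hx : x ∈ ball (0 : Rn n) 1) (hxh : x + h ∈ ball (0 : Rn n) 1) {w : Rn n → ℝ}
    (hw : w = fun x => u (x + h) - u x) :
    ∫ z, (w x - w (x + z)) * nearKer n s z =
      -((∫ z, farKer n s z) * w x) + (∫ z, w (x + z) * farKer n s z) +
      ε ^ (-s) * ((1 - (u (x + h) ^ 2 + u (x + h) * u x + u x ^ 2)) * w x) := by
  have hF := integrable_farKer hn hs
  have hwc : Continuous w := by rw [hw]; fun_prop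
  have i : ∀ y, Integrable (fun z => (u y - u (y + z)) * radKer n s z) := fun y =>
    integrable_mul_radKer hn hs (Continuous.aestronglyMeasurable (by fun_prop))
      (abs_sub_le_min hu1 hK y)
  have iw : Integrable (fun z => (w x - w (x + z)) * radKer n s z) := by
    refine ((i (x + h)).sub (i x)).congr (ae_of_all _ fun z => ?_)
    simp only [Pi.sub_apply, hw]
    rw [add_right_comm]; ring
  have i2 : Integrable (fun z => w (x + z) * farKer n s z) :=
    hF.bdd_mul (c := 2) (Continuous.aestronglyMeasurable (by fun_prop)) (ae_of_all _ fun z => by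
      have := abs_sub (u (x + z + h)) (u (x + z))
      simp only [hw, Real.norm_eq_abs]
      linarith [hu1 (x + z + h), hu1 (x + z)])
  have e1 : ∫ z, (w x - w (x + z)) * radKer n s z =
      (∫ z, (u (x + h) - u (x + h + z)) * radKer n s z) -
        ∫ z, (u x - u (x + z)) * radKer n s z := by
    rw [← integral_sub (i (x + h)) (i x)]
    refine integral_congr_ae (ae_of_all _ fun z => ?_)
    simp only [hw]
    rw [add_right_comm]; ring
  have e2 : ∫ z, (w x - w (x + z)) * nearKer n s z = (∫ z, (w x - w (x + z)) * radKer n s z) -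
      (w x * (∫ z, farKer n s z) - ∫ z, w (x + z) * farKer n s z) := by
    rw [← integral_const_mul, ← integral_sub (hF.const_mul _) i2]
    refine Eq.trans ?_ (integral_sub iw ((hF.const_mul (w x)).sub i2))
    refine integral_congr_ae (ae_of_all _ fun z => ?_)
    simp only [nearKer]; ring
  have s1 := hsol x hx
  have s2 := hsol (x + h) hxh
  rw [integral_sub_mul_fracKer] at s1 s2
  rw [e2, e1]
  have : w x = u (x + h) - u x := by rw [hw]
  rw [this]
  linear_combination s2 - s1
end
end

noncomputable section
section
variable {n : ℕ} (hn : 1 ≤ n) {s : ℝ} (hs : s ∈ Ioo (0 : ℝ) 1)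
include hn hs

lemma integrable_min_mul_nearKer : Integrable (fun z : Rn n => min 1 ‖z‖ * nearKer n s z) :=
  integrable_mul_nearKer hn hs (C := 1) (Continuous.aestronglyMeasurable (by fun_prop)) fun z => by
    rw [abs_of_nonneg (by positivity), one_mul]

lemma integrable_prod_wPair {η w : Rn n → ℝ} (hη : Continuous η) (hc : HasCompactSupport η)
    (hw : Continuous w) {C : ℝ} (hC : ∀ x z, |w x - w (x + z)| ≤ C * min 1 ‖z‖) :
    Integrable (fun q : Rn n × Rn n =>
      η q.1 ^ 2 * w q.1 * ((w q.1 - w (q.1 + q.2)) * nearKer n s q.2)) (volume.prod volume) := by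
  have hi : Integrable (fun x => η x ^ 2 * w x) := by
    have := integrable_mul_of_compact (g := fun x => η x * w x) hη (by fun_prop) hc
    refine this.congr (ae_of_all _ fun x => ?_)
    simp only
    ring
  have hm : Measurable (nearKer n s) := measurable_nearKer n s
  refine (hi.norm.mul_prod ((integrable_min_mul_nearKer hn hs).norm.const_mul C)).mono'
    (Measurable.aestronglyMeasurable (by fun_prop)) (ae_of_all _ fun q => ?_)
  rw [norm_mul, norm_mul (w q.1 - w (q.1 + q.2)), norm_mul (min 1 ‖q.2‖),
    Real.norm_eq_abs (min 1 ‖q.2‖), abs_of_nonneg (by positivity : (0 : ℝ) ≤ min 1 ‖q.2‖),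
    ← mul_assoc C]
  gcongr
  exact hC q.1 q.2

lemma integral_wPair_mul_nearKer {η w : Rn n → ℝ} (hη : Continuous η) (hc : HasCompactSupport η)
    (hw : Continuous w) {C : ℝ} (hC : ∀ x z, |w x - w (x + z)| ≤ C * min 1 ‖z‖) :
    ∫ z, wPair η w z * nearKer n s z =
      ∫ x, η x ^ 2 * w x * ∫ z, (w x - w (x + z)) * nearKer n s z := by
  simp_rw [← integral_const_mul]
  rw [integral_integral_swap (integrable_prod_wPair hn hs hη hc hw hC)]
  refine integral_congr_ae (ae_of_all _ fun z => ?_)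
  simp only [wPair]
  rw [← integral_mul_const]
  simp only [mul_assoc]

lemma integral_sqDiff_nearKer_le {η w : Rn n → ℝ} {a L : ℝ} (hη : IsCutoff η a (3 / 8) L)
    (hw : Continuous w) {B K : ℝ} (hB : ∀ x, |w x| ≤ B)
    (hK : ∀ x y, |w x - w y| ≤ K * ‖x - y‖) :
    ∫ z, sqDiff (fun x => η x * w x) z * nearKer n s z ≤
      2 * (∫ z, wPair η w z * nearKer n s z) +
        L ^ 2 * (∫ x in ball 0 (1 / 2), w x ^ 2) * ∫ z, min 1 ‖z‖ * nearKer n s z := by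
  obtain ⟨C, hC⟩ := wPair_le_min hη.continuous hη.hasCompactSupport hw hB hK
  have hm := (stronglyMeasurable_wPair hη.continuous hw)
  have i1 : Integrable (fun z => wPair η w z * nearKer n s z) :=
    integrable_mul_nearKer hn hs hm.aestronglyMeasurable hC
  have i2 : Integrable (fun z => wPair η w (-z) * nearKer n s z) := by
    refine i1.comp_neg.congr (ae_of_all _ fun z => ?_)
    simp only [nearKer_neg]
  have e2 : ∫ z, wPair η w (-z) * nearKer n s z = ∫ z, wPair η w z * nearKer n s z := by
    rw [← integral_neg_eq_self (fun z => wPair η w z * nearKer n s z)]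
    simp only [nearKer_neg]
  have i3 := (integrable_min_mul_nearKer hn hs).const_mul (L ^ 2 * ∫ x in ball 0 (1 / 2), w x ^ 2)
  rw [two_mul, ← integral_const_mul]
  nth_rw 1 [← e2]
  rw [← integral_add i2 i1, ← integral_add (i2.fun_add i1) i3]
  refine integral_mono_of_nonneg ?_ ((i2.fun_add i1).fun_add i3) ?_
  · filter_upwards [ae_ne_zero hn] with z hz
    exact mul_nonneg (sqDiff_nonneg _ z) (nearKer_nonneg hn hs hz)
  · filter_upwards [ae_ne_zero hn] with z hz
    rcases le_or_gt (1 / 8) ‖z‖ with h | h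
    · simp [nearKer_eq_zero h]
    · have h0 := nearKer_nonneg hn hs hz
      have h1 := wPair_symm hη.continuous hη.hasCompactSupport hw z
      have h2 := wComm_le hη.continuous hw hη.lip (fun x hx => hη.eq_zero x hx.le) h
      have hW : 0 ≤ ∫ x in ball 0 (1 / 2), w x ^ 2 := integral_nonneg fun _ => sq_nonneg _
      have h3 : L ^ 2 * ‖z‖ ^ 2 * (∫ x in ball 0 (1 / 2), w x ^ 2) ≤
          L ^ 2 * (∫ x in ball 0 (1 / 2), w x ^ 2) * min 1 ‖z‖ := by
        rw [min_eq_right (by linarith), mul_right_comm]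
        gcongr
        nlinarith [norm_nonneg z]
      calc sqDiff (fun x => η x * w x) z * nearKer n s z
          ≤ (wPair η w (-z) + wPair η w z +
              L ^ 2 * (∫ x in ball 0 (1 / 2), w x ^ 2) * min 1 ‖z‖) * nearKer n s z := by
            gcongr
            linarith
        _ = _ := by ring

lemma integral_sqDiff_radKer_le {f : Rn n → ℝ} (hf : Continuous f) (hc : HasCompactSupport f)
    {L : ℝ} (hL : ∀ x y, |f x - f y| ≤ L * ‖x - y‖) :
    ∫ z, sqDiff f z * radKer n s z ≤
      (∫ z, sqDiff f z * nearKer n s z) + 4 * (∫ z, farKer n s z) * ∫ x, f x ^ 2 := by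
  obtain ⟨C, hC⟩ := sqDiff_le_min hf hc hL
  have hm := (stronglyMeasurable_sqDiff hf).aestronglyMeasurable (μ := volume)
  have i1 := integrable_mul_nearKer hn hs hm hC
  have i2 := (integrable_farKer hn hs).const_mul (4 * ∫ x, f x ^ 2)
  have : 4 * (∫ z, farKer n s z) * ∫ x, f x ^ 2 = ∫ z, 4 * (∫ x, f x ^ 2) * farKer n s z := by
    rw [integral_const_mul]; ring
  rw [this, ← integral_add i1 i2]
  refine integral_mono (integrable_mul_radKer hn hs hm hC) (i1.add i2) fun z => ?_
  have h0 := farKer_nonneg hn hs z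
  have h1 := sqDiff_le_four_mul hf hc z
  calc sqDiff f z * radKer n s z = sqDiff f z * nearKer n s z + sqDiff f z * farKer n s z := by
        unfold nearKer; ring
    _ ≤ _ := by gcongr

lemma near_energy_le {η : Rn n → ℝ} {a L : ℝ} (hη : IsCutoff η a (3 / 8) L) {Λ : ℝ}
    (hΛ : 0 ≤ Λ) : ∃ C : ℝ, 0 ≤ C ∧ ∀ (ε : ℝ) (u : Rn n → ℝ) (K : ℝ) (h : Rn n), 0 < ε →
    ContDiff ℝ 1 u → (∀ x, |u x| ≤ 1) → (∀ x y, |u x - u y| ≤ K * ‖x - y‖) →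
    IsACSol n s ε u (ball 0 1) → StableInUnitBall n s ε Λ u → ‖h‖ ≤ 1 / 16 →
    ∫ z, sqDiff (fun x => η x * (u (x + h) - u x)) z * nearKer n s z ≤
      C * ((∫ x in ball 0 (1 / 2), (u (x + h) - u x) ^ 2) + ‖h‖ ^ 2) +
        12 * ε ^ (-s) * K * ‖h‖ * ∫ x, (η x * (u (x + h) - u x)) ^ 2 := by
  obtain ⟨C₁, hC₁, hF⟩ := farKer_convolution_lipschitz hn hs
  set A := ∫ z, farKer n s z with hA
  have hA0 : 0 ≤ A := integral_nonneg (farKer_nonneg hn hs)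
  set M := ∫ z : Rn n, min 1 ‖z‖ * nearKer n s z with hM
  have hM0 : 0 ≤ M := integral_nonneg_of_ae <| by
    filter_upwards [ae_ne_zero hn] with z hz
    exact mul_nonneg (by positivity) (nearKer_nonneg hn hs hz)
  have iη := integrable_sq_of_compact hη.continuous hη.hasCompactSupport
  have hη0 : 0 ≤ ∫ x, η x ^ 2 := integral_nonneg fun _ => sq_nonneg _
  refine ⟨2 * (1 + 2 * A + 2 * Λ + L ^ 2 * M) + 2 * C₁ ^ 2 * ∫ x, η x ^ 2, by positivity, ?_⟩
  intro ε u K h hε hu hu1 hK hsol hst hh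
  set w : Rn n → ℝ := fun x => u (x + h) - u x with hw
  have huc := hu.continuous
  have hwd : ContDiff ℝ 1 w := by
    rw [hw]; exact (hu.comp (contDiff_id.add contDiff_const)).sub hu
  have hwc : Continuous w := hwd.continuous
  have hw2 : ∀ x, |w x| ≤ 2 := fun x => by
    have := abs_sub (u (x + h)) (u x)
    linarith [hu1 (x + h), hu1 x]
  have hwK : ∀ x, |w x| ≤ K * ‖h‖ := fun x => by
    have := hK (x + h) x
    rwa [add_sub_cancel_left] at this
  have hwL : ∀ x y, |w x - w y| ≤ 2 * K * ‖x - y‖ := fun x y => by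
    have h1 := hK (x + h) (y + h)
    have h2 := hK x y
    rw [add_sub_add_right_eq_sub] at h1
    have h3 := abs_sub (u (x + h) - u (y + h)) (u x - u y)
    have : w x - w y = u (x + h) - u (y + h) - (u x - u y) := by simp only [hw]; ring
    rw [this]
    linarith
  set ξ : Rn n → ℝ := fun x => η x * w x with hξ
  have hξc : Continuous ξ := hη.continuous.mul hwc
  have hξs : HasCompactSupport ξ := hη.hasCompactSupport.mul_right
  have iξ := integrable_sq_of_compact hξc hξs
  have hξL : ∃ L', ∀ x y, |ξ x - ξ y| ≤ L' * ‖x - y‖ := by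
    refine ⟨L * 2 + 2 * K, fun x y => ?_⟩
    have : ξ x - ξ y = (η x - η y) * w x + η y * (w x - w y) := by simp only [hξ]; ring
    rw [this]
    have h1 := abs_add_le ((η x - η y) * w x) (η y * (w x - w y))
    rw [abs_mul, abs_mul, abs_of_nonneg (hη.nonneg y)] at h1
    have h2 := mul_le_mul (hη.lip x y) (hw2 x) (abs_nonneg _)
      (mul_nonneg hη.lip_nonneg (norm_nonneg _))
    have h3 := mul_le_mul (hη.le_one y) (hwL x y) (abs_nonneg _) zero_le_one
    linarith
  obtain ⟨L', hL'⟩ := hξL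
  have s1 := integral_sqDiff_nearKer_le hn hs hη hwc hw2 hwL
  have s2 := integral_sqDiff_radKer_le hn hs hξc hξs hL'
  have s3 := hst ξ (hη.isCc1On_mul (by norm_num) hwd)
  have s4 := hη.integral_sq_mul_le hwc (r := 1 / 2) (by norm_num)
  have hmin := abs_sub_le_min hw2 hwL
  have iV : Integrable (fun x => (1 - 3 * u x ^ 2) * ξ x ^ 2) := by
    have := integrable_mul_of_compact (g := fun x => (1 - 3 * u x ^ 2) * ξ x) hξc
      (by fun_prop) hξs
    refine this.congr (ae_of_all _ fun x => ?_)
    simp only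
    ring
  have s5 : ∫ z, wPair η w z * nearKer n s z ≤
      ∫ x, (1 / 2 * ξ x ^ 2 + 1 / 2 * C₁ ^ 2 * ‖h‖ ^ 2 * η x ^ 2 +
        ε ^ (-s) * ((1 - 3 * u x ^ 2) * ξ x ^ 2) + 3 * ε ^ (-s) * K * ‖h‖ * ξ x ^ 2) := by
    rw [integral_wPair_mul_nearKer hn hs hη.continuous hη.hasCompactSupport hwc hmin]
    have ip := (integrable_prod_wPair hn hs hη.continuous hη.hasCompactSupport hwc
      hmin).integral_prod_left
    simp only [integral_const_mul] at ip
    refine integral_mono ip ((((iξ.const_mul _).add (iη.const_mul _)).add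
      (iV.const_mul _)).add (iξ.const_mul _)) fun x => ?_
    simp only
    by_cases hx : 3 / 8 ≤ ‖x‖
    · simp [hξ, hη.eq_zero x hx]
    rw [not_le] at hx
    have hxb : x ∈ ball (0 : Rn n) 1 := by rw [mem_ball_zero_iff]; linarith
    have hxhb : x + h ∈ ball (0 : Rn n) 1 := by
      rw [mem_ball_zero_iff]; linarith [norm_add_le x h]
    rw [increment_equation hn hs huc hu1 hK hsol hxb hxhb hw]
    have hFx : |∫ z, w (x + z) * farKer n s z| ≤ C₁ * ‖h‖ := hF u huc hu1 h x hh
    set F := ∫ z, w (x + z) * farKer n s z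
    have hε' : 0 < ε ^ (-s) := Real.rpow_pos_of_pos hε _
    have t1 : η x ^ 2 * w x * F ≤ 1 / 2 * ξ x ^ 2 + 1 / 2 * C₁ ^ 2 * ‖h‖ ^ 2 * η x ^ 2 := by
      have hF2 : F ^ 2 ≤ C₁ ^ 2 * ‖h‖ ^ 2 := by
        rw [← mul_pow]; exact sq_le_sq.2 (hFx.trans (le_abs_self _))
      have := mul_le_mul_of_nonneg_left hF2 (sq_nonneg (η x))
      have e := sq_nonneg (η x * w x - η x * F)
      simp only [hξ]
      nlinarith
    have t2 : 1 - (u (x + h) ^ 2 + u (x + h) * u x + u x ^ 2) ≤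
        1 - 3 * u x ^ 2 + 3 * (K * ‖h‖) := by
      have e : u (x + h) = u x + w x := by simp only [hw]; ring
      rw [e]
      have h1 := abs_le.1 (hu1 x)
      have h2 := abs_le.1 (hwK x)
      have h3 : -(u x * w x) ≤ K * ‖h‖ := by
        refine (neg_le_abs _).trans ?_
        rw [abs_mul]
        exact (mul_le_of_le_one_left (abs_nonneg _) (hu1 x)).trans (hwK x)
      nlinarith [sq_nonneg (w x)]
    have t3 : ε ^ (-s) * ((1 - (u (x + h) ^ 2 + u (x + h) * u x + u x ^ 2)) * ξ x ^ 2) ≤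
        ε ^ (-s) * ((1 - 3 * u x ^ 2 + 3 * (K * ‖h‖)) * ξ x ^ 2) := by gcongr
    have t4 : 0 ≤ A * ξ x ^ 2 := by positivity
    have e : η x ^ 2 * w x * (-(A * w x) + F +
        ε ^ (-s) * ((1 - (u (x + h) ^ 2 + u (x + h) * u x + u x ^ 2)) * w x)) =
        -(A * ξ x ^ 2) + η x ^ 2 * w x * F +
        ε ^ (-s) * ((1 - (u (x + h) ^ 2 + u (x + h) * u x + u x ^ 2)) * ξ x ^ 2) := by
      simp only [hξ]; ring
    rw [e]
    linarith
  have s6 : ∫ x, (1 / 2 * ξ x ^ 2 + 1 / 2 * C₁ ^ 2 * ‖h‖ ^ 2 * η x ^ 2 +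
        ε ^ (-s) * ((1 - 3 * u x ^ 2) * ξ x ^ 2) + 3 * ε ^ (-s) * K * ‖h‖ * ξ x ^ 2) =
      1 / 2 * (∫ x, ξ x ^ 2) + 1 / 2 * C₁ ^ 2 * ‖h‖ ^ 2 * (∫ x, η x ^ 2) +
        ε ^ (-s) * (∫ x, (1 - 3 * u x ^ 2) * ξ x ^ 2) +
        3 * ε ^ (-s) * K * ‖h‖ * ∫ x, ξ x ^ 2 := by
    simp_rw [← integral_const_mul]
    rw [← integral_add (iξ.const_mul _) (iη.const_mul _),
      ← integral_add ((iξ.const_mul _).fun_add (iη.const_mul _)) (iV.const_mul _)]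
    exact integral_add (((iξ.const_mul _).fun_add (iη.const_mul _)).fun_add
      (iV.const_mul _)) (iξ.const_mul _)
  rw [s6] at s5
  set E := ∫ z, sqDiff ξ z * nearKer n s z
  set X := ∫ x, ξ x ^ 2
  set Y := ∫ x in ball (0 : Rn n) (1 / 2), w x ^ 2
  set N := ∫ x, η x ^ 2
  have hY : 0 ≤ Y := integral_nonneg fun _ => sq_nonneg _
  have hX : X ≤ Y := s4
  have m1 := mul_le_mul_of_nonneg_left hX hA0
  have m2 := mul_le_mul_of_nonneg_left hX hΛ
  have m3 : 0 ≤ C₁ ^ 2 * N * Y := by positivity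
  have m4 : 0 ≤ (1 + 2 * A + 2 * Λ + L ^ 2 * M) * ‖h‖ ^ 2 := by positivity
  change E ≤ _
  linarith
end
end

noncomputable section

/-- The tent function of radius `τ` centred at the origin. -/
def tent {n : ℕ} (τ : ℝ) (z : Rn n) : ℝ := max 0 (τ - ‖z‖)

section
variable {n : ℕ}

lemma tent_nonneg (τ : ℝ) (z : Rn n) : 0 ≤ tent τ z := le_max_left _ _

lemma tent_le {τ : ℝ} (hτ : 0 ≤ τ) (z : Rn n) : tent τ z ≤ τ :=
  max_le hτ (by linarith [norm_nonneg z])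

lemma tent_eq_zero {τ : ℝ} {z : Rn n} (hz : τ ≤ ‖z‖) : tent τ z = 0 :=
  max_eq_left (by linarith)

lemma tent_lip (τ : ℝ) (z y : Rn n) : |tent τ z - tent τ y| ≤ ‖z - y‖ := by
  unfold tent
  refine (abs_max_sub_max_le_max _ _ _ _).trans ?_
  rw [sub_self, abs_zero, sub_sub_sub_cancel_left, max_eq_right (abs_nonneg _), norm_sub_rev]
  exact abs_norm_sub_norm_le _ _

lemma continuous_tent (τ : ℝ) : Continuous (tent τ : Rn n → ℝ) := by
  unfold tent; fun_prop

lemma hasCompactSupport_tent (τ : ℝ) : HasCompactSupport (tent τ : Rn n → ℝ) :=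
  HasCompactSupport.intro (isCompact_closedBall (0 : Rn n) τ) fun z hz => by
    rw [mem_closedBall_zero_iff, not_le] at hz
    exact tent_eq_zero hz.le

lemma integrable_tent (τ : ℝ) : Integrable (tent τ : Rn n → ℝ) :=
  (continuous_tent τ).integrable_of_hasCompactSupport (hasCompactSupport_tent τ)

lemma integral_tent_ge {τ : ℝ} (hτ : 0 < τ) :
    (τ / 2) ^ (n + 1) * volume.real (ball (0 : Rn n) 1) ≤ ∫ z : Rn n, tent τ z := by
  have h1 : ∫ z in ball (0 : Rn n) (τ / 2), τ / 2 ≤ ∫ z in ball (0 : Rn n) (τ / 2), tent τ z := by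
    refine setIntegral_mono_on (integrableOn_const measure_ball_lt_top.ne)
      (integrable_tent τ).integrableOn measurableSet_ball
      fun z hz => ?_
    rw [mem_ball_zero_iff] at hz
    exact le_max_of_le_right (by linarith)
  have h2 : ∫ z in ball (0 : Rn n) (τ / 2), tent τ z ≤ ∫ z : Rn n, tent τ z :=
    setIntegral_le_integral (integrable_tent τ) (ae_of_all _ (tent_nonneg τ))
  have h3 : volume.real (ball (0 : Rn n) (τ / 2)) =
      (τ / 2) ^ n * volume.real (ball (0 : Rn n) 1) := by
    rw [measureReal_def, Measure.addHaar_ball_of_pos _ _ (by positivity), ENNReal.toReal_mul,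
      ENNReal.toReal_ofReal (by positivity), finrank_euclideanSpace, Fintype.card_fin,
      ← measureReal_def]
  rw [setIntegral_const, smul_eq_mul, h3] at h1
  calc _ = (τ / 2) ^ n * volume.real (ball (0 : Rn n) 1) * (τ / 2) := by ring
    _ ≤ _ := h1.trans h2

lemma tent_convolution_le {η : Rn n → ℝ} {a L : ℝ} (hη : IsCutoff η a (3 / 8) L) {τ : ℝ}
    (hτ : 0 ≤ τ) (hτ1 : τ ≤ 1) {u : Rn n → ℝ} (hu : Continuous u) (hu1 : ∀ x, |u x| ≤ 1)
    {h : Rn n} (hh : ‖h‖ ≤ 1 / 16) (x : Rn n) :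
    |∫ z, (η (x + z) * (u (x + z + h) - u (x + z))) * tent τ z| ≤
      (L + 1) * ‖h‖ * volume.real (ball (0 : Rn n) 1) := by
  set g : Rn n → ℝ := fun y => η y * tent τ (y - x) with hg
  have hgc : Continuous g := hη.continuous.mul ((continuous_tent τ).comp (by fun_prop))
  have hgs : HasCompactSupport g := hη.hasCompactSupport.mul_right
  have hgl : ∀ y y', |g y - g y'| ≤ (L + 1) * ‖y - y'‖ := fun y y' => by
    have e : g y - g y' = (η y - η y') * tent τ (y - x) +
        η y' * (tent τ (y - x) - tent τ (y' - x)) := by simp only [hg]; ring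
    rw [e]
    have h1 := abs_add_le ((η y - η y') * tent τ (y - x))
      (η y' * (tent τ (y - x) - tent τ (y' - x)))
    rw [abs_mul, abs_mul, abs_of_nonneg (hη.nonneg y'), abs_of_nonneg (tent_nonneg _ _)] at h1
    have h2 := mul_le_mul (hη.lip y y') ((tent_le hτ (y - x)).trans hτ1) (tent_nonneg _ _)
      (mul_nonneg hη.lip_nonneg (norm_nonneg _))
    have h3 := mul_le_mul (hη.le_one y') (tent_lip τ (y - x) (y' - x)) (abs_nonneg _) zero_le_one
    rw [sub_sub_sub_cancel_right] at h3
    linarith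
  have hg0 : ∀ y, 3 / 8 ≤ ‖y‖ → g y = 0 := fun y hy => by simp [hg, hη.eq_zero y hy]
  have i1 : Integrable (fun y => g (y - h) * u y) :=
    integrable_mul_of_compact (by fun_prop) hu (hgs.comp_homeomorph (Homeomorph.subRight h))
  have i2 : Integrable (fun y => g y * u y) := integrable_mul_of_compact hgc hu hgs
  have i1' : Integrable (fun y => g y * u (y + h)) :=
    integrable_mul_of_compact hgc (by fun_prop) hgs
  have e : ∫ z, (η (x + z) * (u (x + z + h) - u (x + z))) * tent τ z =
      ∫ y, (g (y - h) - g y) * u y := by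
    simp_rw [sub_mul (g _)]
    rw [integral_sub i1 i2, ← integral_add_right_eq_self (fun y => g (y - h) * u y) h]
    simp only [add_sub_cancel_right]
    rw [← integral_sub i1' i2,
      ← integral_add_left_eq_self (fun y => g y * u (y + h) - g y * u y) x]
    refine integral_congr_ae (ae_of_all _ fun z => ?_)
    simp only [hg, add_sub_cancel_left]
    ring
  rw [e, ← setIntegral_eq_integral_of_forall_compl_eq_zero (s := ball (0 : Rn n) 1)]
  · rw [← Real.norm_eq_abs]
    refine norm_setIntegral_le_of_norm_le_const measure_ball_lt_top fun y _ => ?_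
    rw [norm_mul]
    refine (mul_le_of_le_one_right (norm_nonneg _) (hu1 y)).trans ?_
    have := hgl (y - h) y
    rwa [sub_sub_cancel_left, norm_neg] at this
  · intro y hy
    rw [mem_ball_zero_iff, not_lt] at hy
    have : ‖y‖ ≤ ‖y - h‖ + ‖h‖ := norm_le_norm_sub_add y h
    rw [hg0 y (by linarith), hg0 (y - h) (by linarith)]
    simp

lemma integral_sqDiff_mul {f φ : Rn n → ℝ} (hf : Continuous f) (hc : HasCompactSupport f)
    {B : ℝ} (hB : ∀ x, |f x| ≤ B) (hφ : Integrable φ) :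
    ∫ z, sqDiff f z * φ z =
      2 * (∫ z, φ z) * (∫ x, f x ^ 2) - 2 * ∫ x, f x * ∫ z, f (x + z) * φ z := by
  have hi : Integrable f := hf.integrable_of_hasCompactSupport hc
  have h2 := integrable_sq_of_compact hf hc
  have ip : Integrable (fun q : Rn n × Rn n => f q.1 * (f (q.1 + q.2) * φ q.2))
      (volume.prod volume) := by
    refine (hi.norm.mul_prod (hφ.norm.const_mul B)).mono' ?_ (ae_of_all _ fun q => ?_)
    · exact (hf.comp continuous_fst).aestronglyMeasurable.mul
        ((hf.comp (by fun_prop)).aestronglyMeasurable.mul hφ.aestronglyMeasurable.comp_snd)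
    · rw [norm_mul, norm_mul]
      gcongr
      exact hB _
  have e1 : ∫ x, f x * ∫ z, f (x + z) * φ z = ∫ z, (∫ x, f x * f (x + z)) * φ z := by
    simp_rw [← integral_const_mul, ← integral_mul_const]
    rw [integral_integral_swap ip]
    simp only [mul_assoc]
  have e2 : ∀ z, sqDiff f z = 2 * (∫ x, f x ^ 2) - 2 * ∫ x, f x * f (x + z) := fun z => by
    have h1 := h2.comp_add_right z
    have h3 := integrable_mul_of_compact (g := fun x => f (x + z)) hf (by fun_prop) hc
    have e := integral_add_right_eq_self (μ := (volume : Measure (Rn n))) (fun x => f x ^ 2) z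
    rw [← integral_const_mul 2 (fun x => f x * f (x + z)), two_mul]
    nth_rw 1 [← e]
    rw [← integral_add h1 h2, ← integral_sub (h1.fun_add h2) (h3.const_mul 2)]
    refine integral_congr_ae (ae_of_all _ fun x => ?_)
    simp only
    ring
  have i3 : Integrable (fun z => (∫ x, f x * f (x + z)) * φ z) := by
    refine ip.integral_prod_right.congr (ae_of_all _ fun z => ?_)
    simp only
    rw [← integral_mul_const]
    simp only [mul_assoc]
  rw [e1, ← integral_const_mul 2 φ, ← integral_const_mul 2 (fun z => _ * φ z),
    ← integral_mul_const, ← integral_sub ((hφ.const_mul 2).mul_const _) (i3.const_mul 2)]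
  refine integral_congr_ae (ae_of_all _ fun z => ?_)
  simp only [e2 z]
  ring

end

section
variable {n : ℕ} (hn : 1 ≤ n) {s : ℝ} (hs : s ∈ Ioo (0 : ℝ) 1)
include hn hs

lemma integral_sqDiff_tent_le {τ : ℝ} (hτ : 0 < τ) (hτ1 : τ ≤ 1 / 16) {f : Rn n → ℝ}
    (hf : Continuous f) (hc : HasCompactSupport f) {L : ℝ}
    (hL : ∀ x y, |f x - f y| ≤ L * ‖x - y‖) :
    ∫ z, sqDiff f z * tent τ z ≤
      2 / alphaC n s * τ ^ ((n : ℝ) + s + 1) * ∫ z, sqDiff f z * nearKer n s z := by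
  obtain ⟨C, hC⟩ := sqDiff_le_min hf hc hL
  have hα := alphaC_pos hn hs
  have i1 := integrable_mul_nearKer hn hs
    ((stronglyMeasurable_sqDiff hf).aestronglyMeasurable (μ := volume)) hC
  rw [← integral_const_mul]
  refine integral_mono_of_nonneg (ae_of_all _ fun z =>
    mul_nonneg (sqDiff_nonneg f z) (tent_nonneg τ z)) (i1.const_mul _) ?_
  filter_upwards [ae_ne_zero hn] with z hz
  have h0 := sqDiff_nonneg f z
  have h1 := nearKer_nonneg hn hs hz
  rcases le_or_gt τ ‖z‖ with h | h
  · rw [tent_eq_zero h, mul_zero]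
    positivity
  · have h2 := nearKer_lower hn hs hz h.le hτ1
    have h3 : τ ^ ((n : ℝ) + s + 1) * τ ^ (-((n : ℝ) + s)) = τ := by
      rw [← Real.rpow_add hτ]
      convert Real.rpow_one τ using 2
      ring
    have h4 : tent τ z ≤ 2 / alphaC n s * τ ^ ((n : ℝ) + s + 1) * nearKer n s z := by
      refine (tent_le hτ.le z).trans ?_
      calc τ = 2 / alphaC n s * τ ^ ((n : ℝ) + s + 1) *
            (alphaC n s / 2 * τ ^ (-((n : ℝ) + s))) := by
            rw [mul_mul_mul_comm, mul_comm (τ ^ ((n : ℝ) + s + 1)), mul_comm] at *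
            field_simp
            linarith
        _ ≤ _ := by gcongr
    calc sqDiff f z * tent τ z
        ≤ sqDiff f z * (2 / alphaC n s * τ ^ ((n : ℝ) + s + 1) * nearKer n s z) := by gcongr
      _ = _ := by ring

lemma increment_interpolation {η : Rn n → ℝ} {a L : ℝ} (hη : IsCutoff η a (3 / 8) L) {δ : ℝ}
    (hδ : 0 < δ) : ∃ C : ℝ, 0 ≤ C ∧ ∀ (u : Rn n → ℝ) (K : ℝ) (h : Rn n),
    Continuous u → (∀ x, |u x| ≤ 1) → (∀ x y, |u x - u y| ≤ K * ‖x - y‖) → ‖h‖ ≤ 1 / 16 →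
    ∫ x, (η x * (u (x + h) - u x)) ^ 2 ≤
      δ * (∫ z, sqDiff (fun x => η x * (u (x + h) - u x)) z * nearKer n s z) +
        C * ‖h‖ ^ 2 := by
  have hα := alphaC_pos hn hs
  set ω := volume.real (ball (0 : Rn n) 1) with hω
  have hω0 : 0 < ω := ENNReal.toReal_pos (Metric.measure_ball_pos _ _ one_pos).ne' measure_ball_lt_top.ne
  set c := 2 / alphaC n s * 2 ^ (n + 1) / ω with hc
  have hc0 : 0 < c := by positivity
  obtain ⟨τ, hτ0, hτ1, hτc⟩ : ∃ τ : ℝ, 0 < τ ∧ τ ≤ 1 / 16 ∧ c * τ ^ s ≤ δ := by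
    refine ⟨min (1 / 16) ((δ / c) ^ (1 / s)), by positivity, min_le_left _ _, ?_⟩
    have h1 : min (1 / 16) ((δ / c) ^ (1 / s)) ^ s ≤ ((δ / c) ^ (1 / s)) ^ s :=
      Real.rpow_le_rpow (by positivity) (min_le_right _ _) hs.1.le
    rw [← Real.rpow_mul (by positivity), one_div_mul_cancel hs.1.ne', Real.rpow_one] at h1
    calc _ ≤ c * (δ / c) := by gcongr
      _ = δ := by field_simp
  set m := ∫ z : Rn n, tent τ z with hm
  have hm1 : (τ / 2) ^ (n + 1) * ω ≤ m := integral_tent_ge hτ0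
  have hm0 : 0 < m := lt_of_lt_of_le (by positivity) hm1
  refine ⟨((L + 1) * ω) ^ 2 * ω / m ^ 2, by positivity, ?_⟩
  intro u K h hu hu1 hK hh
  set w : Rn n → ℝ := fun x => u (x + h) - u x with hw
  have hwc : Continuous w := by rw [hw]; fun_prop
  have hw2 : ∀ x, |w x| ≤ 2 := fun x => by
    have := abs_sub (u (x + h)) (u x)
    linarith [hu1 (x + h), hu1 x]
  have hwL : ∀ x y, |w x - w y| ≤ 2 * K * ‖x - y‖ := fun x y => by
    have h1 := hK (x + h) (y + h)
    have h2 := hK x y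
    rw [add_sub_add_right_eq_sub] at h1
    have h3 := abs_sub (u (x + h) - u (y + h)) (u x - u y)
    have : w x - w y = u (x + h) - u (y + h) - (u x - u y) := by simp only [hw]; ring
    rw [this]
    linarith
  set ξ : Rn n → ℝ := fun x => η x * w x with hξ
  have hξc : Continuous ξ := hη.continuous.mul hwc
  have hξs : HasCompactSupport ξ := hη.hasCompactSupport.mul_right
  have iξ := integrable_sq_of_compact hξc hξs
  have hξ2 : ∀ x, |ξ x| ≤ 2 := fun x => by
    rw [hξ, abs_mul, abs_of_nonneg (hη.nonneg x)]
    exact (mul_le_of_le_one_left (abs_nonneg _) (hη.le_one x)).trans (hw2 x)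
  obtain ⟨L', hL'⟩ : ∃ L', ∀ x y, |ξ x - ξ y| ≤ L' * ‖x - y‖ := by
    refine ⟨L * 2 + 2 * K, fun x y => ?_⟩
    have : ξ x - ξ y = (η x - η y) * w x + η y * (w x - w y) := by simp only [hξ]; ring
    rw [this]
    have h1 := abs_add_le ((η x - η y) * w x) (η y * (w x - w y))
    rw [abs_mul, abs_mul, abs_of_nonneg (hη.nonneg y)] at h1
    have h2 := mul_le_mul (hη.lip x y) (hw2 x) (abs_nonneg _)
      (mul_nonneg hη.lip_nonneg (norm_nonneg _))
    have h3 := mul_le_mul (hη.le_one y) (hwL x y) (abs_nonneg _) zero_le_one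
    linarith
  have s1 := integral_sqDiff_mul hξc hξs hξ2 (integrable_tent τ)
  have s2 := integral_sqDiff_tent_le hn hs hτ0 hτ1 hξc hξs hL'
  set D := (L + 1) * ‖h‖ * ω with hD
  have s3 : 2 * ∫ x, ξ x * ∫ z, ξ (x + z) * tent τ z ≤
      m * (∫ x, ξ x ^ 2) + D ^ 2 / m * ω := by
    have hz : ∀ x, x ∉ ball (0 : Rn n) 1 → ξ x * ∫ z, ξ (x + z) * tent τ z = 0 := fun x hx => by
      rw [mem_ball_zero_iff, not_lt] at hx
      have : ξ x = 0 := by simp only [hξ]; rw [hη.eq_zero x (by linarith), zero_mul]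
      rw [this, zero_mul]
    have hz' : ∀ x, x ∉ ball (0 : Rn n) 1 → ξ x ^ 2 = 0 := fun x hx => by
      rw [mem_ball_zero_iff, not_lt] at hx
      have : ξ x = 0 := by simp only [hξ]; rw [hη.eq_zero x (by linarith), zero_mul]
      rw [this]; simp
    rw [← setIntegral_eq_integral_of_forall_compl_eq_zero hz,
      ← setIntegral_eq_integral_of_forall_compl_eq_zero hz']
    have e : D ^ 2 / m * ω = ∫ x in ball (0 : Rn n) 1, D ^ 2 / m := by
      rw [setIntegral_const, smul_eq_mul, mul_comm]
    rw [e, ← integral_const_mul, ← integral_const_mul, ← integral_add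
      (iξ.integrableOn.const_mul _) (integrableOn_const measure_ball_lt_top.ne)]
    have hH : Continuous fun x => ∫ z, ξ (x + z) * tent τ z := by
      refine continuous_of_dominated (bound := fun z => 2 * ‖tent τ z‖)
        (fun x => (Continuous.aestronglyMeasurable
          ((hξc.comp (by fun_prop)).mul (continuous_tent τ)))) (fun x => ae_of_all _ fun z => ?_)
        ((integrable_tent τ).norm.const_mul 2)
        (ae_of_all _ fun z => by fun_prop)
      rw [norm_mul]
      gcongr
      exact hξ2 _
    refine setIntegral_mono ?_ ((iξ.integrableOn.const_mul _).fun_add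
      (integrableOn_const measure_ball_lt_top.ne)) fun x => ?_
    · exact (((hξc.mul hH).const_smul (2 : ℝ)).integrable_of_hasCompactSupport
        (hξs.mul_right.smul_left (f := fun _ => (2 : ℝ)))).integrableOn
    · have hb : |∫ z, ξ (x + z) * tent τ z| ≤ D := tent_convolution_le hη hτ0.le (by linarith)
        hu hu1 hh x
      set H := ∫ z, ξ (x + z) * tent τ z
      have hH2 : H ^ 2 ≤ D ^ 2 := sq_le_sq.2 (hb.trans (le_abs_self _))
      have h1 : 2 * (ξ x * H) ≤ m * ξ x ^ 2 + H ^ 2 / m := by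
        have := sq_nonneg (m * ξ x - H)
        rw [← sub_nonneg]
        have e : m * ξ x ^ 2 + H ^ 2 / m - 2 * (ξ x * H) = (m * ξ x - H) ^ 2 / m := by
          field_simp
          ring
        rw [e]; positivity
      refine h1.trans ?_
      gcongr
  set E := ∫ z, sqDiff ξ z * nearKer n s z
  have hE : 0 ≤ E := integral_nonneg_of_ae <| by
    filter_upwards [ae_ne_zero hn] with z hz
    exact mul_nonneg (sqDiff_nonneg _ z) (nearKer_nonneg hn hs hz)
  have s4 : m * (∫ x, ξ x ^ 2) ≤
      2 / alphaC n s * τ ^ ((n : ℝ) + s + 1) * E + D ^ 2 / m * ω := by linarith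
  have s5 : 2 / alphaC n s * τ ^ ((n : ℝ) + s + 1) ≤ δ * m := by
    have e : τ ^ ((n : ℝ) + s + 1) = τ ^ (n + 1) * τ ^ s := by
      rw [← Real.rpow_natCast, ← Real.rpow_add hτ0]
      congr 1
      push_cast
      ring
    calc _ = c * τ ^ s * ((τ / 2) ^ (n + 1) * ω) := by
          rw [e, hc, div_pow]; field_simp
      _ ≤ δ * m := by gcongr
  have s6 : m * (∫ x, ξ x ^ 2) ≤ m * (δ * E + D ^ 2 * ω / m ^ 2) := by
    calc _ ≤ δ * m * E + D ^ 2 / m * ω := s4.trans (by gcongr)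
      _ = _ := by field_simp
  have s7 := le_of_mul_le_mul_left s6 hm0
  calc _ ≤ _ := s7
    _ = _ := by rw [hD]; ring
end
end

noncomputable section
section
variable {n : ℕ}

lemma sq_norm_le_sum_sq (T : Rn n →L[ℝ] ℝ) :
    ‖T‖ ^ 2 ≤ ∑ i, T (EuclideanSpace.single i 1) ^ 2 := by
  have h0 : 0 ≤ ∑ i, T (EuclideanSpace.single i 1) ^ 2 := Finset.sum_nonneg fun _ _ => sq_nonneg _
  rw [← Real.le_sqrt (norm_nonneg _) h0]
  refine T.opNorm_le_bound (Real.sqrt_nonneg _) fun x => ?_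
  have hx : T x = ∑ i, T (EuclideanSpace.single i 1) * x i := by
    conv_lhs => rw [← (EuclideanSpace.basisFun (Fin n) ℝ).sum_repr x]
    simp [mul_comm]
  rw [hx, EuclideanSpace.norm_eq, ← Real.sqrt_mul h0, Real.norm_eq_abs]
  refine Real.abs_le_sqrt ?_
  simpa using Finset.sum_mul_sq_le_sq_mul_sq Finset.univ
    (fun i => T (EuclideanSpace.single i 1)) fun i => x i

lemma abs_sub_le_of_fderiv_le {u : Rn n → ℝ} (hu : ContDiff ℝ 1 u) {K : ℝ}
    (hK : ∀ x, ‖fderiv ℝ u x‖ ≤ K) (x y : Rn n) : |u x - u y| ≤ K * ‖x - y‖ :=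
  (convex_univ (𝕜 := ℝ)).norm_image_sub_le_of_norm_fderiv_le
    (fun _ _ => (hu.differentiable one_ne_zero).differentiableAt) (fun z _ => hK z)
    (mem_univ y) (mem_univ x)

lemma tendsto_integral_sq_increment {u g : Rn n → ℝ} (hu : ContDiff ℝ 1 u) (hg : Continuous g)
    {K : ℝ} (hK : ∀ x, ‖fderiv ℝ u x‖ ≤ K) {e : Rn n} (he : ‖e‖ = 1) {S : Set (Rn n)}
    (hgi : IntegrableOn (fun x => g x ^ 2) S) :
    Tendsto (fun t : ℝ => (∫ x in S, (g x * (u (x + t • e) - u x)) ^ 2) / t ^ 2) (𝓝[>] 0)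
      (𝓝 (∫ x in S, (g x * fderiv ℝ u x e) ^ 2)) := by
  have huc := hu.continuous
  simp_rw [← integral_div]
  refine tendsto_integral_filter_of_dominated_convergence (fun x => K ^ 2 * g x ^ 2)
    (Eventually.of_forall fun t => Continuous.aestronglyMeasurable (by fun_prop)) ?_
    (hgi.const_mul _) (ae_of_all _ fun x => ?_)
  · filter_upwards [self_mem_nhdsWithin] with t ht
    refine ae_of_all _ fun x => ?_
    have ht0 : (0 : ℝ) < t := ht
    have h1 := abs_sub_le_of_fderiv_le hu hK (x + t • e) x
    rw [add_sub_cancel_left, norm_smul, he, mul_one, Real.norm_eq_abs, abs_of_pos ht0] at h1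
    have h2 : (u (x + t • e) - u x) ^ 2 ≤ (K * t) ^ 2 := sq_le_sq.2 (h1.trans (le_abs_self _))
    rw [Real.norm_eq_abs, abs_of_nonneg (by positivity), div_le_iff₀ (by positivity), mul_pow]
    nlinarith [sq_nonneg (g x)]
  · have h1 : HasLineDerivAt ℝ u (fderiv ℝ u x e) x e :=
      ((hu.differentiable one_ne_zero x).hasFDerivAt).hasLineDerivAt e
    have h2 := ((h1.tendsto_slope_zero_right).const_mul (g x)).pow 2
    refine h2.congr' ?_
    filter_upwards [self_mem_nhdsWithin] with t ht
    have ht0 : (0 : ℝ) < t := ht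
    simp only [smul_eq_mul]
    field_simp
end

section
variable {n : ℕ} (hn : 1 ≤ n) {s : ℝ} (hs : s ∈ Ioo (0 : ℝ) 1)
include hn hs

/-- The Dirichlet energy of an almost stable solution improves on smaller balls. -/
lemma dirichlet_improvement {Λ δ : ℝ} (hΛ : 0 ≤ Λ) (hδ : 0 < δ) : ∃ C : ℝ, 0 ≤ C ∧
    ∀ (ε : ℝ) (u : Rn n → ℝ) (K : ℝ), 0 < ε → ContDiff ℝ 1 u → (∀ x, |u x| ≤ 1) →
    (∀ x, ‖fderiv ℝ u x‖ ≤ K) → IsACSol n s ε u (ball 0 1) → StableInUnitBall n s ε Λ u →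
    ∫ x in ball 0 (1 / 4), ‖fderiv ℝ u x‖ ^ 2 ≤
      δ * (∫ x in ball 0 (1 / 2), ‖fderiv ℝ u x‖ ^ 2) + C := by
  obtain ⟨η, L, hη⟩ := exists_isCutoff n (a := 1 / 4) (b := 3 / 8) (by norm_num) (by norm_num)
  obtain ⟨C₁, hC₁, H₁⟩ := near_energy_le hn hs hη hΛ
  have hn1 : (1 : ℝ) ≤ n := by exact_mod_cast hn
  set δ' := δ / (n * (C₁ + 1)) with hδ'
  have hδ'0 : 0 < δ' := by positivity
  obtain ⟨C₂, hC₂, H₂⟩ := increment_interpolation hn hs hη hδ'0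
  refine ⟨n * (δ' * C₁ + C₂), by positivity, ?_⟩
  intro ε u K hε hu hu1 hK hsol hst
  have hL := abs_sub_le_of_fderiv_le hu hK
  have iη := integrable_sq_of_compact hη.continuous hη.hasCompactSupport
  have hd : Continuous (fderiv ℝ u) := hu.continuous_fderiv one_ne_zero
  have hcont : ∀ e : Rn n, Continuous fun x => fderiv ℝ u x e := fun e => by fun_prop
  have dir : ∀ e : Rn n, ‖e‖ = 1 → ∫ x, (η x * fderiv ℝ u x e) ^ 2 ≤
      δ' * C₁ * (∫ x in ball 0 (1 / 2), fderiv ℝ u x e ^ 2) + (δ' * C₁ + C₂) := by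
    intro e he
    have t1 := tendsto_integral_sq_increment (S := univ) hu hη.continuous hK he iη.integrableOn
    have t2 := tendsto_integral_sq_increment (g := fun _ => 1) (S := ball 0 (1 / 2)) hu
      continuous_const hK he (integrableOn_const measure_ball_lt_top.ne)
    simp only [setIntegral_univ, one_mul] at t1 t2
    have t3 : Tendsto (fun t : ℝ => t) (𝓝[>] 0) (𝓝 0) := tendsto_nhdsWithin_of_tendsto_nhds
      tendsto_id
    have t4 := (((t2.const_mul (δ' * C₁)).add_const (δ' * C₁ + C₂)).add
      ((t3.const_mul (δ' * (12 * ε ^ (-s) * K))).mul t1))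
    rw [mul_zero, zero_mul, add_zero] at t4
    refine le_of_tendsto_of_tendsto t1 t4 ?_
    have : ∀ᶠ t : ℝ in 𝓝[>] 0, t < 1 / 16 :=
      (eventually_lt_nhds (by norm_num)).filter_mono nhdsWithin_le_nhds
    filter_upwards [self_mem_nhdsWithin, this] with t ht ht'
    have ht0 : (0 : ℝ) < t := ht
    have hh : ‖t • e‖ = t := by rw [norm_smul, he, mul_one, Real.norm_eq_abs, abs_of_pos ht0]
    have a1 := H₁ ε u K (t • e) hε hu hu1 hL hsol hst (by rw [hh]; exact ht'.le)
    have a2 := H₂ u K (t • e) hu.continuous hu1 hL (by rw [hh]; exact ht'.le)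
    rw [hh] at a1 a2
    set X := ∫ x, (η x * (u (x + t • e) - u x)) ^ 2
    set Y := ∫ x in ball (0 : Rn n) (1 / 2), (u (x + t • e) - u x) ^ 2
    have a3 := a2.trans (add_le_add_left (mul_le_mul_of_nonneg_left a1 hδ'0.le) _)
    rw [div_le_iff₀ (by positivity)]
    refine a3.trans_eq ?_
    field_simp
    ring
  have iD : ∀ e : Rn n, ∀ r : ℝ, IntegrableOn (fun x => fderiv ℝ u x e ^ 2) (ball 0 r) :=
    fun e r => (((hcont e).pow 2).continuousOn.integrableOn_compact
      (isCompact_closedBall (0 : Rn n) r)).mono_set ball_subset_closedBall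
  have iG : ∀ r : ℝ, IntegrableOn (fun x => ‖fderiv ℝ u x‖ ^ 2) (ball 0 r) :=
    fun r => ((hd.norm.pow 2).continuousOn.integrableOn_compact
      (isCompact_closedBall (0 : Rn n) r)).mono_set ball_subset_closedBall
  set b : Fin n → Rn n := fun i => EuclideanSpace.single i 1 with hb
  have hb1 : ∀ i, ‖b i‖ = 1 := fun i => by simp [hb]
  set G := ∫ x in ball (0 : Rn n) (1 / 2), ‖fderiv ℝ u x‖ ^ 2
  have hG : 0 ≤ G := integral_nonneg fun _ => by positivity
  calc ∫ x in ball 0 (1 / 4), ‖fderiv ℝ u x‖ ^ 2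
      ≤ ∫ x in ball 0 (1 / 4), ∑ i, fderiv ℝ u x (b i) ^ 2 :=
        setIntegral_mono (iG _) (integrable_finsetSum _ fun i _ => iD _ _)
          fun x => sq_norm_le_sum_sq _
    _ = ∑ i, ∫ x in ball 0 (1 / 4), fderiv ℝ u x (b i) ^ 2 :=
        integral_finsetSum _ fun i _ => iD _ _
    _ ≤ ∑ i : Fin n, (δ' * C₁ * G + (δ' * C₁ + C₂)) := by
        refine Finset.sum_le_sum fun i _ => ?_
        have j1 : ∫ x in ball 0 (1 / 4), fderiv ℝ u x (b i) ^ 2 ≤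
            ∫ x, (η x * fderiv ℝ u x (b i)) ^ 2 := by
          have e : ∫ x in ball 0 (1 / 4), fderiv ℝ u x (b i) ^ 2 =
              ∫ x in ball 0 (1 / 4), (η x * fderiv ℝ u x (b i)) ^ 2 := by
            refine setIntegral_congr_fun measurableSet_ball fun x hx => ?_
            rw [mem_ball_zero_iff] at hx
            rw [hη.eq_one x hx.le, one_mul]
          rw [e]
          exact setIntegral_le_integral (integrable_sq_of_compact
            (hη.continuous.mul (hcont _)) hη.hasCompactSupport.mul_right)
            (ae_of_all _ fun _ => sq_nonneg _)
        have j2 : ∫ x in ball (0 : Rn n) (1 / 2), fderiv ℝ u x (b i) ^ 2 ≤ G := by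
          refine setIntegral_mono (iD _ _) (iG _) fun x => ?_
          refine sq_le_sq.2 ?_
          have := (fderiv ℝ u x).le_opNorm (b i)
          rwa [hb1, mul_one, ← abs_norm (fderiv ℝ u x)] at this
        refine j1.trans ((dir (b i) (hb1 i)).trans ?_)
        gcongr
    _ = δ * (C₁ / (C₁ + 1)) * G + n * (δ' * C₁ + C₂) := by
        rw [Finset.sum_const, Finset.card_univ, Fintype.card_fin, nsmul_eq_mul]
        rw [hδ']
        field_simp
    _ ≤ δ * 1 * G + n * (δ' * C₁ + C₂) := by
        gcongr
        rw [div_le_one (by positivity)]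
        linarith
    _ = _ := by rw [mul_one]
end
end

noncomputable section
section
variable {n : ℕ}

lemma sq_sub_le_integral_sq_fderiv {u : Rn n → ℝ} (hu : ContDiff ℝ 1 u) (x z : Rn n) :
    (u (x + z) - u x) ^ 2 ≤
      ‖z‖ ^ 2 * ∫ t in Icc (0 : ℝ) 1, ‖fderiv ℝ u (x + t • z)‖ ^ 2 := by
  have hd : Continuous (fderiv ℝ u) := hu.continuous_fderiv one_ne_zero
  set g : ℝ → ℝ := fun t => fderiv ℝ u (x + t • z) z with hg
  have hgc : Continuous g := by rw [hg]; fun_prop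
  have hder : ∀ t ∈ uIcc (0 : ℝ) 1, HasDerivAt (fun t : ℝ => u (x + t • z)) (g t) t := by
    intro t _
    have h1 : HasDerivAt (fun t : ℝ => x + t • z) z t := by
      simpa using ((hasDerivAt_id t).smul_const z).const_add x
    exact ((hu.differentiable one_ne_zero _).hasFDerivAt).comp_hasDerivAt t h1
  have hF := intervalIntegral.integral_eq_sub_of_hasDerivAt hder (hgc.intervalIntegrable _ _)
  rw [one_smul, zero_smul, add_zero, intervalIntegral.integral_of_le zero_le_one,
    ← integral_Icc_eq_integral_Ioc] at hF
  have ig : IntegrableOn g (Icc 0 1) := hgc.continuousOn.integrableOn_compact isCompact_Icc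
  have ig2 : IntegrableOn (fun t => g t ^ 2) (Icc 0 1) :=
    (hgc.pow 2).continuousOn.integrableOn_compact isCompact_Icc
  have iG : IntegrableOn (fun t : ℝ => ‖fderiv ℝ u (x + t • z)‖ ^ 2) (Icc 0 1) :=
    Continuous.integrableOn_Icc (by fun_prop)
  set m := ∫ t in Icc (0 : ℝ) 1, g t with hm
  have h1 : 0 ≤ ∫ t in Icc (0 : ℝ) 1, (g t - m) ^ 2 := integral_nonneg fun _ => sq_nonneg _
  have h2 : ∫ t in Icc (0 : ℝ) 1, (g t - m) ^ 2 = (∫ t in Icc (0 : ℝ) 1, g t ^ 2) - m ^ 2 := by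
    have e : ∀ t, (g t - m) ^ 2 = g t ^ 2 - (2 * m * g t - m ^ 2) := fun t => by ring
    simp_rw [e]
    have il : IntegrableOn (fun t => 2 * m * g t - m ^ 2) (Icc 0 1) :=
      (ig.const_mul _).sub (integrableOn_const (by simp))
    rw [integral_sub ig2 il,
      integral_sub (ig.const_mul _) (integrableOn_const (by simp)), integral_const_mul, ← hm,
      setIntegral_const]
    simp
    ring
  have h3 : ∫ t in Icc (0 : ℝ) 1, g t ^ 2 ≤
      ‖z‖ ^ 2 * ∫ t in Icc (0 : ℝ) 1, ‖fderiv ℝ u (x + t • z)‖ ^ 2 := by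
    rw [← integral_const_mul]
    refine setIntegral_mono ig2 (iG.const_mul _) fun t => ?_
    have := (fderiv ℝ u (x + t • z)).le_opNorm z
    rw [← mul_pow, mul_comm]
    exact sq_le_sq.2 (by rwa [abs_of_nonneg (by positivity : 0 ≤ ‖fderiv ℝ u (x + t • z)‖ * ‖z‖)])
  rw [← hF]
  linarith

lemma setLIntegral_translate_le {f : Rn n → ENNReal} {S T : Set (Rn n)} (hS : MeasurableSet S)
    (hT : MeasurableSet T) {y : Rn n} (h : ∀ x ∈ S, x + y ∈ T) :
    ∫⁻ x in S, f (x + y) ≤ ∫⁻ x in T, f x := by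
  rw [← lintegral_indicator hS, ← lintegral_indicator hT,
    ← lintegral_add_right_eq_self (T.indicator f) y]
  refine lintegral_mono fun x => ?_
  by_cases hx : x ∈ S
  · simp [hx, h x hx]
  · simp [hx]

lemma setIntegral_sq_increment_le {u : Rn n → ℝ} (hu : ContDiff ℝ 1 u) {S T : Set (Rn n)}
    (hS : MeasurableSet S) (hT : MeasurableSet T) {z : Rn n}
    (h : ∀ x ∈ S, ∀ t ∈ Icc (0 : ℝ) 1, x + t • z ∈ T)
    (hG : IntegrableOn (fun x => ‖fderiv ℝ u x‖ ^ 2) T) :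
    ∫ x in S, (u (x + z) - u x) ^ 2 ≤ ‖z‖ ^ 2 * ∫ x in T, ‖fderiv ℝ u x‖ ^ 2 := by
  have hd : Continuous (fderiv ℝ u) := hu.continuous_fderiv one_ne_zero
  have huc := hu.continuous
  have hT0 : 0 ≤ ∫ x in T, ‖fderiv ℝ u x‖ ^ 2 := integral_nonneg fun _ => by positivity
  rw [integral_eq_lintegral_of_nonneg_ae (ae_of_all _ fun _ => sq_nonneg _)
    (Continuous.aestronglyMeasurable (by fun_prop))]
  refine ENNReal.toReal_le_of_le_ofReal (by positivity) ?_
  rw [ENNReal.ofReal_mul (by positivity), ofReal_integral_eq_lintegral_ofReal hG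
    (ae_of_all _ fun _ => by positivity)]
  calc ∫⁻ x in S, ENNReal.ofReal ((u (x + z) - u x) ^ 2)
      ≤ ∫⁻ x in S, ENNReal.ofReal (‖z‖ ^ 2) *
          ∫⁻ t in Icc (0 : ℝ) 1, ENNReal.ofReal (‖fderiv ℝ u (x + t • z)‖ ^ 2) := by
        refine lintegral_mono fun x => ?_
        refine (ENNReal.ofReal_le_ofReal (sq_sub_le_integral_sq_fderiv hu x z)).trans ?_
        rw [ENNReal.ofReal_mul (by positivity), ofReal_integral_eq_lintegral_ofReal
          (Continuous.integrableOn_Icc (by fun_prop)) (ae_of_all _ fun _ => by positivity)]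
    _ = ENNReal.ofReal (‖z‖ ^ 2) * ∫⁻ t in Icc (0 : ℝ) 1,
          ∫⁻ x in S, ENNReal.ofReal (‖fderiv ℝ u (x + t • z)‖ ^ 2) := by
        rw [lintegral_const_mul' _ _ ENNReal.ofReal_ne_top, lintegral_lintegral_swap]
        exact Measurable.aemeasurable (by
          apply ENNReal.measurable_ofReal.comp
          apply Continuous.measurable
          fun_prop)
    _ ≤ ENNReal.ofReal (‖z‖ ^ 2) * ∫⁻ t in Icc (0 : ℝ) 1,
          ∫⁻ x in T, ENNReal.ofReal (‖fderiv ℝ u x‖ ^ 2) := by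
        gcongr 1
        refine setLIntegral_mono' measurableSet_Icc fun t ht => ?_
        exact setLIntegral_translate_le (f := fun x => ENNReal.ofReal (‖fderiv ℝ u x‖ ^ 2)) hS hT
          fun x hx => h x hx t ht
    _ = _ := by simp

end

section
variable {n : ℕ} (hn : 1 ≤ n) {s : ℝ} (hs : s ∈ Ioo (0 : ℝ) 1)
include hn hs

lemma integral_min_mul_radKer_scaled {τ : ℝ} (hτ : 0 < τ) :
    Integrable (fun z : Rn n => min 1 (‖z‖ / τ) * radKer n s z) ∧
    ∫ z : Rn n, min 1 (‖z‖ / τ) * radKer n s z =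
      τ ^ (-s) * ∫ z : Rn n, min 1 ‖z‖ * radKer n s z := by
  have e : ∀ z : Rn n, min 1 (‖τ • z‖ / τ) * radKer n s (τ • z) =
      τ ^ (-((n : ℝ) + s)) * (min 1 ‖z‖ * radKer n s z) := fun z => by
    have h1 : ‖τ • z‖ = τ * ‖z‖ := by rw [norm_smul, Real.norm_eq_abs, abs_of_pos hτ]
    rw [radKer, radKer, h1, mul_div_cancel_left₀ _ hτ.ne', Real.mul_rpow hτ.le (norm_nonneg _)]
    ring
  have hi := integrable_min_mul_radKer hn hs
  constructor
  · rw [← integrable_comp_smul_iff volume _ hτ.ne']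
    simp_rw [e]
    exact hi.const_mul _
  · have := Measure.integral_comp_smul (volume : Measure (Rn n))
      (fun z => min 1 (‖z‖ / τ) * radKer n s z) τ
    simp_rw [e] at this
    rw [integral_const_mul, finrank_euclideanSpace, Fintype.card_fin, smul_eq_mul,
      abs_of_nonneg (by positivity)] at this
    have h2 : τ ^ (-((n : ℝ) + s)) = (τ ^ n)⁻¹ * τ ^ (-s) := by
      rw [neg_add, Real.rpow_add hτ, Real.rpow_neg hτ.le, Real.rpow_natCast]
    rw [h2, mul_assoc] at this
    exact (mul_left_cancel₀ (by positivity) this).symm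

lemma integral_sqDiff_radKer_le_of_small {f : Rn n → ℝ} (hf : Continuous f)
    (hc : HasCompactSupport f) {τ A : ℝ} (hτ : 0 < τ) (hA : 0 ≤ A)
    (h : ∀ z, ‖z‖ < τ → sqDiff f z ≤ ‖z‖ ^ 2 * A) :
    ∫ z, sqDiff f z * radKer n s z ≤
      τ ^ (-s) * (∫ z : Rn n, min 1 ‖z‖ * radKer n s z) * (τ ^ 2 * A + 4 * ∫ x, f x ^ 2) := by
  obtain ⟨hi, he⟩ := integral_min_mul_radKer_scaled hn hs hτ
  rw [← he, ← integral_mul_const]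
  have hB : 0 ≤ ∫ x, f x ^ 2 := integral_nonneg fun _ => sq_nonneg _
  refine integral_mono_of_nonneg (ae_of_all _ fun z =>
    mul_nonneg (sqDiff_nonneg f z) (radKer_nonneg hn hs z)) (hi.mul_const _)
    (ae_of_all _ fun z => ?_)
  have h0 := radKer_nonneg hn hs z
  simp only
  rw [mul_right_comm]
  refine mul_le_mul_of_nonneg_right ?_ h0
  rcases le_or_gt τ ‖z‖ with hz | hz
  · rw [min_eq_left ((one_le_div hτ).2 hz), one_mul]
    have := sqDiff_le_four_mul hf hc z
    have : 0 ≤ τ ^ 2 * A := by positivity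
    linarith
  · have h1 : ‖z‖ / τ ≤ 1 := (div_le_one hτ).2 hz.le
    rw [min_eq_right h1]
    have h2 : ‖z‖ ^ 2 * A = ‖z‖ / τ * (‖z‖ / τ * (τ ^ 2 * A)) := by field_simp
    refine (h z hz).trans ?_
    rw [h2]
    refine mul_le_mul_of_nonneg_left ?_ (by positivity)
    have : ‖z‖ / τ * (τ ^ 2 * A) ≤ 1 * (τ ^ 2 * A) := by gcongr
    linarith

end
end

noncomputable section
section
variable {n : ℕ}

lemma integral_cutoff_sq_increment_le {η : Rn n → ℝ} {a L : ℝ} (hη : IsCutoff η a (1 / 8) L)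
    {u : Rn n → ℝ} (hu : ContDiff ℝ 1 u) (hu1 : ∀ x, |u x| ≤ 1) (z : Rn n) :
    ∫ x, η x ^ 2 * (u x - u (x + z)) ^ 2 ≤ min 1 ‖z‖ ^ 2 *
      ((∫ x in ball 0 (1 / 4), ‖fderiv ℝ u x‖ ^ 2) + 256 * volume.real (ball (0 : Rn n) 1)) := by
  have huc := hu.continuous
  have hd : Continuous (fderiv ℝ u) := hu.continuous_fderiv one_ne_zero
  have iG : ∀ r : ℝ, IntegrableOn (fun x => ‖fderiv ℝ u x‖ ^ 2) (ball 0 r) :=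
    fun r => ((hd.norm.pow 2).continuousOn.integrableOn_compact
      (isCompact_closedBall (0 : Rn n) r)).mono_set ball_subset_closedBall
  have hG : 0 ≤ ∫ x in ball (0 : Rn n) (1 / 4), ‖fderiv ℝ u x‖ ^ 2 :=
    integral_nonneg fun _ => by positivity
  have iη := integrable_sq_of_compact hη.continuous hη.hasCompactSupport
  have i1 : Integrable (fun x => η x ^ 2 * (u x - u (x + z)) ^ 2) := by
    have := integrable_sq_of_compact (f := fun x => η x * (u x - u (x + z)))
      (hη.continuous.mul (by fun_prop)) hη.hasCompactSupport.mul_right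
    simpa only [mul_pow] using this
  rcases lt_or_ge ‖z‖ (1 / 8) with hz | hz
  · have h0 : ∀ x, x ∉ ball (0 : Rn n) (1 / 8) → η x ^ 2 * (u x - u (x + z)) ^ 2 = 0 :=
      fun x hx => by
        rw [mem_ball_zero_iff, not_lt] at hx
        rw [hη.eq_zero x hx]; simp
    rw [← setIntegral_eq_integral_of_forall_compl_eq_zero h0, min_eq_right (by linarith)]
    have hsq : IntegrableOn (fun x => (u (x + z) - u x) ^ 2) (ball (0 : Rn n) (1 / 8)) :=
      (Continuous.continuousOn (by fun_prop)).integrableOn_compact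
        (isCompact_closedBall (0 : Rn n) (1 / 8)) |>.mono_set ball_subset_closedBall
    have h1 : ∫ x in ball 0 (1 / 8), η x ^ 2 * (u x - u (x + z)) ^ 2 ≤
        ∫ x in ball 0 (1 / 8), (u (x + z) - u x) ^ 2 := by
      refine setIntegral_mono i1.integrableOn hsq fun x => ?_
      have : (u x - u (x + z)) ^ 2 = (u (x + z) - u x) ^ 2 := by ring
      rw [this]
      exact mul_le_of_le_one_left (sq_nonneg _) (hη.sq_le_one x)
    have h2 := setIntegral_sq_increment_le hu (S := ball 0 (1 / 8)) (T := ball 0 (1 / 4)) (z := z)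
      measurableSet_ball measurableSet_ball (fun x hx t ht => ?_) (iG _)
    · have : 0 ≤ ‖z‖ ^ 2 * (256 * volume.real (ball (0 : Rn n) 1)) := by positivity
      linarith
    · rw [mem_ball_zero_iff] at hx ⊢
      have : ‖t • z‖ ≤ 1 * ‖z‖ := by
        rw [norm_smul, Real.norm_eq_abs, abs_of_nonneg ht.1]
        gcongr
        exact ht.2
      linarith [norm_add_le x (t • z)]
  · have h1 : ∫ x, η x ^ 2 * (u x - u (x + z)) ^ 2 ≤ ∫ x in ball (0 : Rn n) 1, (4 : ℝ) := by
      have h0 : ∀ x, x ∉ ball (0 : Rn n) 1 → η x ^ 2 * (u x - u (x + z)) ^ 2 = 0 :=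
        fun x hx => by
          rw [mem_ball_zero_iff, not_lt] at hx
          rw [hη.eq_zero x (by linarith)]; simp
      rw [← setIntegral_eq_integral_of_forall_compl_eq_zero h0]
      refine setIntegral_mono i1.integrableOn (integrableOn_const measure_ball_lt_top.ne)
        fun x => ?_
      refine (mul_le_of_le_one_left (sq_nonneg _) (hη.sq_le_one x)).trans ?_
      have h3 := abs_le.1 (hu1 x)
      have h4 := abs_le.1 (hu1 (x + z))
      nlinarith
    rw [setIntegral_const, smul_eq_mul] at h1
    have h2 : 1 / 8 ≤ min 1 ‖z‖ := le_min (by norm_num) hz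
    have h3 : (1 / 8 : ℝ) ^ 2 ≤ min 1 ‖z‖ ^ 2 := by gcongr
    have h4 : (0 : ℝ) ≤ volume.real (ball (0 : Rn n) 1) := measureReal_nonneg
    nlinarith

lemma sq_increment_cutoff_le {a b : ℝ} (ha : |a| ≤ 1) (hb : |b| ≤ 1) (p r : ℝ) :
    (r * (1 - b ^ 2) - p * (1 - a ^ 2)) ^ 2 ≤ 2 * (r - p) ^ 2 + 8 * (p ^ 2 * (a - b) ^ 2) := by
  have h1 := abs_le.1 ha
  have h2 := abs_le.1 hb
  have h3 : 0 ≤ 1 - b ^ 2 := by nlinarith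
  have h4 : 1 - b ^ 2 ≤ 1 := by nlinarith [sq_nonneg b]
  have h5 : (1 - b ^ 2) ^ 2 ≤ 1 := by nlinarith
  have h6 : (a + b) ^ 2 ≤ 4 := by nlinarith
  have h7 : ((r - p) * (1 - b ^ 2)) ^ 2 ≤ (r - p) ^ 2 := by
    rw [mul_pow]
    exact mul_le_of_le_one_right (sq_nonneg _) h5
  have h8 : (p * (a - b) * (a + b)) ^ 2 ≤ p ^ 2 * (a - b) ^ 2 * 4 := by
    rw [mul_pow, mul_pow]
    gcongr
  have e : r * (1 - b ^ 2) - p * (1 - a ^ 2) =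
      (r - p) * (1 - b ^ 2) + p * (a - b) * (a + b) := by ring
  rw [e]
  linarith [two_mul_le_add_sq ((r - p) * (1 - b ^ 2)) (p * (a - b) * (a + b)),
    add_sq ((r - p) * (1 - b ^ 2)) (p * (a - b) * (a + b))]

lemma sqDiff_cutoff_le {η : Rn n → ℝ} {a L : ℝ} (hη : IsCutoff η a (1 / 8) L)
    {u : Rn n → ℝ} (hu : ContDiff ℝ 1 u) (hu1 : ∀ x, |u x| ≤ 1) {z : Rn n} (hz8 : ‖z‖ < 1 / 8) :
    sqDiff (fun x => η x * (1 - u x ^ 2)) z ≤ ‖z‖ ^ 2 *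
      (2 * L ^ 2 * volume.real (ball (0 : Rn n) 1) +
        8 * ((∫ x in ball 0 (1 / 4), ‖fderiv ℝ u x‖ ^ 2) +
          256 * volume.real (ball (0 : Rn n) 1))) := by
  have huc := hu.continuous
  have hηc := hη.continuous
  set ω := volume.real (ball (0 : Rn n) 1) with hω
  set G := ∫ x in ball (0 : Rn n) (1 / 4), ‖fderiv ℝ u x‖ ^ 2 with hGdef
  set v : Rn n → ℝ := fun x => η x * (1 - u x ^ 2) with hv
  have hvc : Continuous v := by rw [hv]; fun_prop
  have hvs : HasCompactSupport v := hη.hasCompactSupport.mul_right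
  have b1 := integral_cutoff_sq_increment_le hη hu hu1 z
  rw [min_eq_right (by linarith : ‖z‖ ≤ 1)] at b1
  have i3 : Integrable (fun x => η x ^ 2 * (u x - u (x + z)) ^ 2) := by
    have := integrable_sq_of_compact (f := fun x => η x * (u x - u (x + z)))
      (hη.continuous.mul (by fun_prop)) hη.hasCompactSupport.mul_right
    simpa only [mul_pow] using this
  have i4 := integrable_sqDiff_integrand hη.continuous hη.hasCompactSupport z
  have b2 : ∫ x, (η (x + z) - η x) ^ 2 ≤ L ^ 2 * ‖z‖ ^ 2 * ω := by
    have h0 : ∀ x, x ∉ ball (0 : Rn n) 1 → (η (x + z) - η x) ^ 2 = 0 := fun x hx => by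
      rw [mem_ball_zero_iff, not_lt] at hx
      have : ‖x‖ ≤ ‖x + z‖ + ‖z‖ := by simpa using norm_sub_le (x + z) z
      rw [hη.eq_zero x (by linarith), hη.eq_zero (x + z) (by linarith)]
      simp
    rw [← setIntegral_eq_integral_of_forall_compl_eq_zero h0]
    have : ∫ x in ball (0 : Rn n) 1, (η (x + z) - η x) ^ 2 ≤
        ∫ x in ball (0 : Rn n) 1, L ^ 2 * ‖z‖ ^ 2 := by
      refine setIntegral_mono i4.integrableOn (integrableOn_const measure_ball_lt_top.ne)
        fun x => ?_
      have := hη.lip (x + z) x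
      rw [add_sub_cancel_left] at this
      rw [← mul_pow]
      exact sq_le_sq.2 (this.trans (le_abs_self _))
    rw [setIntegral_const, smul_eq_mul] at this
    linarith
  calc sqDiff v z ≤ ∫ x, (2 * (η (x + z) - η x) ^ 2 +
        8 * (η x ^ 2 * (u x - u (x + z)) ^ 2)) := by
        refine integral_mono (integrable_sqDiff_integrand hvc hvs z)
          ((i4.const_mul _).fun_add (i3.const_mul _)) fun x => ?_
        exact sq_increment_cutoff_le (hu1 x) (hu1 (x + z)) _ _
    _ = 2 * (∫ x, (η (x + z) - η x) ^ 2) + 8 * ∫ x, η x ^ 2 * (u x - u (x + z)) ^ 2 := by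
        rw [integral_add (i4.const_mul _) (i3.const_mul _), integral_const_mul,
          integral_const_mul]
    _ ≤ 2 * (L ^ 2 * ‖z‖ ^ 2 * ω) + 8 * (‖z‖ ^ 2 * (G + 256 * ω)) := by gcongr
    _ = _ := by ring
end

section
variable {n : ℕ} (hn : 1 ≤ n) {s : ℝ} (hs : s ∈ Ioo (0 : ℝ) 1)
include hn hs

lemma integral_nonlinearity_le {η : Rn n → ℝ} {a L : ℝ} (hη : IsCutoff η a (1 / 8) L)
    {ε : ℝ} (hε : 0 < ε) {u : Rn n → ℝ} (hu : ContDiff ℝ 1 u) (hu1 : ∀ x, |u x| ≤ 1) {K : ℝ}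
    (hK : ∀ x, ‖fderiv ℝ u x‖ ≤ K) (hsol : IsACSol n s ε u (ball 0 1)) {M : ℝ} (hM : 0 < M)
    (hM' : ∫ z : Rn n, min 1 ‖z‖ * radKer n s z ≤ M) :
    ∫ x, (η x * (u x - u x ^ 3)) ^ 2 ≤ M ^ 2 * ε ^ (2 * s) *
      ((∫ x in ball 0 (1 / 4), ‖fderiv ℝ u x‖ ^ 2) + 256 * volume.real (ball (0 : Rn n) 1)) := by
  have huc := hu.continuous
  have hηc := hη.continuous
  have hL := abs_sub_le_of_fderiv_le hu hK
  set G := (∫ x in ball 0 (1 / 4), ‖fderiv ℝ u x‖ ^ 2) + 256 * volume.real (ball (0 : Rn n) 1)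
    with hGdef
  have hG : 0 ≤ G := add_nonneg (integral_nonneg fun _ => by positivity) (by positivity)
  set k : Rn n → ℝ := fun x => η x ^ 2 * (u x - u x ^ 3) with hk
  have hkc : Continuous k := by rw [hk]; fun_prop
  have hks : HasCompactSupport k := by
    have : k = fun x => η x * (η x * (u x - u x ^ 3)) := by
      ext x; simp only [hk]; ring
    rw [this]; exact hη.hasCompactSupport.mul_right
  have ik : Integrable k := hkc.integrable_of_hasCompactSupport hks
  have hmin := abs_sub_le_min hu1 hL
  set C := max (2 * 1) K
  have hrad := integrable_min_mul_radKer hn hs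
  have hrm : Measurable (radKer n s) := measurable_radKer n s
  have ip : Integrable (fun q : Rn n × Rn n =>
      k q.1 * ((u q.1 - u (q.1 + q.2)) * radKer n s q.2)) (volume.prod volume) := by
    refine (ik.norm.mul_prod (hrad.norm.const_mul C)).mono'
      (Measurable.aestronglyMeasurable (by fun_prop)) (ae_of_all _ fun q => ?_)
    rw [norm_mul, norm_mul (u q.1 - u (q.1 + q.2)), norm_mul (min 1 ‖q.2‖),
      Real.norm_eq_abs (min 1 ‖q.2‖), abs_of_nonneg (by positivity : (0 : ℝ) ≤ min 1 ‖q.2‖),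
      ← mul_assoc C]
    gcongr
    exact hmin q.1 q.2
  set P := ∫ x, (η x * (u x - u x ^ 3)) ^ 2 with hP
  have hP0 : 0 ≤ P := integral_nonneg fun _ => sq_nonneg _
  have iP : Integrable (fun x => (η x * (u x - u x ^ 3)) ^ 2) :=
    integrable_sq_of_compact (by fun_prop) hη.hasCompactSupport.mul_right
  set A := ε ^ (-s) with hA
  have hA0 : 0 < A := Real.rpow_pos_of_pos hε _
  have e1 : A * P = ∫ x, k x * ∫ z, (u x - u (x + z)) * radKer n s z := by
    rw [hP, ← integral_const_mul]
    refine integral_congr_ae (ae_of_all _ fun x => ?_)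
    simp only
    by_cases hx : 1 / 8 ≤ ‖x‖
    · simp [hk, hη.eq_zero x hx]
    rw [not_le] at hx
    have h1 := hsol x (by rw [mem_ball_zero_iff]; linarith)
    rw [integral_sub_mul_fracKer] at h1
    have h2 : ∫ z, (u x - u (x + z)) * radKer n s z = A * (u x - u x ^ 3) := by linarith
    rw [h2]
    simp only [hk]; ring
  have e2 : ∫ x, k x * ∫ z, (u x - u (x + z)) * radKer n s z =
      ∫ z, (∫ x, k x * (u x - u (x + z))) * radKer n s z := by
    simp_rw [← integral_const_mul, ← integral_mul_const]
    rw [integral_integral_swap ip]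
    simp only [mul_assoc]
  have i2 : Integrable (fun z => (∫ x, k x * (u x - u (x + z))) * radKer n s z) := by
    refine ip.integral_prod_right.congr (ae_of_all _ fun z => ?_)
    simp only
    rw [← integral_mul_const]
    simp only [mul_assoc]
  set θ := A / M with hθ
  have hθ0 : 0 < θ := by positivity
  have e3 : ∫ z, (∫ x, k x * (u x - u (x + z))) * radKer n s z ≤
      1 / 2 * (θ * P + G / θ) * ∫ z : Rn n, min 1 ‖z‖ * radKer n s z := by
    rw [← integral_const_mul]
    refine integral_mono_ae i2 (hrad.const_mul _) ?_
    filter_upwards [ae_ne_zero hn] with z hz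
    have h0 := radKer_nonneg hn hs z
    set m := min 1 ‖z‖ with hm
    have hm0 : 0 < m := lt_min one_pos (norm_pos_iff.2 hz)
    rw [← mul_assoc]
    refine mul_le_mul_of_nonneg_right ?_ h0
    have i3 : Integrable (fun x => η x ^ 2 * (u x - u (x + z)) ^ 2) := by
      have := integrable_sq_of_compact (f := fun x => η x * (u x - u (x + z)))
        (hη.continuous.mul (by fun_prop)) hη.hasCompactSupport.mul_right
      simpa only [mul_pow] using this
    calc ∫ x, k x * (u x - u (x + z))
        ≤ ∫ x, (1 / 2 * (θ * m) * (η x * (u x - u x ^ 3)) ^ 2 +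
            1 / 2 * (1 / (θ * m)) * (η x ^ 2 * (u x - u (x + z)) ^ 2)) := by
          refine integral_mono (integrable_mul_of_compact hkc (by fun_prop) hks)
            ((iP.const_mul _).fun_add (i3.const_mul _)) fun x => ?_
          have := sq_nonneg (θ * m * (η x * (u x - u x ^ 3)) - η x * (u x - u (x + z)))
          rw [← sub_nonneg]
          have e : 1 / 2 * (θ * m) * (η x * (u x - u x ^ 3)) ^ 2 +
              1 / 2 * (1 / (θ * m)) * (η x ^ 2 * (u x - u (x + z)) ^ 2) -
              k x * (u x - u (x + z)) =
              (θ * m * (η x * (u x - u x ^ 3)) - η x * (u x - u (x + z))) ^ 2 / (2 * (θ * m)) := by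
            simp only [hk]
            field_simp
            ring
          simp only
          rw [e]
          positivity
      _ = 1 / 2 * (θ * m) * P + 1 / 2 * (1 / (θ * m)) *
            ∫ x, η x ^ 2 * (u x - u (x + z)) ^ 2 := by
          rw [integral_add (iP.const_mul _) (i3.const_mul _), integral_const_mul,
            integral_const_mul]
      _ ≤ 1 / 2 * (θ * m) * P + 1 / 2 * (1 / (θ * m)) * (m ^ 2 * G) := by
          gcongr
          exact integral_cutoff_sq_increment_le hη hu hu1 z
      _ = 1 / 2 * (θ * P + G / θ) * m := by
          field_simp
  have e4 : A * P ≤ 1 / 2 * (θ * P + G / θ) * M := by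
    rw [e1, e2]
    exact e3.trans (by gcongr)
  have e5 : 1 / 2 * (θ * P + G / θ) * M = 1 / 2 * (A * P) + 1 / 2 * (M ^ 2 * G / A) := by
    rw [hθ]; field_simp
  have e6 : A * P ≤ M ^ 2 * G / A := by linarith
  have e7 : P ≤ M ^ 2 * G / A ^ 2 := by
    rw [le_div_iff₀ (by positivity)]
    rw [le_div_iff₀ hA0] at e6
    linarith
  have e8 : 1 / A ^ 2 = ε ^ (2 * s) := by
    rw [hA, ← Real.rpow_natCast, ← Real.rpow_mul hε.le, one_div, ← Real.rpow_neg hε.le]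
    congr 1
    push_cast
    ring
  rw [← e8]
  refine e7.trans_eq (by ring)

set_option maxHeartbeats 1000000 in
/-- The potential energy of an almost stable solution is controlled by its Dirichlet energy. -/
lemma potential_le_dirichlet {Λ q : ℝ} (hΛ : 0 ≤ Λ) (hq : 0 ≤ q) (hq2 : q ≤ 2 * s) :
    ∃ C : ℝ, 0 ≤ C ∧
    ∀ (ε : ℝ) (u : Rn n → ℝ) (K : ℝ), 0 < ε → ContDiff ℝ 1 u → (∀ x, |u x| ≤ 1) →
    (∀ x, ‖fderiv ℝ u x‖ ≤ K) → IsACSol n s ε u (ball 0 1) → StableInUnitBall n s ε Λ u →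
    ∫ x in ball 0 (1 / 16), Wpot (u x) ≤
      C * ε ^ q * ((∫ x in ball 0 (1 / 4), ‖fderiv ℝ u x‖ ^ 2) + 1) := by
  obtain ⟨η, L, hη⟩ := exists_isCutoff n (a := 1 / 16) (b := 1 / 8) (by norm_num) (by norm_num)
  set ω := volume.real (ball (0 : Rn n) 1) with hω
  have hω0 : 0 ≤ ω := measureReal_nonneg
  set M₀ := ∫ z : Rn n, min 1 ‖z‖ * radKer n s z with hM₀
  have hM₀0 : 0 ≤ M₀ := integral_nonneg fun z =>
    mul_nonneg (by positivity) (radKer_nonneg hn hs z)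
  have hs0 := hs.1
  have hs1 := hs.2
  set M := M₀ + 1 with hM
  have hM0 : 0 < M := by positivity
  set N := (4 * M) ^ (1 / s) with hN
  have hN1 : 1 ≤ N := Real.one_le_rpow (by linarith) (by positivity)
  have hNs : N ^ (-s) = 1 / (4 * M) := by
    rw [hN, ← Real.rpow_mul (by positivity), one_div_mul_eq_div, neg_div, div_self hs0.ne',
      Real.rpow_neg_one, one_div]
  set ε₁ := min (1 / (8 * N)) ((1 / (4 * (Λ + 1))) ^ (1 / s)) with hε₁
  have hε₁0 : 0 < ε₁ := by positivity
  set D := 2 * L ^ 2 * ω + 256 * ω + 1 with hD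
  have hD0 : 0 ≤ D := by positivity
  refine ⟨(6 * M ^ 2 + 8 * N ^ 2) * D + ω * ε₁ ^ (-q), by positivity, ?_⟩
  intro ε u K hε hu hu1 hK hsol hst
  have huc := hu.continuous
  have hηc := hη.continuous
  have hd : Continuous (fderiv ℝ u) := hu.continuous_fderiv one_ne_zero
  set G := ∫ x in ball (0 : Rn n) (1 / 4), ‖fderiv ℝ u x‖ ^ 2 with hGdef
  have hG : 0 ≤ G := integral_nonneg fun _ => by positivity
  have hu2 : ∀ x, 0 ≤ 1 - u x ^ 2 ∧ 1 - u x ^ 2 ≤ 1 := fun x => by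
    have := abs_le.1 (hu1 x)
    constructor <;> nlinarith [sq_nonneg (u x)]
  have iW : IntegrableOn (fun x => Wpot (u x)) (ball (0 : Rn n) (1 / 16)) := by
    refine (Continuous.continuousOn ?_).integrableOn_compact
        (isCompact_closedBall (0 : Rn n) (1 / 16)) |>.mono_set ball_subset_closedBall
    unfold Wpot; fun_prop
  rcases le_or_gt ε₁ ε with hεε | hεε
  · have h1 : ∫ x in ball 0 (1 / 16), Wpot (u x) ≤ ∫ x in ball (0 : Rn n) (1 / 16), (1 : ℝ) := by
      refine setIntegral_mono iW (integrableOn_const measure_ball_lt_top.ne) fun x => ?_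
      have := hu2 x
      unfold Wpot
      nlinarith
    rw [setIntegral_const, smul_eq_mul, mul_one] at h1
    have h2 : volume.real (ball (0 : Rn n) (1 / 16)) ≤ ω :=
      measureReal_mono (ball_subset_ball (by norm_num)) measure_ball_lt_top.ne
    have h3 : 1 ≤ ε₁ ^ (-q) * ε ^ q := by
      rw [Real.rpow_neg hε₁0.le, inv_mul_eq_div, one_le_div (by positivity)]
      exact Real.rpow_le_rpow hε₁0.le hεε hq
    calc _ ≤ ω * 1 * 1 := by linarith
      _ ≤ ω * (ε₁ ^ (-q) * ε ^ q) * (G + 1) := by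
        gcongr
        linarith
      _ ≤ _ := by
        have : 0 ≤ (6 * M ^ 2 + 8 * N ^ 2) * D * ε ^ q * (G + 1) := by positivity
        linarith
  have hεN : ε < 1 / (8 * N) := hεε.trans_le (min_le_left _ _)
  have hεs : ε ^ s ≤ 1 / (4 * (Λ + 1)) := by
    have := Real.rpow_le_rpow hε.le (hεε.le.trans (min_le_right _ _)) hs0.le
    rwa [← Real.rpow_mul (by positivity), one_div_mul_cancel hs0.ne', Real.rpow_one] at this
  have hε1 : ε ≤ 1 := by
    refine hεN.le.trans ?_
    rw [div_le_one (by positivity)]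
    linarith
  set τ := N * ε with hτ
  have hτ0 : 0 < τ := by positivity
  have hτ1 : τ ≤ 1 / 8 := by
    rw [lt_div_iff₀ (by positivity)] at hεN
    linarith
  set v : Rn n → ℝ := fun x => η x * (1 - u x ^ 2) with hv
  have hvc : Continuous v := by rw [hv]; fun_prop
  have hvs : HasCompactSupport v := hη.hasCompactSupport.mul_right
  have iv := integrable_sq_of_compact hvc hvs
  set V := ∫ x, v x ^ 2 with hV
  have hV0 : 0 ≤ V := integral_nonneg fun _ => sq_nonneg _
  have hsmall : ∀ z, ‖z‖ < τ → sqDiff v z ≤ ‖z‖ ^ 2 * (2 * L ^ 2 * ω + 8 * (G + 256 * ω)) :=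
    fun z hz => sqDiff_cutoff_le hη hu hu1 (hz.trans_le hτ1)
  have k1 := integral_sqDiff_radKer_le_of_small hn hs hvc hvs hτ0 (by positivity) hsmall
  have k2 := hst v (hη.isCc1On_mul (by norm_num) (contDiff_const.sub (hu.pow 2)))
  have k3 := integral_nonlinearity_le hn hs hη hε hu hu1 hK hsol hM0 (by rw [hM]; linarith)
  set P := ∫ x, (η x * (u x - u x ^ 3)) ^ 2 with hP
  have iP : Integrable (fun x => (η x * (u x - u x ^ 3)) ^ 2) :=
    integrable_sq_of_compact (by fun_prop) hη.hasCompactSupport.mul_right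
  have k4 : ∫ x, (1 - 3 * u x ^ 2) * v x ^ 2 = V - 3 * P := by
    rw [hV, hP, ← integral_const_mul, ← integral_sub iv (iP.const_mul _)]
    refine integral_congr_ae (ae_of_all _ fun x => ?_)
    simp only [hv]; ring
  rw [k4] at k2
  set A := ε ^ (-s) with hA
  have hA0 : 0 < A := Real.rpow_pos_of_pos hε _
  have hAε : A * ε ^ s = 1 := by
    rw [hA, ← Real.rpow_add hε, neg_add_cancel, Real.rpow_zero]
  have hΛA : Λ ≤ 1 / 4 * A := by
    have : Λ * ε ^ s ≤ 1 / 4 := by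
      calc Λ * ε ^ s ≤ (Λ + 1) * (1 / (4 * (Λ + 1))) := by gcongr; linarith
        _ = 1 / 4 := by field_simp
    have h2 := mul_le_mul_of_nonneg_left this hA0.le
    have h3 : A * (Λ * ε ^ s) = Λ := by
      rw [mul_left_comm, hAε, mul_one]
    linarith
  have hτs : τ ^ (-s) * M₀ ≤ A / 4 := by
    rw [hτ, Real.mul_rpow (by positivity) hε.le, hNs, ← hA]
    rw [mul_right_comm, mul_comm, ← mul_div_right_comm, one_mul]
    rw [mul_div_assoc', div_le_div_iff₀ (by positivity) (by norm_num)]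
    have : A * M₀ ≤ A * M := by gcongr; linarith
    linarith
  set B := 2 * L ^ 2 * ω + 8 * (G + 256 * ω) with hB
  have hB0 : 0 ≤ B := by positivity
  have k5 : ∫ z, sqDiff v z * radKer n s z ≤ A / 4 * (τ ^ 2 * B + 4 * V) :=
    k1.trans (by gcongr)
  have k6 : Λ * V ≤ 1 / 4 * A * V := by gcongr
  have k7 : A * V ≤ A * (6 * P + τ ^ 2 * B / 8) := by nlinarith
  have k8 : V ≤ 6 * P + τ ^ 2 * B / 8 := le_of_mul_le_mul_left k7 hA0
  have k9 : ε ^ (2 * s) ≤ ε ^ q := Real.rpow_le_rpow_of_exponent_ge hε hε1 hq2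
  have k10 : ε ^ 2 ≤ ε ^ q := by
    rw [← Real.rpow_natCast]
    exact Real.rpow_le_rpow_of_exponent_ge hε hε1 (by push_cast; linarith)
  have k11 : ∫ x in ball 0 (1 / 16), Wpot (u x) ≤ V := by
    have e : ∫ x in ball 0 (1 / 16), Wpot (u x) ≤ ∫ x in ball 0 (1 / 16), v x ^ 2 := by
      refine setIntegral_mono_on iW iv.integrableOn measurableSet_ball fun x hx => ?_
      rw [mem_ball_zero_iff] at hx
      simp only [hv, hη.eq_one x hx.le, Wpot]
      nlinarith [sq_nonneg (1 - u x ^ 2)]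
    exact e.trans (setIntegral_le_integral iv (ae_of_all _ fun _ => sq_nonneg _))
  have k12 : G + 256 * ω ≤ D * (G + 1) := by
    rw [hD]
    have : 0 ≤ (2 * L ^ 2 * ω + 256 * ω) * G := by positivity
    have : 0 ≤ 2 * L ^ 2 * ω := by positivity
    linarith
  have k13 : B ≤ 8 * (D * (G + 1)) := by
    rw [hD, hB]
    have : 0 ≤ (2 * L ^ 2 * ω + 256 * ω) * G := by positivity
    have : 0 ≤ 2 * L ^ 2 * ω := by positivity
    linarith
  calc _ ≤ 6 * P + τ ^ 2 * B / 8 := k11.trans k8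
    _ ≤ 6 * (M ^ 2 * ε ^ (2 * s) * (G + 256 * ω)) + τ ^ 2 * (8 * (D * (G + 1))) / 8 := by gcongr
    _ = 6 * (M ^ 2 * ε ^ (2 * s) * (G + 256 * ω)) + N ^ 2 * ε ^ 2 * (D * (G + 1)) := by
        rw [hτ]; ring
    _ ≤ 6 * (M ^ 2 * ε ^ q * (D * (G + 1))) + N ^ 2 * ε ^ q * (D * (G + 1)) := by gcongr
    _ ≤ _ := by
        have h1 : 0 ≤ N ^ 2 * ε ^ q * (D * (G + 1)) := by positivity
        have h2 : 0 ≤ ω * ε₁ ^ (-q) * ε ^ q * (G + 1) := by positivity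
        linarith
end
end

noncomputable section

/-- The Gagliardo energy `∬ (f(x) - f(y))² α |x-y|^{-(n+s)}`, sliced along increments. -/
def kinetic (n : ℕ) (s : ℝ) (f : Rn n → ℝ) : ℝ := ∫ z, sqDiff f z * radKer n s z

section
variable {n : ℕ}

lemma measurePreserving_shear : MeasurePreserving (MeasurableEquiv.shearAddRight (Rn n))
    (volume.prod volume) (volume.prod volume) :=
  measurePreserving_prod_add volume volume

lemma integrable_mul_shear {h k : Rn n → ℝ} (hh : Integrable h) (hk : Integrable k) :
    Integrable (fun q : Rn n × Rn n => h q.1 * k (q.1 + q.2)) (volume.prod volume) :=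
  (measurePreserving_shear.integrable_comp_emb
    (MeasurableEquiv.shearAddRight (Rn n)).measurableEmbedding).2 (hh.mul_prod hk)

lemma integral_mul_shear (h k : Rn n → ℝ) :
    ∫ q : Rn n × Rn n, h q.1 * k (q.1 + q.2) ∂(volume.prod volume) = (∫ x, h x) * ∫ x, k x := by
  rw [← integral_prod_mul]
  exact measurePreserving_shear.integral_comp
    (MeasurableEquiv.shearAddRight (Rn n)).measurableEmbedding (fun q : Rn n × Rn n => h q.1 * k q.2)

lemma IsCc1On.lip {Ω : Set (Rn n)} {f : Rn n → ℝ} (hf : IsCc1On n Ω f) :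
    ∃ L : ℝ, ∀ x y, |f x - f y| ≤ L * ‖x - y‖ := by
  obtain ⟨L, hL⟩ := hf.1.lipschitzWith_of_hasCompactSupport hf.2.1 one_ne_zero
  refine ⟨L, fun x y => ?_⟩
  have := hL.dist_le_mul x y
  rwa [Real.dist_eq, dist_eq_norm] at this

lemma IsCc1On.eq_zero {Ω : Set (Rn n)} {f : Rn n → ℝ} (hf : IsCc1On n Ω f) {x : Rn n}
    (hx : x ∉ Ω) : f x = 0 :=
  image_eq_zero_of_notMem_tsupport fun h => hx (hf.2.2 h)

lemma IsCc1On.mono {Ω Ω' : Set (Rn n)} {f : Rn n → ℝ} (hf : IsCc1On n Ω f) (h : Ω ⊆ Ω') :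
    IsCc1On n Ω' f := ⟨hf.1, hf.2.1, hf.2.2.trans h⟩

lemma IsCc1On.add {Ω : Set (Rn n)} {f g : Rn n → ℝ} (hf : IsCc1On n Ω f) (hg : IsCc1On n Ω g) :
    IsCc1On n Ω (fun x => f x + g x) :=
  ⟨hf.1.add hg.1, hf.2.1.add hg.2.1,
    (tsupport_add f g).trans (union_subset hf.2.2 hg.2.2)⟩

lemma IsCc1On.const_mul {Ω : Set (Rn n)} {f : Rn n → ℝ} (hf : IsCc1On n Ω f) (a : ℝ) :
    IsCc1On n Ω (fun x => a * f x) :=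
  ⟨contDiff_const.mul hf.1, hf.2.1.mul_left,
    (closure_mono (Function.support_mul_subset_right _ _)).trans hf.2.2⟩
end

section
variable {n : ℕ} (hn : 1 ≤ n) {s : ℝ} (hs : s ∈ Ioo (0 : ℝ) 1) {Ω : Set (Rn n)} {f : Rn n → ℝ}
  (hf : IsCc1On n Ω f)
include hn hs hf

lemma IsCc1On.integrable_kinetic : Integrable (fun z => sqDiff f z * radKer n s z) := by
  obtain ⟨L, hL⟩ := hf.lip
  obtain ⟨C, hC⟩ := sqDiff_le_min hf.1.continuous hf.2.1 hL
  exact integrable_mul_radKer hn hs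
    (stronglyMeasurable_sqDiff hf.1.continuous).aestronglyMeasurable hC

lemma IsCc1On.integrable_prod : Integrable
    (fun q : Rn n × Rn n => (f (q.1 + q.2) - f q.1) ^ 2 * radKer n s q.2)
    (volume.prod volume) := by
  have hc := hf.1.continuous
  have hrm := measurable_radKer n s
  have hm : AEStronglyMeasurable
      (fun q : Rn n × Rn n => (f (q.1 + q.2) - f q.1) ^ 2 * radKer n s q.2)
      (volume.prod volume) := Measurable.aestronglyMeasurable (by fun_prop)
  rw [integrable_prod_iff' hm]
  refine ⟨ae_of_all _ fun z => (integrable_sqDiff_integrand hc hf.2.1 z).mul_const (radKer n s z), ?_⟩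
  refine (hf.integrable_kinetic hn hs).congr (ae_of_all _ fun z => ?_)
  simp only [sqDiff, ← integral_mul_const]
  refine integral_congr_ae (ae_of_all _ fun x => ?_)
  simp only
  rw [Real.norm_of_nonneg (mul_nonneg (sq_nonneg _) (radKer_nonneg hn hs z))]

lemma IsCc1On.kinetic_eq_prod : kinetic n s f =
    ∫ q : Rn n × Rn n, (f (q.1 + q.2) - f q.1) ^ 2 * radKer n s q.2 ∂(volume.prod volume) := by
  rw [integral_prod_symm _ (hf.integrable_prod hn hs)]
  simp only [kinetic, sqDiff, ← integral_mul_const]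

lemma IsCc1On.qform_eq (ε : ℝ) (u : Rn n → ℝ) : Qform n s ε u Ω f =
    1 / 4 * kinetic n s f + ε ^ (-s) * ∫ x, (3 * u x ^ 2 - 1) * f x ^ 2 := by
  unfold Qform
  rw [setIntegral_eq_integral_of_forall_compl_eq_zero (s := Ω)
      fun x hx => by rw [hf.eq_zero hx]; simp,
    setIntegral_eq_integral_of_forall_compl_eq_zero (s := (Ωᶜ ×ˢ Ωᶜ)ᶜ) fun q hq => by
      rw [notMem_compl_iff] at hq
      rw [hf.eq_zero hq.1, hf.eq_zero hq.2]; simp]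
  rw [hf.kinetic_eq_prod hn hs]
  congr 2
  have h := measurePreserving_shear.integral_comp
    (MeasurableEquiv.shearAddRight (Rn n)).measurableEmbedding
    (fun q : Rn n × Rn n => (f q.1 - f q.2) ^ 2 * fracKer n s q.1 q.2)
  refine Eq.trans h.symm (integral_congr_ae (ae_of_all _ fun q => ?_))
  have e : (MeasurableEquiv.shearAddRight (Rn n)) q = (q.1, q.1 + q.2) := rfl
  simp only [e, fracKer_eq, sub_add_cancel_left, radKer_neg]
  ring

end

section
variable {n : ℕ} (hn : 1 ≤ n) {s : ℝ} (hs : s ∈ Ioo (0 : ℝ) 1)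
include hn hs

lemma kinetic_nonneg (f : Rn n → ℝ) : 0 ≤ kinetic n s f :=
  integral_nonneg fun z => mul_nonneg (sqDiff_nonneg f z) (radKer_nonneg hn hs z)

lemma radKer_le {ρ : ℝ} (hρ : 0 < ρ) {z : Rn n} (hz : ρ ≤ ‖z‖) :
    radKer n s z ≤ alphaC n s * ρ ^ (-((n : ℝ) + s)) := by
  have := alphaC_pos hn hs
  have h0 := hs.1
  unfold radKer
  refine mul_le_mul_of_nonneg_left (Real.rpow_le_rpow_of_nonpos hρ hz ?_) this.le
  have : (0 : ℝ) ≤ n := by positivity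
  linarith

/-- Functions with well separated supports interact weakly in the Gagliardo energy. -/
lemma kinetic_add_le {Ω A B : Set (Rn n)} {f g : Rn n → ℝ} (hf : IsCc1On n Ω f)
    (hg : IsCc1On n Ω g) (hA : MeasurableSet A) (hB : MeasurableSet B) (hA' : volume A ≠ ⊤)
    (hB' : volume B ≠ ⊤) (hfA : ∀ x, x ∉ A → f x = 0) (hgB : ∀ x, x ∉ B → g x = 0) {ρ : ℝ}
    (hρ : 0 < ρ) (hAB : ∀ x ∈ A, ∀ y ∈ B, ρ ≤ ‖x - y‖) :
    kinetic n s (fun x => f x + g x) ≤ kinetic n s f + kinetic n s g +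
      2 * (alphaC n s * ρ ^ (-((n : ℝ) + s))) *
        (volume.real B * (∫ x, f x ^ 2) + volume.real A * ∫ x, g x ^ 2) := by
  set l := alphaC n s * ρ ^ (-((n : ℝ) + s)) with hl
  have hl0 : 0 ≤ l := mul_nonneg (alphaC_pos hn hs).le (by positivity)
  set a : Rn n → ℝ := A.indicator 1 with ha
  set b : Rn n → ℝ := B.indicator 1 with hb
  have ia : Integrable a := (integrable_indicator_iff hA).2 (integrableOn_const hA')
  have ib : Integrable b := (integrable_indicator_iff hB).2 (integrableOn_const hB')
  have if2 := integrable_sq_of_compact hf.1.continuous hf.2.1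
  have ig2 := integrable_sq_of_compact hg.1.continuous hg.2.1
  have j1 := integrable_mul_shear if2 ib
  have j2 := integrable_mul_shear ia ig2
  have j3 := integrable_mul_shear ib if2
  have j4 := integrable_mul_shear ig2 ia
  have jf := hf.integrable_prod hn hs
  have jg := hg.integrable_prod hn hs
  have ea : ∫ x, a x = volume.real A := by rw [ha, integral_indicator_one hA]
  have eb : ∫ x, b x = volume.real B := by rw [hb, integral_indicator_one hB]
  have ha0 : ∀ x, 0 ≤ a x := fun x => indicator_nonneg (fun _ _ => zero_le_one) x
  have hb0 : ∀ x, 0 ≤ b x := fun x => indicator_nonneg (fun _ _ => zero_le_one) x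
  have main : ∀ x y z, ‖x - y‖ = ‖z‖ → -(2 * (f x * g y)) * radKer n s z ≤
      l * (f x ^ 2 * b y + a x * g y ^ 2) := fun x y z hxy => by
    have hk := radKer_nonneg hn hs z
    have hr : 0 ≤ l * (f x ^ 2 * b y + a x * g y ^ 2) := by
      have := ha0 x
      have := hb0 y
      positivity
    by_cases hx : x ∈ A
    · by_cases hy : y ∈ B
      · have h1 : a x = 1 := by simp [ha, hx]
        have h2 : b y = 1 := by simp [hb, hy]
        have h3 : radKer n s z ≤ l := radKer_le hn hs hρ (by rw [← hxy]; exact hAB x hx y hy)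
        rw [h1, h2]
        calc -(2 * (f x * g y)) * radKer n s z ≤ (f x ^ 2 * 1 + 1 * g y ^ 2) * radKer n s z := by
              gcongr
              nlinarith [sq_nonneg (f x + g y)]
          _ ≤ (f x ^ 2 * 1 + 1 * g y ^ 2) * l := by gcongr
          _ = _ := mul_comm _ _
      · rw [hgB y hy] at hr ⊢
        simpa using hr
    · rw [hfA x hx] at hr ⊢
      simpa using hr
  have hdisj : ∀ x, f x * g x = 0 := fun x => by
    by_cases hx : x ∈ A
    · by_cases hy : x ∈ B
      · have := hAB x hx x hy
        rw [sub_self, norm_zero] at this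
        linarith
      · rw [hgB x hy, mul_zero]
    · rw [hfA x hx, zero_mul]
  rw [(hf.add hg).kinetic_eq_prod hn hs, hf.kinetic_eq_prod hn hs, hg.kinetic_eq_prod hn hs]
  calc _ ≤ ∫ q : Rn n × Rn n, (((f (q.1 + q.2) - f q.1) ^ 2 * radKer n s q.2 +
        (g (q.1 + q.2) - g q.1) ^ 2 * radKer n s q.2) +
        l * ((f q.1 ^ 2 * b (q.1 + q.2) + a q.1 * g (q.1 + q.2) ^ 2) +
          (b q.1 * f (q.1 + q.2) ^ 2 + g q.1 ^ 2 * a (q.1 + q.2)))) ∂(volume.prod volume) := by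
        refine integral_mono ((hf.add hg).integrable_prod hn hs)
          ((jf.fun_add jg).fun_add (((j1.fun_add j2).fun_add (j3.fun_add j4)).const_mul l))
          fun q => ?_
        have m1 := main q.1 (q.1 + q.2) q.2 (by rw [sub_add_cancel_left, norm_neg])
        have m2 := main (q.1 + q.2) q.1 q.2 (by rw [add_sub_cancel_left])
        have d1 := hdisj q.1
        have d2 := hdisj (q.1 + q.2)
        simp only
        have e : (f (q.1 + q.2) + g (q.1 + q.2) - (f q.1 + g q.1)) ^ 2 =
            (f (q.1 + q.2) - f q.1) ^ 2 + (g (q.1 + q.2) - g q.1) ^ 2 +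
            (-(2 * (f q.1 * g (q.1 + q.2))) + -(2 * (f (q.1 + q.2) * g q.1))) := by
          linear_combination 2 * d1 + 2 * d2
        rw [e]
        linarith
    _ = _ := by
        rw [integral_add (jf.fun_add jg) (((j1.fun_add j2).fun_add (j3.fun_add j4)).const_mul l),
          integral_add jf jg, integral_const_mul,
          integral_add (j1.fun_add j2) (j3.fun_add j4), integral_add j1 j2, integral_add j3 j4,
          integral_mul_shear (fun x => f x ^ 2) b, integral_mul_shear a (fun x => g x ^ 2),
          integral_mul_shear b (fun x => f x ^ 2), integral_mul_shear (fun x => g x ^ 2) a, ea, eb]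
        ring
end
end

noncomputable section

lemma exists_finset_cover {V : Type*} [NormedAddCommGroup V] (m : ℕ) (S : Set (V × ℝ))
    {ε : ℝ} (hε : 0 < ε) (hS : ∀ q ∈ S, ε ≤ q.2)
    (h : ∀ q : Fin (m + 1) → V × ℝ, (∀ i, q i ∈ S) →
      ¬ ∀ i j, i < j → (q i).2 ≤ 2 * (q j).2 ∧ 4 * (q j).2 ≤ ‖(q i).1 - (q j).1‖) :
    ∃ X : Finset V, X.card ≤ m ∧ ∀ q ∈ S, ∃ x ∈ X, ‖q.1 - x‖ < 4 * q.2 := by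
  classical
  induction m generalizing S with
  | zero =>
    refine ⟨∅, by simp, fun q hq => ?_⟩
    refine (h (fun _ => q) (fun _ => hq) fun i j hij => ?_).elim
    exact absurd hij (by omega)
  | succ m ih =>
    rcases S.eq_empty_or_nonempty with rfl | hne
    · exact ⟨∅, by simp, fun q hq => hq.elim⟩
    have hbdd : BddBelow (Prod.snd '' S) := ⟨ε, by rintro _ ⟨q, hq, rfl⟩; exact hS q hq⟩
    have hinf : ε ≤ sInf (Prod.snd '' S) :=
      le_csInf (hne.image _) (by rintro _ ⟨q, hq, rfl⟩; exact hS q hq)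
    obtain ⟨_, ⟨q₀, hq₀, rfl⟩, hlt⟩ := exists_lt_of_csInf_lt (hne.image Prod.snd)
      (by linarith : sInf (Prod.snd '' S) < 2 * sInf (Prod.snd '' S))
    have hmin : ∀ q ∈ S, q₀.2 ≤ 2 * q.2 := fun q hq => by
      have := csInf_le hbdd (mem_image_of_mem Prod.snd hq)
      linarith
    obtain ⟨X, hX, hX'⟩ := ih {q ∈ S | 4 * q.2 ≤ ‖q₀.1 - q.1‖} (fun q hq => hS q hq.1)
      fun q hq hq' => by
        refine h (Fin.cons q₀ q) (fun i => ?_) fun i j hij => ?_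
        · refine Fin.cases ?_ (fun i => ?_) i
          · exact hq₀
          · exact (hq i).1
        · induction j using Fin.cases with
          | zero => exact absurd hij (Fin.not_lt_zero i)
          | succ j =>
            induction i using Fin.cases with
            | zero => exact ⟨hmin _ (hq j).1, (hq j).2⟩
            | succ i => exact hq' i j (Fin.succ_lt_succ_iff.1 hij)
    refine ⟨insert q₀.1 X, (Finset.card_insert_le _ _).trans (by omega), fun q hq => ?_⟩
    by_cases hc : 4 * q.2 ≤ ‖q₀.1 - q.1‖
    · obtain ⟨x, hx, hx'⟩ := hX' q ⟨hq, hc⟩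
      exact ⟨x, Finset.mem_insert_of_mem hx, hx'⟩
    · exact ⟨q₀.1, Finset.mem_insert_self _ _, by rw [norm_sub_rev]; linarith⟩

/-- The second variation with halved kinetic part, written on the whole space. -/
def energyForm (n : ℕ) (s ε : ℝ) (u f : Rn n → ℝ) : ℝ :=
  1 / 4 * kinetic n s f + ε ^ (-s) * ∫ x, (3 * u x ^ 2 - 1) * f x ^ 2

section
variable {n : ℕ}

lemma sqDiff_const_mul (a : ℝ) (f : Rn n → ℝ) (z : Rn n) :
    sqDiff (fun x => a * f x) z = a ^ 2 * sqDiff f z := by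
  unfold sqDiff
  rw [← integral_const_mul]
  refine integral_congr_ae (ae_of_all _ fun x => ?_)
  simp only; ring

lemma energyForm_const_mul (s ε : ℝ) (u f : Rn n → ℝ) (a : ℝ) :
    energyForm n s ε u (fun x => a * f x) = a ^ 2 * energyForm n s ε u f := by
  have e : ∀ x, (3 * u x ^ 2 - 1) * (a * f x) ^ 2 = a ^ 2 * ((3 * u x ^ 2 - 1) * f x ^ 2) :=
    fun x => by ring
  simp only [energyForm, kinetic, sqDiff_const_mul, mul_assoc (a ^ 2), e, integral_const_mul]
  ring

lemma energyForm_zero (s ε : ℝ) (u : Rn n → ℝ) : energyForm n s ε u (fun _ => 0) = 0 := by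
  simp [energyForm, kinetic, sqDiff]

lemma integrable_potential {u f : Rn n → ℝ} (hu : Continuous u) {Ω : Set (Rn n)}
    (hf : IsCc1On n Ω f) : Integrable (fun x => (3 * u x ^ 2 - 1) * f x ^ 2) := by
  have := hf.1.continuous
  refine Continuous.integrable_of_hasCompactSupport (by fun_prop) ?_
  simp only [sq (f _), ← mul_assoc]
  exact hf.2.1.mul_left

lemma integral_sq_add_of_disjoint {f g : Rn n → ℝ} {Ω : Set (Rn n)}
    (hf : IsCc1On n Ω f) (hg : IsCc1On n Ω g) (h : ∀ x, f x * g x = 0) :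
    ∫ x, (f x + g x) ^ 2 = (∫ x, f x ^ 2) + ∫ x, g x ^ 2 := by
  rw [← integral_add (integrable_sq_of_compact hf.1.continuous hf.2.1)
    (integrable_sq_of_compact hg.1.continuous hg.2.1)]
  refine integral_congr_ae (ae_of_all _ fun x => ?_)
  simp only
  linear_combination 2 * h x

lemma integral_potential_add_of_disjoint {u f g : Rn n → ℝ} (hu : Continuous u) {Ω : Set (Rn n)}
    (hf : IsCc1On n Ω f) (hg : IsCc1On n Ω g) (h : ∀ x, f x * g x = 0) :
    ∫ x, (3 * u x ^ 2 - 1) * (f x + g x) ^ 2 =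
      (∫ x, (3 * u x ^ 2 - 1) * f x ^ 2) + ∫ x, (3 * u x ^ 2 - 1) * g x ^ 2 := by
  rw [← integral_add (integrable_potential hu hf) (integrable_potential hu hg)]
  refine integral_congr_ae (ae_of_all _ fun x => ?_)
  simp only
  linear_combination 2 * (3 * u x ^ 2 - 1) * h x

lemma IsCc1On.zero (Ω : Set (Rn n)) : IsCc1On n Ω (fun _ => 0) :=
  ⟨contDiff_const, HasCompactSupport.zero, by simp [tsupport]⟩

lemma IsCc1On.sum {ι : Type*} {Ω : Set (Rn n)} {f : ι → Rn n → ℝ} (hf : ∀ i, IsCc1On n Ω (f i))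
    (S : Finset ι) : IsCc1On n Ω (fun x => ∑ i ∈ S, f i x) := by
  classical
  induction S using Finset.induction_on with
  | empty => simpa using IsCc1On.zero Ω
  | insert j S hj ih =>
    simp only [Finset.sum_insert hj]
    exact (hf j).add ih
end

section
variable {n : ℕ} (hn : 1 ≤ n) {s : ℝ} (hs : s ∈ Ioo (0 : ℝ) 1)
include hn hs

lemma neg_le_energyForm {ε : ℝ} (hε : 0 < ε) {u f : Rn n → ℝ} (hu : Continuous u)
    {Ω : Set (Rn n)} (hf : IsCc1On n Ω f) :
    -(ε ^ (-s) * ∫ x, f x ^ 2) ≤ energyForm n s ε u f := by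
  have h0 := kinetic_nonneg hn hs f
  have if2 := integrable_sq_of_compact hf.1.continuous hf.2.1
  have h1 : -∫ x, f x ^ 2 ≤ ∫ x, (3 * u x ^ 2 - 1) * f x ^ 2 := by
    rw [← integral_neg]
    refine integral_mono if2.neg (integrable_potential hu hf) fun x => ?_
    have : 0 ≤ u x ^ 2 * f x ^ 2 := by positivity
    simp only
    linarith
  have h2 : 0 < ε ^ (-s) := Real.rpow_pos_of_pos hε _
  have h3 := mul_le_mul_of_nonneg_left h1 h2.le
  unfold energyForm
  linarith

lemma energyForm_sum_le {ε : ℝ} {u : Rn n → ℝ} (hu : Continuous u)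
    {Ω : Set (Rn n)} {N : ℕ} {z : Fin N → Rn n} {r : Fin N → ℝ} (hr : ∀ i, 0 < r i)
    (hΩ : ∀ i, ball (z i) (r i) ⊆ Ω)
    (hsep : ∀ i j, i < j → r i ≤ 2 * r j ∧ 4 * r j ≤ ‖z i - z j‖)
    {f : Fin N → Rn n → ℝ} (hf : ∀ i, IsCc1On n (ball (z i) (r i)) (f i)) (S : Finset (Fin N)) :
    energyForm n s ε u (fun x => ∑ i ∈ S, f i x) ≤ ∑ i ∈ S, (energyForm n s ε u (f i) +
      alphaC n s * volume.real (ball (0 : Rn n) 1) * (1 / 2 * N * 2 ^ n + S.card) *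
        (r i ^ (-s) * ∫ x, f i x ^ 2)) ∧
    ∫ x, (∑ i ∈ S, f i x) ^ 2 = ∑ i ∈ S, ∫ x, f i x ^ 2 := by
  have hα := alphaC_pos hn hs
  have hs0 := hs.1
  have hs1 := hs.2
  set ω := volume.real (ball (0 : Rn n) 1) with hω
  have hω0 : 0 ≤ ω := measureReal_nonneg
  have hvol : ∀ i, volume.real (ball (z i) (r i)) = r i ^ n * ω := fun i => by
    rw [measureReal_def, Measure.addHaar_ball_of_pos _ _ (hr i), finrank_euclideanSpace,
      Fintype.card_fin, ENNReal.toReal_mul, ENNReal.toReal_ofReal (by have := hr i; positivity)]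
    rfl
  have hI : ∀ i, 0 ≤ ∫ x, f i x ^ 2 := fun i => integral_nonneg fun _ => sq_nonneg _
  induction S using Finset.induction_on_max with
  | empty => simp [energyForm_zero]
  | insert j S hj ih =>
    have hjS : j ∉ S := fun h => lt_irrefl _ (hj j h)
    obtain ⟨ih1, ih2⟩ := ih
    set g : Rn n → ℝ := fun x => ∑ i ∈ S, f i x with hg
    have hfΩ : ∀ i, IsCc1On n Ω (f i) := fun i => (hf i).mono (hΩ i)
    have hgΩ : IsCc1On n Ω g := IsCc1On.sum hfΩ S
    set A : Set (Rn n) := ⋃ i ∈ S, ball (z i) (r i) with hA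
    have hAm : MeasurableSet A := Finset.measurableSet_biUnion S fun i _ => measurableSet_ball
    have hrj := hr j
    have hAle : volume A ≤ ENNReal.ofReal (N * (2 ^ n * (r j ^ n * ω))) := by
      refine (measure_biUnion_finset_le S _).trans ?_
      calc ∑ i ∈ S, volume (ball (z i) (r i)) ≤
          ∑ i ∈ S, ENNReal.ofReal (2 ^ n * (r j ^ n * ω)) := by
            refine Finset.sum_le_sum fun i hi => ?_
            rw [← ENNReal.ofReal_toReal (measure_ball_lt_top (x := z i) (r := r i)).ne,
              ← measureReal_def, hvol]
            refine ENNReal.ofReal_le_ofReal ?_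
            have := pow_le_pow_left₀ (hr i).le (hsep i j (hj i hi)).1 n
            rw [mul_pow] at this
            nlinarith
        _ = S.card * ENNReal.ofReal (2 ^ n * (r j ^ n * ω)) := by simp
        _ ≤ N * ENNReal.ofReal (2 ^ n * (r j ^ n * ω)) := by
            gcongr
            simpa using S.card_le_univ
        _ = _ := by
            rw [ENNReal.ofReal_mul (p := (N : ℝ)) (by positivity), ENNReal.ofReal_natCast]
    have hAr : volume.real A ≤ N * (2 ^ n * (r j ^ n * ω)) :=
      ENNReal.toReal_le_of_le_ofReal (by positivity) hAle
    have hgA : ∀ x, x ∉ A → g x = 0 := fun x hx => by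
      refine Finset.sum_eq_zero fun i hi => (hf i).eq_zero fun h => hx ?_
      exact mem_biUnion hi h
    have hdist : ∀ x ∈ A, ∀ y ∈ ball (z j) (r j), r j ≤ ‖x - y‖ := fun x hx y hy => by
      simp only [hA, mem_iUnion] at hx
      obtain ⟨i, hi, hx⟩ := hx
      obtain ⟨h1, h2⟩ := hsep i j (hj i hi)
      rw [mem_ball, dist_eq_norm] at hx hy
      have : ‖z i - z j‖ ≤ ‖x - z i‖ + ‖x - y‖ + ‖y - z j‖ := by
        calc ‖z i - z j‖ = ‖-(x - z i) + (x - y) + (y - z j)‖ := by congr 1; abel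
          _ ≤ ‖-(x - z i)‖ + ‖x - y‖ + ‖y - z j‖ := norm_add₃_le
          _ = _ := by rw [norm_neg]
      linarith
    have hdisj : ∀ x, f j x * g x = 0 := fun x => by
      by_cases hx : x ∈ A
      · rw [(hf j).eq_zero fun h => ?_, zero_mul]
        have := hdist x hx x h
        rw [sub_self, norm_zero] at this
        linarith
      · rw [hgA x hx, mul_zero]
    have hkin := kinetic_add_le hn hs hgΩ (hfΩ j) hAm measurableSet_ball
      (hAle.trans_lt ENNReal.ofReal_lt_top).ne measure_ball_lt_top.ne hgA
      (fun x hx => (hf j).eq_zero hx) hrj hdist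
    have hcomm : (fun x => f j x + g x) = fun x => g x + f j x := by
      ext x; exact add_comm _ _
    have hpot := integral_potential_add_of_disjoint hu (hfΩ j) hgΩ hdisj
    have hsq := integral_sq_add_of_disjoint (hfΩ j) hgΩ hdisj
    simp only [Finset.sum_insert hjS]
    change energyForm n s ε u (fun x => f j x + g x) ≤ _ ∧ _
    refine ⟨?_, by rw [hsq, ih2]⟩
    have hF := hI j
    have e1 : r j ^ (-((n : ℝ) + s)) * r j ^ n = r j ^ (-s) := by
      rw [← Real.rpow_natCast, ← Real.rpow_add hrj]
      congr 1; ring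
    have e2 : 1 / 4 * (2 * (alphaC n s * r j ^ (-((n : ℝ) + s))) *
        (volume.real (ball (z j) (r j)) * (∫ x, g x ^ 2) + volume.real A * ∫ x, f j x ^ 2)) ≤
        alphaC n s * ω * (∑ i ∈ S, r i ^ (-s) * ∫ x, f i x ^ 2) +
        alphaC n s * ω * (1 / 2 * N * 2 ^ n) * (r j ^ (-s) * ∫ x, f j x ^ 2) := by
      have e3 : r j ^ (-s) * (∫ x, g x ^ 2) ≤ 2 * ∑ i ∈ S, r i ^ (-s) * ∫ x, f i x ^ 2 := by
        rw [ih2, Finset.mul_sum, Finset.mul_sum]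
        refine Finset.sum_le_sum fun i hi => ?_
        rw [← mul_assoc]
        refine mul_le_mul_of_nonneg_right ?_ (hI i)
        have h1 : r j ^ (-s) ≤ (r i / 2) ^ (-s) :=
          Real.rpow_le_rpow_of_nonpos (by have := hr i; positivity)
            (by linarith [(hsep i j (hj i hi)).1]) (by linarith)
        have h2 : (r i / 2) ^ (-s) = 2 ^ s * r i ^ (-s) := by
          rw [Real.div_rpow (hr i).le (by norm_num), Real.rpow_neg (by norm_num : (0 : ℝ) ≤ 2),
            div_inv_eq_mul, mul_comm]
        have h3 : (2 : ℝ) ^ s ≤ 2 := by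
          simpa using Real.rpow_le_rpow_of_exponent_le (by norm_num : (1 : ℝ) ≤ 2) hs1.le
        have h4 : 0 ≤ r i ^ (-s) := Real.rpow_nonneg (hr i).le _
        rw [h2] at h1
        nlinarith
      calc _ ≤ 1 / 4 * (2 * (alphaC n s * r j ^ (-((n : ℝ) + s))) *
          (r j ^ n * ω * (∫ x, g x ^ 2) + N * (2 ^ n * (r j ^ n * ω)) * ∫ x, f j x ^ 2)) := by
            rw [hvol]; gcongr
        _ = alphaC n s * ω * (1 / 2 * (r j ^ (-((n : ℝ) + s)) * r j ^ n * (∫ x, g x ^ 2))) +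
          alphaC n s * ω * (1 / 2 * N * 2 ^ n) *
            (r j ^ (-((n : ℝ) + s)) * r j ^ n * ∫ x, f j x ^ 2) := by ring
        _ ≤ _ := by
          rw [e1]
          gcongr
          linarith
    have e4 : energyForm n s ε u (fun x => f j x + g x) ≤ energyForm n s ε u (f j) +
        energyForm n s ε u g + (alphaC n s * ω * (∑ i ∈ S, r i ^ (-s) * ∫ x, f i x ^ 2) +
        alphaC n s * ω * (1 / 2 * N * 2 ^ n) * (r j ^ (-s) * ∫ x, f j x ^ 2)) := by
      unfold energyForm
      rw [hpot, hcomm]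
      linarith
    refine e4.trans ?_
    rw [Finset.card_insert_of_notMem hjS]
    have e5 : ∑ i ∈ S, (energyForm n s ε u (f i) +
        alphaC n s * ω * (1 / 2 * N * 2 ^ n + ((S.card + 1 : ℕ) : ℝ)) *
          (r i ^ (-s) * ∫ x, f i x ^ 2)) =
        (∑ i ∈ S, (energyForm n s ε u (f i) +
        alphaC n s * ω * (1 / 2 * N * 2 ^ n + S.card) *
          (r i ^ (-s) * ∫ x, f i x ^ 2))) +
        alphaC n s * ω * ∑ i ∈ S, r i ^ (-s) * ∫ x, f i x ^ 2 := by
      rw [Finset.mul_sum, ← Finset.sum_add_distrib]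
      refine Finset.sum_congr rfl fun i _ => ?_
      push_cast; ring
    rw [e5]
    have e6 : 0 ≤ alphaC n s * ω * ((S.card + 1 : ℕ) : ℝ) * (r j ^ (-s) * ∫ x, f j x ^ 2) := by
      have := Real.rpow_nonneg hrj.le (-s)
      positivity
    linarith

/-- Finite Morse index yields almost stability away from finitely many points. -/
lemma exists_finset_almost_stable (m : ℕ) {ε : ℝ} (hε : 0 < ε) {u : Rn n → ℝ}
    (hu : Continuous u) {Ω : Set (Rn n)} (hidx : ACMorseIndexLE n s ε u Ω m) :
    ∃ X : Finset (Rn n), X.card ≤ m ∧ ∀ (z : Rn n) (r : ℝ), 0 < r → ball z r ⊆ Ω →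
      (∀ x ∈ X, 4 * r ≤ ‖z - x‖) → ∀ f, IsCc1On n (ball z r) f →
      -((alphaC n s * volume.real (ball (0 : Rn n) 1) *
        (1 / 2 * ((m + 1 : ℕ) : ℝ) * 2 ^ n + ((m + 1 : ℕ) : ℝ)) + 1) *
          (r ^ (-s) * ∫ x, f x ^ 2)) ≤ energyForm n s ε u f := by
  have hα := alphaC_pos hn hs
  have hs0 := hs.1
  set ω := volume.real (ball (0 : Rn n) 1) with hω
  have hω0 : 0 ≤ ω := measureReal_nonneg
  set Λ := alphaC n s * ω * (1 / 2 * ((m + 1 : ℕ) : ℝ) * 2 ^ n + ((m + 1 : ℕ) : ℝ)) with hΛ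
  have hΛ0 : 0 ≤ Λ := by positivity
  let S : Set (Rn n × ℝ) := {q | 0 < q.2 ∧ ball q.1 q.2 ⊆ Ω ∧ ∃ f, IsCc1On n (ball q.1 q.2) f ∧
    energyForm n s ε u f < -((Λ + 1) * (q.2 ^ (-s) * ∫ x, f x ^ 2))}
  have hS : ∀ q ∈ S, ε ≤ q.2 := by
    rintro ⟨z, r⟩ ⟨hr, -, f, hf, hlt⟩
    by_contra! hlt'
    have h1 := neg_le_energyForm hn hs hε hu hf
    have h2 : ε ^ (-s) ≤ r ^ (-s) := Real.rpow_le_rpow_of_nonpos hr hlt'.le (by linarith)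
    have h3 : 0 ≤ ∫ x, f x ^ 2 := integral_nonneg fun _ => sq_nonneg _
    have h4 : 0 ≤ r ^ (-s) := Real.rpow_nonneg hr.le _
    have h5 : 0 ≤ Λ * (r ^ (-s) * ∫ x, f x ^ 2) := by positivity
    have h6 := mul_le_mul_of_nonneg_right h2 h3
    simp only at hlt
    linarith
  obtain ⟨X, hX, hX'⟩ := exists_finset_cover m S hε hS fun q hq hsep => by
    choose hr hΩ f hf hlt using hq
    have hf0 : ∀ i, ∃ x, f i x ≠ 0 := fun i => by
      by_contra! h0
      have : f i = fun _ => 0 := funext h0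
      have h1 := hlt i
      rw [this, energyForm_zero] at h1
      simp at h1
    have hzero : ∀ i j x, i ≠ j → f i x ≠ 0 → f j x = 0 := by
      have key : ∀ i j x, i < j → f i x ≠ 0 → f j x ≠ 0 → False := fun i j x hij hi hj => by
        have hi' : x ∈ ball (q i).1 (q i).2 := by
          by_contra h; exact hi ((hf i).eq_zero h)
        have hj' : x ∈ ball (q j).1 (q j).2 := by
          by_contra h; exact hj ((hf j).eq_zero h)
        obtain ⟨h1, h2⟩ := hsep i j hij
        rw [mem_ball, dist_eq_norm] at hi' hj'
        have h3 := norm_sub_le (x - (q j).1) (x - (q i).1)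
        rw [sub_sub_sub_cancel_left] at h3
        have := hr j
        linarith
      intro i j x hij hi
      by_contra hj
      rcases lt_or_gt_of_ne hij with h | h
      · exact key i j x h hi hj
      · exact key j i x h hj hi
    have hlin : LinearIndependent ℝ f := by
      rw [Fintype.linearIndependent_iff]
      intro a ha i
      obtain ⟨x, hx⟩ := hf0 i
      have h1 := congrFun ha x
      simp only [Finset.sum_apply, Pi.smul_apply, smul_eq_mul, Pi.zero_apply] at h1
      rw [Finset.sum_eq_single i (fun j _ hj => by rw [hzero i j x hj.symm hx, mul_zero])
        (fun h => (h (Finset.mem_univ i)).elim)] at h1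
      exact (mul_eq_zero.1 h1).resolve_right hx
    obtain ⟨a, ha, hQ⟩ := hidx f (fun i => (hf i).mono (hΩ i)) hlin
    have hsum : IsCc1On n Ω (fun x => ∑ i, a i * f i x) :=
      IsCc1On.sum (fun i => ((hf i).mono (hΩ i)).const_mul (a i)) Finset.univ
    rw [hsum.qform_eq hn hs] at hQ
    have h1 := (energyForm_sum_le (ε := ε) hn hs hu hr hΩ hsep (fun i => (hf i).const_mul (a i))
      Finset.univ).1
    have h2 : ∀ i, energyForm n s ε u (fun x => a i * f i x) +
        Λ * ((q i).2 ^ (-s) * ∫ x, (a i * f i x) ^ 2) =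
        a i ^ 2 * (energyForm n s ε u (f i) + Λ * ((q i).2 ^ (-s) * ∫ x, f i x ^ 2)) :=
      fun i => by
        rw [energyForm_const_mul]
        simp only [mul_pow, integral_const_mul]
        ring
    have h3 : ∀ i, energyForm n s ε u (f i) + Λ * ((q i).2 ^ (-s) * ∫ x, f i x ^ 2) < 0 :=
      fun i => by
        have h4 := hlt i
        have h5 : 0 ≤ (q i).2 ^ (-s) * ∫ x, f i x ^ 2 :=
          mul_nonneg (Real.rpow_nonneg (hr i).le _) (integral_nonneg fun _ => sq_nonneg _)
        linarith
    rw [Finset.card_univ, Fintype.card_fin, Finset.sum_congr rfl fun i _ => h2 i] at h1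
    obtain ⟨k, hk⟩ := Function.ne_iff.1 ha
    have h4 : ∑ i, a i ^ 2 * (energyForm n s ε u (f i) +
        Λ * ((q i).2 ^ (-s) * ∫ x, f i x ^ 2)) < 0 := by
      refine Finset.sum_neg' (fun i _ => ?_) ⟨k, Finset.mem_univ k, ?_⟩
      · exact mul_nonpos_of_nonneg_of_nonpos (sq_nonneg _) (h3 i).le
      · have : a k ≠ 0 := hk
        exact mul_neg_of_pos_of_neg (by positivity) (h3 k)
    exact absurd (hQ.trans h1) (not_le.2 h4)
  refine ⟨X, hX, fun z r hr hΩ hfar f hf => ?_⟩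
  by_contra! hlt
  obtain ⟨x, hx, hx'⟩ := hX' (z, r) ⟨hr, hΩ, f, hf, hlt⟩
  exact absurd (hfar x hx) (not_le.2 hx')
end
end

noncomputable section

/-- `u` solves the equation in `ball z r` and its second variation there is bounded below at
the natural scale. -/
structure IsGoodBall (n : ℕ) (s ε Λ : ℝ) (u : Rn n → ℝ) (z : Rn n) (r : ℝ) : Prop where
  pos : 0 < r
  sol : IsACSol n s ε u (ball z r)
  stable : ∀ f, IsCc1On n (ball z r) f →
    -(Λ * (r ^ (-s) * ∫ x, f x ^ 2)) ≤ energyForm n s ε u f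

section
variable {n : ℕ}

lemma integral_comp_affine (F : Rn n → ℝ) (z : Rn n) {r : ℝ} (hr : 0 < r) :
    ∫ x, F (z + r • x) = (r ^ n)⁻¹ * ∫ y, F y := by
  have h := Measure.integral_comp_smul (volume : Measure (Rn n)) (fun y => F (z + y)) r
  rw [finrank_euclideanSpace, Fintype.card_fin, smul_eq_mul, abs_of_nonneg (by positivity),
    integral_add_left_eq_self F z] at h
  exact h

lemma integral_eq_affine (F : Rn n → ℝ) (z : Rn n) {r : ℝ} (hr : 0 < r) :
    ∫ y, F y = r ^ n * ∫ x, F (z + r • x) := by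
  rw [integral_comp_affine F z hr, mul_inv_cancel_left₀ (by positivity)]

lemma setIntegral_comp_affine (F : Rn n → ℝ) (z : Rn n) {r : ℝ} (hr : 0 < r) (ρ : ℝ) :
    ∫ x in ball 0 ρ, F (z + r • x) = (r ^ n)⁻¹ * ∫ y in ball z (r * ρ), F y := by
  rw [← integral_indicator measurableSet_ball, ← integral_indicator measurableSet_ball,
    ← integral_comp_affine _ z hr]
  congr 1
  ext x
  by_cases hx : x ∈ ball (0 : Rn n) ρ
  · have hx' : z + r • x ∈ ball z (r * ρ) := by
      rw [mem_ball_zero_iff] at hx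
      rw [mem_ball, dist_eq_norm, add_sub_cancel_left, norm_smul, Real.norm_of_nonneg hr.le]
      gcongr
    rw [indicator_of_mem hx, indicator_of_mem hx']
  · have hx' : z + r • x ∉ ball z (r * ρ) := by
      rw [mem_ball_zero_iff, not_lt] at hx
      rw [mem_ball, dist_eq_norm, add_sub_cancel_left, norm_smul, Real.norm_of_nonneg hr.le,
        not_lt]
      gcongr
    rw [indicator_of_notMem hx, indicator_of_notMem hx']

lemma radKer_smul {r : ℝ} (hr : 0 < r) (s : ℝ) (z : Rn n) :
    radKer n s (r • z) = (r ^ n)⁻¹ * r ^ (-s) * radKer n s z := by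
  rw [radKer, radKer, norm_smul, Real.norm_of_nonneg hr.le, Real.mul_rpow hr.le (norm_nonneg _),
    neg_add, Real.rpow_add hr, Real.rpow_neg hr.le, Real.rpow_natCast]
  ring

lemma sqDiff_comp_affine (f : Rn n → ℝ) (z : Rn n) {r : ℝ} (hr : 0 < r) (w : Rn n) :
    sqDiff (fun x => f (z + r • x)) w = (r ^ n)⁻¹ * sqDiff f (r • w) := by
  unfold sqDiff
  rw [← integral_comp_affine _ z hr]
  simp only [smul_add, add_assoc]

lemma kinetic_comp_affine (s : ℝ) (f : Rn n → ℝ) (z : Rn n) {r : ℝ} (hr : 0 < r) :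
    kinetic n s (fun x => f (z + r • x)) = (r ^ n)⁻¹ * r ^ s * kinetic n s f := by
  unfold kinetic
  rw [integral_eq_affine (fun w => sqDiff f w * radKer n s w) 0 hr]
  simp only [zero_add, radKer_smul hr, sqDiff_comp_affine f z hr]
  rw [← integral_const_mul, ← integral_const_mul]
  congr 1
  ext w
  have h1 : r ^ s * r ^ (-s) = 1 := by
    rw [← Real.rpow_add hr, add_neg_cancel, Real.rpow_zero]
  have h2 : (r ^ n)⁻¹ * r ^ n = 1 := inv_mul_cancel₀ (by positivity)
  linear_combination (-((r ^ n)⁻¹ * sqDiff f (r • w) * radKer n s w) * ((r ^ n)⁻¹ * r ^ n)) * h1 +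
    (-((r ^ n)⁻¹ * sqDiff f (r • w) * radKer n s w)) * h2

lemma norm_fderiv_comp_affine {u : Rn n → ℝ} (hu : ContDiff ℝ 1 u) (z : Rn n) {r : ℝ}
    (hr : 0 < r) (x : Rn n) :
    ‖fderiv ℝ (fun x => u (z + r • x)) x‖ = r * ‖fderiv ℝ u (z + r • x)‖ := by
  have h1 : HasFDerivAt (fun x : Rn n => z + r • x) (r • ContinuousLinearMap.id ℝ (Rn n)) x :=
    ((hasFDerivAt_id x).const_smul r).const_add z
  have h2 := ((hu.differentiable one_ne_zero) (z + r • x)).hasFDerivAt.comp x h1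
  have h3 : fderiv ℝ (fun x => u (z + r • x)) x = r • fderiv ℝ u (z + r • x) := by
    refine h2.fderiv.trans ?_
    ext v
    simp
  rw [h3, norm_smul, Real.norm_of_nonneg hr.le]

lemma IsACSol.comp_affine {s ε : ℝ} (hε : 0 < ε) {u : Rn n → ℝ} {z : Rn n} {r : ℝ} (hr : 0 < r)
    (h : IsACSol n s ε u (ball z r)) :
    IsACSol n s (ε / r) (fun x => u (z + r • x)) (ball 0 1) := by
  intro x hx
  have hx' : z + r • x ∈ ball z r := by
    rw [mem_ball_zero_iff] at hx
    rw [mem_ball, dist_eq_norm, add_sub_cancel_left, norm_smul, Real.norm_of_nonneg hr.le]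
    nlinarith
  have h1 := h _ hx'
  rw [integral_sub_mul_fracKer,
    integral_eq_affine (fun w => (u (z + r • x) - u (z + r • x + w)) * radKer n s w) 0 hr] at h1
  rw [integral_sub_mul_fracKer (fun x => u (z + r • x))]
  simp only [zero_add, radKer_smul hr] at h1
  have e : ∀ w, (u (z + r • x) - u (z + r • x + r • w)) *
      ((r ^ n)⁻¹ * r ^ (-s) * radKer n s w) = (r ^ n)⁻¹ * r ^ (-s) *
      ((u (z + r • x) - u (z + r • (x + w))) * radKer n s w) := fun w => by
    rw [smul_add, ← add_assoc]; ring
  simp only [e, integral_const_mul] at h1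
  rw [Real.div_rpow hε.le hr.le, div_eq_mul_inv, Real.rpow_neg hr.le, inv_inv]
  have h2 : r ^ (-s) = (r ^ s)⁻¹ := Real.rpow_neg hr.le s
  have h3 : 0 < r ^ s := Real.rpow_pos_of_pos hr s
  rw [h2, ← mul_assoc, ← mul_assoc, mul_inv_cancel₀ (by positivity), one_mul] at h1
  field_simp at h1
  linarith
end

section
variable {n : ℕ} (hn : 1 ≤ n) {s : ℝ} (hs : s ∈ Ioo (0 : ℝ) 1)

lemma IsGoodBall.stableInUnitBall {ε Λ : ℝ} (hε : 0 < ε) {u : Rn n → ℝ} {z : Rn n} {r : ℝ}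
    (h : IsGoodBall n s ε Λ u z r) :
    StableInUnitBall n s (ε / r) Λ (fun x => u (z + r • x)) := by
  intro ξ hξ
  have hr := h.pos
  set f : Rn n → ℝ := fun y => ξ (r⁻¹ • (y - z)) with hf
  have hfx : ∀ x, f (z + r • x) = ξ x := fun x => by
    simp only [hf, add_sub_cancel_left, inv_smul_smul₀ hr.ne']
  let e : Rn n ≃ₜ Rn n :=
    (Homeomorph.subRight z).trans (Homeomorph.smulOfNeZero r⁻¹ (inv_ne_zero hr.ne'))
  have he : f = ξ ∘ e := rfl
  have hfc : IsCc1On n (ball z r) f := by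
    refine ⟨hξ.1.comp (by fun_prop), ?_, ?_⟩
    · rw [he]; exact hξ.2.1.comp_homeomorph e
    · rw [he, tsupport_comp_eq_preimage]
      intro y hy
      have h1 := hξ.2.2 hy
      have h2 : e y = r⁻¹ • (y - z) := rfl
      rw [h2, mem_ball_zero_iff, norm_smul, norm_inv, Real.norm_of_nonneg hr.le,
        inv_mul_lt_one₀ hr] at h1
      rwa [mem_ball, dist_eq_norm]
  have h1 := h.stable f hfc
  have hk := kinetic_comp_affine s f z hr
  have h2 := integral_comp_affine (fun y => f y ^ 2) z hr
  have h3 := integral_comp_affine (fun y => (3 * u y ^ 2 - 1) * f y ^ 2) z hr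
  simp only [hfx] at hk h2 h3
  change _ ≤ 1 / 4 * kinetic n s ξ + _
  have e1 : ∫ x, (1 - 3 * u (z + r • x) ^ 2) * ξ x ^ 2 =
      -∫ x, (3 * u (z + r • x) ^ 2 - 1) * ξ x ^ 2 := by
    rw [← integral_neg]
    congr 1; ext x; ring
  rw [e1, h3, h2, hk, Real.div_rpow hε.le hr.le, div_eq_mul_inv, Real.rpow_neg hr.le, inv_inv]
  have h4 : 0 < r ^ s := Real.rpow_pos_of_pos hr s
  have h5 : 0 < (r ^ n)⁻¹ := by positivity
  unfold energyForm at h1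
  rw [Real.rpow_neg hr.le] at h1
  have h6 := mul_le_mul_of_nonneg_left h1 (by positivity : 0 ≤ (r ^ n)⁻¹ * r ^ s)
  have h7 : (r ^ n)⁻¹ * r ^ s * -(Λ * ((r ^ s)⁻¹ * ∫ x, f x ^ 2)) =
      -(Λ * ((r ^ n)⁻¹ * ∫ x, f x ^ 2)) := by
    field_simp
  rw [h7] at h6
  linarith

include hn hs

/-- Reverse-absorption estimate for the Dirichlet energy on a good ball. -/
lemma IsGoodBall.dirichlet_improvement {Λ δ : ℝ} (hΛ : 0 ≤ Λ) (hδ : 0 < δ) :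
    ∃ C : ℝ, 0 ≤ C ∧ ∀ (ε : ℝ) (u : Rn n → ℝ) (K : ℝ), 0 < ε → ContDiff ℝ 1 u →
    (∀ x, |u x| ≤ 1) → (∀ x, ‖fderiv ℝ u x‖ ≤ K) → ∀ z r, IsGoodBall n s ε Λ u z r →
    ∫ x in ball z (r / 4), ‖fderiv ℝ u x‖ ^ 2 ≤
      δ * (∫ x in ball z (r / 2), ‖fderiv ℝ u x‖ ^ 2) + C * (r ^ n / r ^ 2) := by
  obtain ⟨C, hC, h⟩ := _root_.dirichlet_improvement hn hs hΛ hδ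
  refine ⟨C, hC, fun ε u K hε hu hu1 hK z r hg => ?_⟩
  have hr := hg.pos
  have h1 := h (ε / r) (fun x => u (z + r • x)) (r * K) (by positivity)
    (hu.comp (by fun_prop)) (fun x => hu1 _) (fun x => ?_) (hg.sol.comp_affine hε hr)
    (hg.stableInUnitBall hε)
  · simp only [norm_fderiv_comp_affine hu z hr, mul_pow] at h1
    rw [setIntegral_comp_affine (fun y => r ^ 2 * ‖fderiv ℝ u y‖ ^ 2) z hr,
      setIntegral_comp_affine (fun y => r ^ 2 * ‖fderiv ℝ u y‖ ^ 2) z hr,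
      integral_const_mul, integral_const_mul, mul_one_div, mul_one_div] at h1
    have h2 := mul_le_mul_of_nonneg_left h1 (by positivity : 0 ≤ r ^ n / r ^ 2)
    have e : ∀ I : ℝ, r ^ n / r ^ 2 * ((r ^ n)⁻¹ * (r ^ 2 * I)) = I := fun I => by
      field_simp
    rw [e, mul_add, mul_left_comm, e] at h2
    linarith
  · rw [norm_fderiv_comp_affine hu z hr]
    have := hK (z + r • x)
    gcongr

lemma IsGoodBall.potential_le_dirichlet {Λ q : ℝ} (hΛ : 0 ≤ Λ) (hq : 0 ≤ q) (hq2 : q ≤ 2 * s) :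
    ∃ C : ℝ, 0 ≤ C ∧ ∀ (ε : ℝ) (u : Rn n → ℝ) (K : ℝ), 0 < ε → ContDiff ℝ 1 u →
    (∀ x, |u x| ≤ 1) → (∀ x, ‖fderiv ℝ u x‖ ≤ K) → ∀ z r, IsGoodBall n s ε Λ u z r →
    ∫ x in ball z (r / 16), Wpot (u x) ≤ C * (ε / r) ^ q *
      (r ^ 2 * (∫ x in ball z (r / 4), ‖fderiv ℝ u x‖ ^ 2) + r ^ n) := by
  obtain ⟨C, hC, h⟩ := _root_.potential_le_dirichlet hn hs hΛ hq hq2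
  refine ⟨C, hC, fun ε u K hε hu hu1 hK z r hg => ?_⟩
  have hr := hg.pos
  have h1 := h (ε / r) (fun x => u (z + r • x)) (r * K) (by positivity)
    (hu.comp (by fun_prop)) (fun x => hu1 _) (fun x => ?_) (hg.sol.comp_affine hε hr)
    (hg.stableInUnitBall hε)
  · simp only [norm_fderiv_comp_affine hu z hr, mul_pow] at h1
    rw [setIntegral_comp_affine (fun y => r ^ 2 * ‖fderiv ℝ u y‖ ^ 2) z hr,
      setIntegral_comp_affine (fun y => Wpot (u y)) z hr,
      integral_const_mul, mul_one_div, mul_one_div] at h1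
    have h2 := mul_le_mul_of_nonneg_left h1 (by positivity : 0 ≤ r ^ n)
    rw [mul_inv_cancel_left₀ (by positivity)] at h2
    refine h2.trans_eq ?_
    field_simp
  · rw [norm_fderiv_comp_affine hu z hr]
    have := hK (z + r • x)
    gcongr
end
end

noncomputable section

lemma rpow_le_two_rpow_abs_mul {x y : ℝ} (hx : 0 < x) (hy : 0 < y) (h1 : x ≤ 2 * y)
    (h2 : y ≤ 2 * x) (a : ℝ) : x ^ a ≤ 2 ^ |a| * y ^ a := by
  rcases le_or_gt 0 a with ha | ha
  · rw [abs_of_nonneg ha, ← Real.mul_rpow (by norm_num) hy.le]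
    exact Real.rpow_le_rpow hx.le h1 ha
  · have h3 : x ^ a ≤ (y / 2) ^ a :=
      Real.rpow_le_rpow_of_nonpos (by positivity) (by linarith) ha.le
    rw [Real.div_rpow hy.le (by norm_num)] at h3
    rw [abs_of_neg ha, Real.rpow_neg (by norm_num)]
    rwa [div_eq_inv_mul] at h3

/-- A quarter of the distance to `S`. -/
def scale {n : ℕ} (S : Set (Rn n)) (z : Rn n) : ℝ := infDist z S / 4

/-- Powers of the scale function, as an extended nonnegative weight. -/
def weight {n : ℕ} (S : Set (Rn n)) (a : ℝ) (z : Rn n) : ENNReal := ENNReal.ofReal (scale S z ^ a)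

section
variable {n : ℕ} {S : Set (Rn n)}

lemma continuous_scale (S : Set (Rn n)) : Continuous (scale S) :=
  (continuous_infDist_pt S).div_const 4

lemma measurable_weight (S : Set (Rn n)) (a : ℝ) : Measurable (weight S a) :=
  ((continuous_scale S).measurable.pow_const a).ennreal_ofReal

lemma measurableSet_scale_pos (S : Set (Rn n)) : MeasurableSet {z | 0 < scale S z} :=
  measurableSet_lt measurable_const (continuous_scale S).measurable

lemma weight_mul {z : Rn n} (hz : 0 < scale S z) (a b : ℝ) :
    weight S a z * weight S b z = weight S (a + b) z := by
  rw [weight, weight, weight, ← ENNReal.ofReal_mul (Real.rpow_nonneg hz.le _), Real.rpow_add hz]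

lemma scale_comparable {z y : Rn n} (h : ‖y - z‖ ≤ scale S z / 2) :
    scale S y ≤ 2 * scale S z ∧ scale S z ≤ 2 * scale S y := by
  have h1 := infDist_le_infDist_add_dist (s := S) (x := y) (y := z)
  have h2 := infDist_le_infDist_add_dist (s := S) (x := z) (y := y)
  rw [dist_eq_norm] at h1 h2
  rw [norm_sub_rev] at h2
  have h3 : 0 ≤ infDist z S := infDist_nonneg
  unfold scale at h ⊢
  constructor <;> linarith

lemma weight_le {x y : Rn n} (hx : 0 < scale S x) (hy : 0 < scale S y)
    (h1 : scale S x ≤ 2 * scale S y) (h2 : scale S y ≤ 2 * scale S x) (a : ℝ) :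
    weight S a x ≤ ENNReal.ofReal (2 ^ |a|) * weight S a y := by
  rw [weight, weight, ← ENNReal.ofReal_mul (by positivity)]
  exact ENNReal.ofReal_le_ofReal (rpow_le_two_rpow_abs_mul hx hy h1 h2 a)

lemma volume_ball_scale {y : Rn n} (hy : 0 < scale S y) {c : ℝ} (hc : 0 < c) :
    volume (ball y (c * scale S y)) =
      ENNReal.ofReal (c ^ n * volume.real (ball (0 : Rn n) 1)) * weight S n y := by
  rw [Measure.addHaar_ball_of_pos _ _ (by positivity), finrank_euclideanSpace, Fintype.card_fin,
    weight, Real.rpow_natCast, mul_pow, ENNReal.ofReal_mul (by positivity),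
    ENNReal.ofReal_mul (by positivity), measureReal_def,
    ENNReal.ofReal_toReal measure_ball_lt_top.ne]
  ring

/-- Weighted averages over balls of comparable scale, with the order of integration exchanged. -/
lemma lintegral_weight_average_eq (S : Set (Rn n)) (a c : ℝ) {f : Rn n → ENNReal}
    (hf : Measurable f) :
    ∫⁻ z in {z | 0 < scale S z}, weight S a z * ∫⁻ y in ball z (c * scale S z), f y =
      ∫⁻ y, ∫⁻ z in {z | 0 < scale S z},
        {q : Rn n × Rn n | ‖q.2 - q.1‖ < c * scale S q.1}.indicator
          (fun q => weight S a q.1 * f q.2) (z, y) := by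
  have hw := measurable_weight S a
  have hsc := continuous_scale S
  have hD : MeasurableSet {q : Rn n × Rn n | ‖q.2 - q.1‖ < c * scale S q.1} :=
    (isOpen_lt (by fun_prop) (by fun_prop)).measurableSet
  have hF : Measurable ({q : Rn n × Rn n | ‖q.2 - q.1‖ < c * scale S q.1}.indicator
      (fun q => weight S a q.1 * f q.2)) := Measurable.indicator (by fun_prop) hD
  rw [← lintegral_lintegral_swap (μ := volume.restrict {z | 0 < scale S z}) (ν := volume)
    (f := fun z y => {q : Rn n × Rn n | ‖q.2 - q.1‖ < c * scale S q.1}.indicator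
      (fun q => weight S a q.1 * f q.2) (z, y)) hF.aemeasurable]
  refine lintegral_congr fun z => ?_
  rw [← lintegral_const_mul _ hf, ← lintegral_indicator measurableSet_ball]
  refine lintegral_congr fun y => ?_
  by_cases h : ‖y - z‖ < c * scale S z
  · rw [indicator_of_mem (by rwa [mem_ball, dist_eq_norm]), indicator_of_mem (show (z, y) ∈ {q : Rn n × Rn n |
      ‖q.2 - q.1‖ < c * scale S q.1} from h)]
  · rw [indicator_of_notMem (by rwa [mem_ball, dist_eq_norm]), indicator_of_notMem
      (show (z, y) ∉ {q : Rn n × Rn n | ‖q.2 - q.1‖ < c * scale S q.1} from h)]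

lemma lintegral_weight_average_le (S : Set (Rn n)) (a : ℝ) {c : ℝ} (hc : 0 < c) (hc2 : c ≤ 1 / 2)
    {f : Rn n → ENNReal} (hf : Measurable f) :
    ∫⁻ z in {z | 0 < scale S z}, weight S a z * ∫⁻ y in ball z (c * scale S z), f y ≤
      ENNReal.ofReal (2 ^ |a| * ((2 * c) ^ n * volume.real (ball (0 : Rn n) 1))) *
        ∫⁻ y in {z | 0 < scale S z}, weight S (a + n) y * f y := by
  have hU := measurableSet_scale_pos S
  rw [lintegral_weight_average_eq S a c hf, ← lintegral_indicator hU,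
    ← lintegral_const_mul' _ _ ENNReal.ofReal_ne_top]
  refine lintegral_mono fun y => ?_
  have hmem : ∀ z, 0 < scale S z → ‖y - z‖ < c * scale S z →
      scale S y ≤ 2 * scale S z ∧ scale S z ≤ 2 * scale S y := fun z hz h =>
    scale_comparable (by nlinarith)
  by_cases hy : 0 < scale S y
  · rw [indicator_of_mem (show y ∈ {z | 0 < scale S z} from hy)]
    calc _ ≤ ∫⁻ z in {z | 0 < scale S z}, (ball y (2 * c * scale S y)).indicator
          (fun _ => ENNReal.ofReal (2 ^ |a|) * weight S a y * f y) z := by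
          refine setLIntegral_mono' hU fun z hz => ?_
          by_cases h : ‖y - z‖ < c * scale S z
          · obtain ⟨h1, h2⟩ := hmem z hz h
            rw [indicator_of_mem (show (z, y) ∈ {q : Rn n × Rn n |
              ‖q.2 - q.1‖ < c * scale S q.1} from h),
              indicator_of_mem]
            · exact mul_le_mul_left (weight_le hz hy h2 h1 a) _
            · rw [mem_ball, dist_eq_norm, norm_sub_rev]
              nlinarith
          · rw [indicator_of_notMem (show (z, y) ∉ {q : Rn n × Rn n |
              ‖q.2 - q.1‖ < c * scale S q.1} from h)]
            exact zero_le
      _ ≤ ∫⁻ z, (ball y (2 * c * scale S y)).indicator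
          (fun _ => ENNReal.ofReal (2 ^ |a|) * weight S a y * f y) z :=
          setLIntegral_le_lintegral _ _
      _ = _ := by
          rw [lintegral_indicator measurableSet_ball, setLIntegral_const,
            volume_ball_scale hy (by positivity), ENNReal.ofReal_mul (p := 2 ^ |a|) (by positivity),
            ← weight_mul hy]
          ring
  · rw [indicator_of_notMem (show y ∉ {z | 0 < scale S z} from hy)]
    rw [mul_zero]
    refine le_of_eq (setLIntegral_eq_zero hU fun z hz => ?_)
    rw [indicator_of_notMem]
    · rfl
    · intro h
      have h2 := (hmem z hz h).2
      have hz' : 0 < scale S z := hz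
      exact hy (by linarith)

lemma lintegral_weight_le_average (S : Set (Rn n)) (a : ℝ) {c : ℝ} (hc : 0 < c) (hc2 : c ≤ 1 / 2)
    {f : Rn n → ENNReal} (hf : Measurable f) :
    ∫⁻ y in {z | 0 < scale S z}, weight S (a + n) y * f y ≤
      ENNReal.ofReal (2 ^ |a| * ((c / 2) ^ n * volume.real (ball (0 : Rn n) 1))⁻¹) *
      ∫⁻ z in {z | 0 < scale S z}, weight S a z * ∫⁻ y in ball z (c * scale S z), f y := by
  have hU := measurableSet_scale_pos S
  have hω : 0 < volume.real (ball (0 : Rn n) 1) :=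
    ENNReal.toReal_pos (Metric.measure_ball_pos _ _ one_pos).ne' measure_ball_lt_top.ne
  rw [lintegral_weight_average_eq S a c hf, ← lintegral_indicator hU,
    ← lintegral_const_mul' _ _ ENNReal.ofReal_ne_top]
  refine lintegral_mono fun y => ?_
  by_cases hy : 0 < scale S y
  swap
  · rw [indicator_of_notMem (show y ∉ {z | 0 < scale S z} from hy)]
    exact zero_le
  rw [indicator_of_mem (show y ∈ {z | 0 < scale S z} from hy)]
  have hmem : ∀ z ∈ ball y (c / 2 * scale S y), 0 < scale S z ∧ ‖y - z‖ < c * scale S z ∧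
      scale S z ≤ 2 * scale S y ∧ scale S y ≤ 2 * scale S z := fun z hz => by
    rw [mem_ball, dist_eq_norm] at hz
    obtain ⟨h1, h2⟩ := scale_comparable (S := S) (z := y) (y := z) (by nlinarith)
    refine ⟨by linarith, ?_, h1, h2⟩
    rw [norm_sub_rev]
    nlinarith
  have hkey : ∫⁻ z in ball y (c / 2 * scale S y), weight S a y * f y ≤
      ENNReal.ofReal (2 ^ |a|) * ∫⁻ z in {z | 0 < scale S z},
        {q : Rn n × Rn n | ‖q.2 - q.1‖ < c * scale S q.1}.indicator
          (fun q => weight S a q.1 * f q.2) (z, y) := by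
    rw [← lintegral_const_mul' _ _ ENNReal.ofReal_ne_top]
    calc _ ≤ ∫⁻ z in ball y (c / 2 * scale S y), ENNReal.ofReal (2 ^ |a|) *
          {q : Rn n × Rn n | ‖q.2 - q.1‖ < c * scale S q.1}.indicator
            (fun q => weight S a q.1 * f q.2) (z, y) := by
          refine setLIntegral_mono' measurableSet_ball fun z hz => ?_
          obtain ⟨h0, h1, h2, h3⟩ := hmem z hz
          rw [indicator_of_mem (show (z, y) ∈ {q : Rn n × Rn n |
              ‖q.2 - q.1‖ < c * scale S q.1} from h1), ← mul_assoc]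
          exact mul_le_mul_left (weight_le hy h0 h3 h2 a) _
      _ ≤ _ := lintegral_mono_set fun z hz => (hmem z hz).1
  rw [setLIntegral_const, volume_ball_scale hy (by positivity)] at hkey
  have h2 := mul_le_mul_right hkey
    (ENNReal.ofReal (((c / 2) ^ n * volume.real (ball (0 : Rn n) 1))⁻¹))
  calc _ = ENNReal.ofReal (((c / 2) ^ n * volume.real (ball (0 : Rn n) 1))⁻¹) *
        (weight S a y * f y * (ENNReal.ofReal ((c / 2) ^ n * volume.real (ball (0 : Rn n) 1)) *
          weight S n y)) := by
        have e : ENNReal.ofReal (((c / 2) ^ n * volume.real (ball (0 : Rn n) 1))⁻¹) *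
            ENNReal.ofReal ((c / 2) ^ n * volume.real (ball (0 : Rn n) 1)) = 1 := by
          rw [← ENNReal.ofReal_mul (by positivity), inv_mul_cancel₀ (by positivity),
            ENNReal.ofReal_one]
        rw [← weight_mul hy]
        calc _ = 1 * (weight S a y * weight S n y * f y) := by rw [one_mul]
          _ = _ := by rw [← e]; ring
    _ ≤ _ := h2
    _ = _ := by
        rw [ENNReal.ofReal_mul (p := 2 ^ |a|) (by positivity)]
        ring
end
end

noncomputable section

section
variable {n : ℕ}

lemma lintegral_eq_affine {F : Rn n → ENNReal} (hF : Measurable F) (z : Rn n) {r : ℝ}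
    (hr : 0 < r) : ∫⁻ y, F y = ENNReal.ofReal (r ^ n) * ∫⁻ x, F (z + r • x) := by
  have h1 : ∫⁻ x, F (z + r • x) = ENNReal.ofReal ((r ^ n)⁻¹) * ∫⁻ y, F y := by
    have h := lintegral_map (μ := (volume : Measure (Rn n))) (f := fun y => F (z + y))
      (g := fun x => r • x) (hF.comp (measurable_const_add z)) (measurable_const_smul r)
    rw [Measure.map_addHaar_smul _ hr.ne', lintegral_smul_measure, finrank_euclideanSpace,
      Fintype.card_fin, abs_of_pos (by positivity), lintegral_add_left_eq_self F z,
      smul_eq_mul] at h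
    exact h.symm
  rw [h1, ← mul_assoc, ← ENNReal.ofReal_mul (by positivity), mul_inv_cancel₀ (by positivity),
    ENNReal.ofReal_one, one_mul]

lemma lintegral_ball_radial {φ : ℝ → ℝ} (hφ : Measurable φ) (z : Rn n) {r : ℝ} (hr : 0 < r) :
    ∫⁻ y in ball z r, ENNReal.ofReal (φ (‖y - z‖ / r)) =
      ENNReal.ofReal (r ^ n) * ∫⁻ x in ball (0 : Rn n) 1, ENNReal.ofReal (φ ‖x‖) := by
  rw [← lintegral_indicator measurableSet_ball, ← lintegral_indicator measurableSet_ball,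
    lintegral_eq_affine _ z hr]
  · congr 1
    refine lintegral_congr fun x => ?_
    have e : ‖z + r • x - z‖ / r = ‖x‖ := by
      rw [add_sub_cancel_left, norm_smul, Real.norm_of_nonneg hr.le, mul_div_cancel_left₀ _ hr.ne']
    have hiff : z + r • x ∈ ball z r ↔ x ∈ ball (0 : Rn n) 1 := by
      rw [mem_ball_zero_iff, mem_ball, dist_eq_norm, ← e, div_lt_one hr]
    by_cases hx : x ∈ ball (0 : Rn n) 1
    · rw [indicator_of_mem (hiff.2 hx), indicator_of_mem hx, e]
    · rw [indicator_of_notMem (fun h => hx (hiff.1 h)), indicator_of_notMem hx]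
  · exact Measurable.indicator (by fun_prop) measurableSet_ball

lemma lintegral_radial_lt_top (hn : 1 ≤ n) {φ : ℝ → ℝ} (hφ : IntegrableOn φ (Ioo 0 1)) :
    ∫⁻ x in ball (0 : Rn n) 1, ENNReal.ofReal (φ ‖x‖) < ⊤ := by
  have : Nonempty (Fin n) := ⟨⟨0, hn⟩⟩
  refine IntegrableOn.setLIntegral_lt_top ((integrableOn_fun_norm_addHaar volume).2 ?_)
  refine Integrable.mono' hφ.norm ?_ ?_
  · exact (continuous_pow _).aestronglyMeasurable.smul hφ.aestronglyMeasurable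
  · filter_upwards [ae_restrict_mem measurableSet_Ioo] with t ht
    rw [norm_smul, norm_pow, Real.norm_of_nonneg ht.1.le]
    exact mul_le_of_le_one_left (norm_nonneg _) (pow_le_one₀ ht.1.le ht.2.le)

lemma integrableOn_rpow_neg {q : ℝ} (hq : q < 1) :
    IntegrableOn (fun t : ℝ => t ^ (-q)) (Ioo 0 1) := by
  have h := intervalIntegral.intervalIntegrable_rpow' (a := 0) (b := 1) (r := -q) (by linarith)
  rw [intervalIntegrable_iff_integrableOn_Ioo_of_le zero_le_one] at h
  exact h

lemma integrableOn_one_sub_rpow_neg {q : ℝ} (hq : q < 1) :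
    IntegrableOn (fun t : ℝ => (1 - t) ^ (-q)) (Ioo 0 1) := by
  have h := (intervalIntegral.intervalIntegrable_rpow' (a := 0) (b := 1) (r := -q)
    (by linarith)).comp_sub_left 1
  rw [sub_zero, sub_self] at h
  have h2 := h.symm
  rw [intervalIntegrable_iff_integrableOn_Ioo_of_le zero_le_one] at h2
  exact h2

/-- Singularities of order less than one at the centre, at the boundary, or at an arbitrary point
are integrable over balls, with the natural scaling in the radius. -/
lemma exists_lintegral_singular_le (hn : 1 ≤ n) {q : ℝ} (hq0 : 0 ≤ q) (hq : q < 1) :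
    ∃ C : ENNReal, C ≠ ⊤ ∧ ∀ (p : Rn n) (R : ℝ), 0 < R →
      ∫⁻ y in ball p R, ENNReal.ofReal ((R - ‖y - p‖) ^ (-q)) ≤
        C * ENNReal.ofReal (R ^ ((n : ℝ) - q)) ∧
      ∀ x : Rn n, ∫⁻ y in ball p R, ENNReal.ofReal (‖y - x‖ ^ (-q)) ≤
        C * ENNReal.ofReal (R ^ ((n : ℝ) - q)) := by
  set c₁ := ∫⁻ x in ball (0 : Rn n) 1, ENNReal.ofReal (‖x‖ ^ (-q)) with hc₁
  set c₂ := ∫⁻ x in ball (0 : Rn n) 1, ENNReal.ofReal ((1 - ‖x‖) ^ (-q)) with hc₂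
  set ω := volume (ball (0 : Rn n) 1) with hω
  have h1 : c₁ < ⊤ := lintegral_radial_lt_top hn (integrableOn_rpow_neg hq)
  have h2 : c₂ < ⊤ := lintegral_radial_lt_top hn (integrableOn_one_sub_rpow_neg hq)
  have h3 : ω < ⊤ := measure_ball_lt_top
  refine ⟨c₁ + c₂ + ω, by simp [h1.ne, h2.ne, h3.ne], fun p R hR => ?_⟩
  have epow : R ^ (-q) * R ^ n = R ^ ((n : ℝ) - q) := by
    rw [← Real.rpow_natCast, ← Real.rpow_add hR]
    ring_nf
  have hscale : ∀ (φ : ℝ → ℝ), Measurable φ → ∀ (ψ : Rn n → ℝ) (x : Rn n),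
      (∀ y ∈ ball x R, ψ y = R ^ (-q) * φ (‖y - x‖ / R)) →
      ∫⁻ y in ball x R, ENNReal.ofReal (ψ y) =
        (∫⁻ x in ball (0 : Rn n) 1, ENNReal.ofReal (φ ‖x‖)) *
          ENNReal.ofReal (R ^ ((n : ℝ) - q)) := by
    intro φ hφ ψ x h
    rw [← epow, ENNReal.ofReal_mul (by positivity)]
    calc _ = ∫⁻ y in ball x R, ENNReal.ofReal (R ^ (-q)) *
          ENNReal.ofReal (φ (‖y - x‖ / R)) :=
          setLIntegral_congr_fun measurableSet_ball fun y hy => by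
            simp only [h y hy]
            exact ENNReal.ofReal_mul (by positivity)
      _ = _ := by
          rw [lintegral_const_mul' _ _ ENNReal.ofReal_ne_top, lintegral_ball_radial hφ x hR]
          ring
  have hcentre : ∀ x : Rn n, ∫⁻ y in ball x R, ENNReal.ofReal (‖y - x‖ ^ (-q)) =
      c₁ * ENNReal.ofReal (R ^ ((n : ℝ) - q)) := fun x =>
    hscale (fun t => t ^ (-q)) (by fun_prop) _ x fun y _ => by
      rw [Real.div_rpow (norm_nonneg _) hR.le, mul_div_cancel₀ _ (by positivity)]
  constructor
  · rw [hscale (fun t => (1 - t) ^ (-q)) (by fun_prop) _ p fun y hy => ?_]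
    · gcongr
      rw [add_right_comm]
      exact le_add_self
    · rw [mem_ball, dist_eq_norm] at hy
      rw [← Real.mul_rpow hR.le (by rw [sub_nonneg, div_le_one hR]; exact hy.le), mul_sub,
        mul_one, mul_div_cancel₀ _ hR.ne']
  · intro x
    calc _ ≤ ∫⁻ y in ball p R, ((ball x R).indicator
            (fun y => ENNReal.ofReal (‖y - x‖ ^ (-q))) y + ENNReal.ofReal (R ^ (-q))) := by
          refine lintegral_mono fun y => ?_
          by_cases hy : y ∈ ball x R
          · simp only [indicator_of_mem hy]
            exact le_self_add
          · simp only [indicator_of_notMem hy, zero_add]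
            rw [mem_ball, dist_eq_norm, not_lt] at hy
            exact ENNReal.ofReal_le_ofReal
              (Real.rpow_le_rpow_of_nonpos hR hy (by linarith))
      _ ≤ c₁ * ENNReal.ofReal (R ^ ((n : ℝ) - q)) + ω * ENNReal.ofReal (R ^ ((n : ℝ) - q)) := by
          rw [lintegral_add_right _ measurable_const, setLIntegral_const]
          refine add_le_add ?_ (le_of_eq ?_)
          · refine (setLIntegral_le_lintegral _ _).trans ?_
            rw [lintegral_indicator measurableSet_ball, hcentre]
          · rw [Measure.addHaar_ball_of_pos _ _ hR, finrank_euclideanSpace, Fintype.card_fin,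
              ← epow, ENNReal.ofReal_mul (by positivity)]
            ring
      _ ≤ _ := by
          rw [← add_mul]
          gcongr
          exact le_self_add
end
end

noncomputable section

section
variable {n : ℕ}

/-- Absorption of a weighted energy under a local improvement inequality at every point. -/
lemma exists_weighted_energy_le (n : ℕ) (a : ℝ) :
    ∃ δ : ℝ, 0 < δ ∧ ∃ K : ENNReal, K ≠ ⊤ ∧ ∀ (S : Set (Rn n)) (G : Rn n → ENNReal) (A : ENNReal),
      Measurable G → ∫⁻ z in {z | 0 < scale S z}, weight S (a + n) z * G z ≠ ⊤ →
      (∀ z, 0 < scale S z → ∫⁻ y in ball z (1 / 4 * scale S z), G y ≤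
        ENNReal.ofReal δ * (∫⁻ y in ball z (1 / 2 * scale S z), G y) +
          A * weight S ((n : ℝ) - 2) z) →
      ∫⁻ z in {z | 0 < scale S z}, weight S (a + n) z * G z ≤
        K * A * ∫⁻ z in {z | 0 < scale S z}, weight S (a + n - 2) z := by
  have hω : 0 < volume.real (ball (0 : Rn n) 1) :=
    ENNReal.toReal_pos (Metric.measure_ball_pos _ _ one_pos).ne' measure_ball_lt_top.ne
  set k₁ : ℝ := 2 ^ |a| * ((2 * (1 / 2)) ^ n * volume.real (ball (0 : Rn n) 1)) with hk₁
  set k₂ : ℝ := 2 ^ |a| * ((1 / 4 / 2) ^ n * volume.real (ball (0 : Rn n) 1))⁻¹ with hk₂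
  have hk₁0 : 0 < k₁ := by positivity
  have hk₂0 : 0 < k₂ := by positivity
  refine ⟨1 / (2 * (k₁ * k₂)), by positivity, ENNReal.ofReal (2 * k₂), ENNReal.ofReal_ne_top,
    fun S G A hG hfin h => ?_⟩
  set δ : ℝ := 1 / (2 * (k₁ * k₂)) with hδ
  have hU := measurableSet_scale_pos S
  set I := ∫⁻ z in {z | 0 < scale S z}, weight S (a + n) z * G z with hI
  set J := ∫⁻ z in {z | 0 < scale S z}, weight S (a + n - 2) z with hJ
  have h1 : I ≤ ENNReal.ofReal k₂ * ∫⁻ z in {z | 0 < scale S z},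
      weight S a z * ∫⁻ y in ball z (1 / 4 * scale S z), G y :=
    lintegral_weight_le_average S a (by norm_num) (by norm_num) hG
  have h2 : ∫⁻ z in {z | 0 < scale S z}, weight S a z * ∫⁻ y in ball z (1 / 2 * scale S z), G y ≤
      ENNReal.ofReal k₁ * I := lintegral_weight_average_le S a (by norm_num) le_rfl hG
  have h3 : ∫⁻ z in {z | 0 < scale S z}, weight S a z * ∫⁻ y in ball z (1 / 4 * scale S z), G y ≤
      ENNReal.ofReal δ * (ENNReal.ofReal k₁ * I) + A * J := by
    calc _ ≤ ∫⁻ z in {z | 0 < scale S z}, (ENNReal.ofReal δ *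
          (weight S a z * ∫⁻ y in ball z (1 / 2 * scale S z), G y) +
          A * weight S (a + n - 2) z) := by
          refine setLIntegral_mono' hU fun z hz => ?_
          calc _ ≤ weight S a z * (ENNReal.ofReal δ * (∫⁻ y in ball z (1 / 2 * scale S z), G y) +
              A * weight S ((n : ℝ) - 2) z) := by gcongr; exact h z hz
            _ = _ := by
              rw [add_sub_assoc, ← weight_mul hz]
              ring
      _ = ENNReal.ofReal δ * (∫⁻ z in {z | 0 < scale S z},
          weight S a z * ∫⁻ y in ball z (1 / 2 * scale S z), G y) + A * J := by
          rw [lintegral_add_right _ ((measurable_weight S _).const_mul _),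
            lintegral_const_mul' _ _ ENNReal.ofReal_ne_top,
            lintegral_const_mul _ (measurable_weight S _)]
      _ ≤ _ := by gcongr
  have h4 : I ≤ ENNReal.ofReal (1 / 2) * I + ENNReal.ofReal k₂ * A * J := by
    calc I ≤ ENNReal.ofReal k₂ * (ENNReal.ofReal δ * (ENNReal.ofReal k₁ * I) + A * J) :=
          h1.trans (by gcongr)
      _ = ENNReal.ofReal (k₂ * (δ * k₁)) * I + ENNReal.ofReal k₂ * A * J := by
          rw [ENNReal.ofReal_mul hk₂0.le, ENNReal.ofReal_mul (p := δ) (by positivity)]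
          ring
      _ = _ := by
          congr 3
          rw [hδ]
          field_simp
  have h5 : I = ENNReal.ofReal (1 / 2) * I + ENNReal.ofReal (1 / 2) * I := by
    rw [← add_mul, ← ENNReal.ofReal_add (by norm_num) (by norm_num)]
    norm_num
  have h6 : ENNReal.ofReal (1 / 2) * I ≤ ENNReal.ofReal k₂ * A * J := by
    refine (ENNReal.add_le_add_iff_left
      (ENNReal.mul_ne_top ENNReal.ofReal_ne_top hfin)).1 (h5.symm.le.trans h4)
  calc I = ENNReal.ofReal 2 * (ENNReal.ofReal (1 / 2) * I) := by
        rw [← mul_assoc, ← ENNReal.ofReal_mul (by norm_num)]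
        norm_num
    _ ≤ ENNReal.ofReal 2 * (ENNReal.ofReal k₂ * A * J) := by gcongr
    _ = _ := by
        rw [ENNReal.ofReal_mul (p := 2) (by norm_num)]
        ring

/-- Summation over all points of a local estimate of one quantity by an energy. -/
lemma exists_lintegral_le_weighted_energy (n : ℕ) (q : ℝ) :
    ∃ K : ENNReal, K ≠ ⊤ ∧ ∀ (S : Set (Rn n)) (F G : Rn n → ENNReal) (B : ENNReal), B ≠ ⊤ →
      Measurable F → Measurable G →
      (∀ z, 0 < scale S z → ∫⁻ y in ball z (1 / 16 * scale S z), F y ≤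
        B * weight S (-q) z * (weight S 2 z * (∫⁻ y in ball z (1 / 4 * scale S z), G y) +
          weight S n z)) →
      ∫⁻ z in {z | 0 < scale S z}, F z ≤
        K * B * ((∫⁻ z in {z | 0 < scale S z}, weight S (2 - q) z * G z) +
          ∫⁻ z in {z | 0 < scale S z}, weight S (-q) z) := by
  set K₁ := ENNReal.ofReal (2 ^ |2 - q - n| *
    ((2 * (1 / 4)) ^ n * volume.real (ball (0 : Rn n) 1))) with hK₁
  set K₂ := ENNReal.ofReal (2 ^ |(-n : ℝ)| *
    ((1 / 16 / 2) ^ n * volume.real (ball (0 : Rn n) 1))⁻¹) with hK₂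
  refine ⟨K₂ * (K₁ + 1), ENNReal.mul_ne_top ENNReal.ofReal_ne_top (by simp [hK₁]),
    fun S F G B hB hF hG h => ?_⟩
  have hU := measurableSet_scale_pos S
  set I := ∫⁻ z in {z | 0 < scale S z}, weight S (2 - q) z * G z with hI
  set J := ∫⁻ z in {z | 0 < scale S z}, weight S (-q) z with hJ
  have h1 : ∫⁻ z in {z | 0 < scale S z}, F z ≤ K₂ * ∫⁻ z in {z | 0 < scale S z},
      weight S (-n) z * ∫⁻ y in ball z (1 / 16 * scale S z), F y := by
    refine le_trans (le_of_eq (setLIntegral_congr_fun hU fun z hz => ?_))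
      (lintegral_weight_le_average S (-n) (by norm_num) (by norm_num) hF)
    simp [weight]
  have h2 : ∫⁻ z in {z | 0 < scale S z},
      weight S (2 - q - n) z * ∫⁻ y in ball z (1 / 4 * scale S z), G y ≤ K₁ * I := by
    have := lintegral_weight_average_le S (2 - q - n) (c := 1 / 4) (by norm_num) (by norm_num) hG
    rwa [sub_add_cancel] at this
  calc _ ≤ K₂ * ∫⁻ z in {z | 0 < scale S z}, (B * (weight S (2 - q - n) z *
        ∫⁻ y in ball z (1 / 4 * scale S z), G y) + B * weight S (-q) z) := by
        refine h1.trans ?_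
        gcongr K₂ * ?_
        refine setLIntegral_mono' hU fun z hz => ?_
        calc _ ≤ weight S (-n) z * (B * weight S (-q) z *
            (weight S 2 z * (∫⁻ y in ball z (1 / 4 * scale S z), G y) + weight S n z)) := by
              gcongr; exact h z hz
          _ = B * ((weight S (-n) z * (weight S (-q) z * weight S 2 z)) *
                ∫⁻ y in ball z (1 / 4 * scale S z), G y) +
              B * (weight S (-n) z * (weight S (-q) z * weight S n z)) := by ring
          _ = _ := by
              rw [weight_mul hz, weight_mul hz, weight_mul hz, weight_mul hz]
              ring_nf
    _ = K₂ * (B * (∫⁻ z in {z | 0 < scale S z}, weight S (2 - q - n) z *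
        ∫⁻ y in ball z (1 / 4 * scale S z), G y) + B * J) := by
        rw [lintegral_add_right _ ((measurable_weight S _).const_mul _),
          lintegral_const_mul' _ _ hB, lintegral_const_mul' _ _ hB]
    _ ≤ K₂ * (B * (K₁ * I) + B * J) := by gcongr
    _ ≤ K₂ * (K₁ + 1) * B * (I + J) := by
        calc _ ≤ K₂ * (B * (K₁ * I) + B * J) + K₂ * B * (I + K₁ * J) := le_self_add
          _ = _ := by ring
end
end

noncomputable section

section
variable {n : ℕ} {p : Rn n} {R : ℝ} {X : Finset (Rn n)} {z : Rn n}

/-- The points outside the ball of radius `R` about `p`, together with the finite set `X`. -/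
def excluded (p : Rn n) (R : ℝ) (X : Finset (Rn n)) : Set (Rn n) := (ball p R)ᶜ ∪ X

lemma isClosed_excluded : IsClosed (excluded p R X) :=
  isOpen_ball.isClosed_compl.union X.finite_toSet.isClosed

lemma nonempty_excluded (hn : 1 ≤ n) : (excluded p R X).Nonempty := by
  have : Nonempty (Fin n) := ⟨⟨0, hn⟩⟩
  obtain ⟨v, hv⟩ := NormedSpace.exists_lt_norm ℝ (Rn n) R
  refine ⟨p + v, Or.inl ?_⟩
  rw [mem_compl_iff, mem_ball, dist_eq_norm, add_sub_cancel_left, not_lt]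
  exact hv.le

lemma scale_pos_iff (hn : 1 ≤ n) : 0 < scale (excluded p R X) z ↔ z ∈ ball p R ∧ z ∉ X := by
  rw [scale, div_pos_iff_of_pos_right four_pos,
    ← isClosed_excluded.notMem_iff_infDist_pos (nonempty_excluded hn)]
  simp [excluded]

lemma ball_scale_subset : ball z (scale (excluded p R X) z) ⊆ ball p R := by
  intro y hy
  by_contra h
  have h1 := infDist_le_dist_of_mem (x := z) (show y ∈ excluded p R X from Or.inl h)
  have h2 : 0 ≤ infDist z (excluded p R X) := infDist_nonneg
  rw [mem_ball, dist_comm, scale] at hy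
  linarith

lemma four_mul_scale_le {x : Rn n} (hx : x ∈ X) : 4 * scale (excluded p R X) z ≤ ‖z - x‖ := by
  have h1 := infDist_le_dist_of_mem (x := z) (show x ∈ excluded p R X from Or.inr hx)
  rw [dist_eq_norm] at h1
  rw [scale]
  linarith

lemma weight_neg_le (hn : 1 ≤ n) {q : ℝ} (hq : 0 ≤ q) (hz : 0 < scale (excluded p R X) z) :
    weight (excluded p R X) (-q) z ≤ ENNReal.ofReal (4 ^ q) *
      (ENNReal.ofReal ((R - ‖z - p‖) ^ (-q)) + ∑ x ∈ X, ENNReal.ofReal (‖z - x‖ ^ (-q))) := by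
  obtain ⟨y, hy, hd⟩ := isClosed_excluded.exists_infDist_eq_dist
    (nonempty_excluded (p := p) (R := R) (X := X) hn) z
  have hpos : 0 < dist z y := by
    rw [← hd]
    unfold scale at hz
    linarith
  have e : weight (excluded p R X) (-q) z =
      ENNReal.ofReal (4 ^ q) * ENNReal.ofReal (dist z y ^ (-q)) := by
    rw [weight, scale, hd, Real.div_rpow hpos.le (by norm_num), Real.rpow_neg (by norm_num : (0 : ℝ) ≤ 4),
      div_inv_eq_mul, mul_comm, ENNReal.ofReal_mul (by positivity)]
  rw [e]
  gcongr
  rcases hy with hy | hy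
  · refine le_trans (ENNReal.ofReal_le_ofReal ?_) le_self_add
    have h1 := ((scale_pos_iff hn).1 hz).1
    rw [mem_ball, dist_eq_norm] at h1
    rw [mem_compl_iff, mem_ball, not_lt] at hy
    have h2 := dist_triangle_left y p z
    rw [dist_eq_norm z p] at h2
    exact Real.rpow_le_rpow_of_nonpos (by linarith) (by linarith) (by linarith)
  · refine le_trans ?_ le_add_self
    rw [dist_eq_norm]
    exact Finset.single_le_sum (f := fun x => ENNReal.ofReal (‖z - x‖ ^ (-q)))
      (fun _ _ => zero_le) hy

/-- The weight of a negative power greater than `-1` is integrable, with a bound depending only on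
the number of excluded points. -/
lemma exists_lintegral_weight_neg_le (hn : 1 ≤ n) (m : ℕ) {q : ℝ} (hq0 : 0 ≤ q) (hq : q < 1) :
    ∃ C : ENNReal, C ≠ ⊤ ∧ ∀ (p : Rn n) (R : ℝ) (X : Finset (Rn n)), 0 < R → X.card ≤ m →
      ∫⁻ z in {z | 0 < scale (excluded p R X) z}, weight (excluded p R X) (-q) z ≤
        C * ENNReal.ofReal (R ^ ((n : ℝ) - q)) := by
  obtain ⟨C, hC, h⟩ := exists_lintegral_singular_le hn hq0 hq
  refine ⟨ENNReal.ofReal (4 ^ q) * (C + m * C), ?_, fun p R X hR hX => ?_⟩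
  · exact ENNReal.mul_ne_top ENNReal.ofReal_ne_top (by simp [hC, ENNReal.mul_eq_top])
  obtain ⟨h1, h2⟩ := h p R hR
  calc _ ≤ ∫⁻ z in {z | 0 < scale (excluded p R X) z}, ENNReal.ofReal (4 ^ q) *
        (ENNReal.ofReal ((R - ‖z - p‖) ^ (-q)) + ∑ x ∈ X, ENNReal.ofReal (‖z - x‖ ^ (-q))) :=
        setLIntegral_mono' (measurableSet_scale_pos _) fun z hz => weight_neg_le hn hq0 hz
    _ ≤ ∫⁻ z in ball p R, ENNReal.ofReal (4 ^ q) *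
        (ENNReal.ofReal ((R - ‖z - p‖) ^ (-q)) + ∑ x ∈ X, ENNReal.ofReal (‖z - x‖ ^ (-q))) :=
        lintegral_mono_set fun z hz => ((scale_pos_iff hn).1 hz).1
    _ = ENNReal.ofReal (4 ^ q) * ((∫⁻ z in ball p R, ENNReal.ofReal ((R - ‖z - p‖) ^ (-q))) +
        ∑ x ∈ X, ∫⁻ z in ball p R, ENNReal.ofReal (‖z - x‖ ^ (-q))) := by
        rw [lintegral_const_mul' _ _ ENNReal.ofReal_ne_top, lintegral_add_left (by fun_prop),
          lintegral_finsetSum _ (fun x _ => by fun_prop)]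
    _ ≤ ENNReal.ofReal (4 ^ q) * (C * ENNReal.ofReal (R ^ ((n : ℝ) - q)) +
        ∑ x ∈ X, C * ENNReal.ofReal (R ^ ((n : ℝ) - q))) := by
        gcongr with x hx
        exact h2 x
    _ ≤ ENNReal.ofReal (4 ^ q) * (C * ENNReal.ofReal (R ^ ((n : ℝ) - q)) +
        m * (C * ENNReal.ofReal (R ^ ((n : ℝ) - q)))) := by
        rw [Finset.sum_const, nsmul_eq_mul]
        gcongr
    _ = _ := by ring

lemma setLIntegral_ball_le (hn : 1 ≤ n) (p : Rn n) (R : ℝ) (X : Finset (Rn n))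
    (F : Rn n → ENNReal) :
    ∫⁻ z in ball p R, F z ≤ ∫⁻ z in {z | 0 < scale (excluded p R X) z}, F z := by
  have : Nonempty (Fin n) := ⟨⟨0, hn⟩⟩
  refine lintegral_mono' (Measure.restrict_mono_ae ?_) le_rfl
  have hX : ∀ᵐ z : Rn n, z ∉ (X : Set (Rn n)) :=
    measure_eq_zero_iff_ae_notMem.1 (X.finite_toSet.measure_zero volume)
  filter_upwards [hX] with z hz hz2
  exact (scale_pos_iff hn).2 ⟨hz2, hz⟩

end
end

noncomputable section

section
variable {n : ℕ} {s : ℝ}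

lemma continuous_integrableOn_ball {F : Rn n → ℝ} (hF : Continuous F) (z : Rn n) (r : ℝ) :
    IntegrableOn F (ball z r) :=
  (hF.continuousOn.integrableOn_compact (isCompact_closedBall z r)).mono_set ball_subset_closedBall

lemma ofReal_setIntegral_ball {F : Rn n → ℝ} (hF : Continuous F) (h0 : ∀ x, 0 ≤ F x)
    (z : Rn n) (r : ℝ) :
    ENNReal.ofReal (∫ x in ball z r, F x) = ∫⁻ x in ball z r, ENNReal.ofReal (F x) :=
  ofReal_integral_eq_lintegral_ofReal (continuous_integrableOn_ball hF z r) (ae_of_all _ h0)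

/-- A finite set of points splits off so that all balls of comparable size away from it are good. -/
lemma exists_finset_isGoodBall (hn : 1 ≤ n) (hs : s ∈ Ioo (0 : ℝ) 1) (m : ℕ) :
    ∃ Λ : ℝ, 0 ≤ Λ ∧ ∀ (ε : ℝ) (u : Rn n → ℝ) (p : Rn n) (R : ℝ), 0 < ε → Continuous u →
      IsACSol n s ε u (ball p R) → ACMorseIndexLE n s ε u (ball p R) m →
      ∃ X : Finset (Rn n), X.card ≤ m ∧ ∀ z, 0 < scale (excluded p R X) z →
        IsGoodBall n s ε Λ u z (scale (excluded p R X) z) := by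
  have hα := alphaC_pos hn hs
  refine ⟨alphaC n s * volume.real (ball (0 : Rn n) 1) *
    (1 / 2 * ((m + 1 : ℕ) : ℝ) * 2 ^ n + ((m + 1 : ℕ) : ℝ)) + 1, ?_,
    fun ε u p R hε hu hsol hidx => ?_⟩
  · have := measureReal_nonneg (μ := (volume : Measure (Rn n))) (s := ball (0 : Rn n) 1)
    positivity
  · obtain ⟨X, hX, h⟩ := exists_finset_almost_stable hn hs m hε hu hidx
    exact ⟨X, hX, fun z hz => ⟨hz, fun x hx => hsol x (ball_scale_subset hx),
      h z _ hz ball_scale_subset fun x hx => four_mul_scale_le hx⟩⟩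

lemma exists_potential_le (hn : 1 ≤ n) (hs : s ∈ Ioo (0 : ℝ) 1) (m : ℕ) {q : ℝ} (hq0 : 0 ≤ q)
    (hq : q < 1) (hq2 : q ≤ 2 * s) :
    ∃ C : ℝ, 0 ≤ C ∧ ∀ (R ε : ℝ) (p : Rn n) (u : Rn n → ℝ) (K : ℝ), 0 < R → 0 < ε →
      (∀ x, |u x| ≤ 1) → ContDiff ℝ 1 u → (∀ x, ‖fderiv ℝ u x‖ ≤ K) →
      IsACSol n s ε u (ball p R) → ACMorseIndexLE n s ε u (ball p R) m →
      ∫ x in ball p R, Wpot (u x) ≤ C * (ε ^ q * R ^ ((n : ℝ) - q)) := by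
  obtain ⟨Λ, hΛ, hgood⟩ := exists_finset_isGoodBall hn hs m
  obtain ⟨CJ, hCJ, hJ⟩ := exists_lintegral_weight_neg_le hn m hq0 hq
  obtain ⟨δ, hδ, KI, hKI, hI⟩ := exists_weighted_energy_le n (2 - q - n)
  obtain ⟨KW, hKW, hW⟩ := exists_lintegral_le_weighted_energy n q
  obtain ⟨C₁, hC₁, h₁⟩ := IsGoodBall.dirichlet_improvement hn hs hΛ hδ
  obtain ⟨C₂, hC₂, h₂⟩ := IsGoodBall.potential_le_dirichlet hn hs hΛ hq0 hq2
  set Cf : ENNReal := KW * ENNReal.ofReal C₂ * (KI * ENNReal.ofReal C₁ + 1) * CJ with hCf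
  have hCf' : Cf ≠ ⊤ := by simp [hCf, ENNReal.mul_eq_top, hKW, hKI, hCJ]
  refine ⟨Cf.toReal, ENNReal.toReal_nonneg, fun R ε p u K hR hε hu1 hu hK hsol hidx => ?_⟩
  obtain ⟨X, hX, hg⟩ := hgood ε u p R hε hu.continuous hsol hidx
  set S := excluded p R X with hS
  have hGc : Continuous fun x => ‖fderiv ℝ u x‖ ^ 2 :=
    (hu.continuous_fderiv one_ne_zero).norm.pow 2
  have hWc : Continuous fun x => Wpot (u x) := by
    have := hu.continuous
    unfold Wpot
    fun_prop
  have hW0 : ∀ x, 0 ≤ Wpot (u x) := fun x => by unfold Wpot; positivity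
  have hfin : ∫⁻ z in {z | 0 < scale S z}, weight S (2 - q - n + n) z *
      ENNReal.ofReal (‖fderiv ℝ u z‖ ^ 2) ≠ ⊤ := by
    have hc : Continuous fun z => scale S z ^ (2 - q - n + n) * ‖fderiv ℝ u z‖ ^ 2 :=
      ((continuous_scale S).rpow_const fun z => Or.inr (by linarith)).mul hGc
    refine ne_top_of_le_ne_top (continuous_integrableOn_ball hc p R).setLIntegral_lt_top.ne ?_
    refine le_trans (setLIntegral_mono' (measurableSet_scale_pos S) fun z hz => ?_)
      (lintegral_mono_set fun z hz => ((scale_pos_iff hn).1 hz).1)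
    rw [weight, ← ENNReal.ofReal_mul (Real.rpow_nonneg (le_of_lt hz) _)]
  have hI' := hI S (fun z => ENNReal.ofReal (‖fderiv ℝ u z‖ ^ 2)) (ENNReal.ofReal C₁)
    hGc.measurable.ennreal_ofReal hfin fun z hz => by
      have h := ENNReal.ofReal_le_ofReal (h₁ ε u K hε hu hu1 hK z _ (hg z hz))
      rw [ENNReal.ofReal_add (by positivity) (by positivity), ENNReal.ofReal_mul hδ.le,
        ENNReal.ofReal_mul hC₁, ofReal_setIntegral_ball hGc (fun x => by positivity),
        ofReal_setIntegral_ball hGc (fun x => by positivity)] at h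
      rw [one_div_mul_eq_div, one_div_mul_eq_div, weight, Real.rpow_sub hz, Real.rpow_natCast,
        Real.rpow_two]
      exact h
  have hW' := hW S (fun z => ENNReal.ofReal (Wpot (u z)))
    (fun z => ENNReal.ofReal (‖fderiv ℝ u z‖ ^ 2)) (ENNReal.ofReal (C₂ * ε ^ q))
    ENNReal.ofReal_ne_top hWc.measurable.ennreal_ofReal hGc.measurable.ennreal_ofReal
    fun z hz => by
      have h := ENNReal.ofReal_le_ofReal (h₂ ε u K hε hu hu1 hK z _ (hg z hz))
      rw [Real.div_rpow hε.le hz.le, div_eq_mul_inv (ε ^ q), ← Real.rpow_neg hz.le, ← mul_assoc,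
        ENNReal.ofReal_mul (by positivity), ENNReal.ofReal_mul (p := C₂ * ε ^ q) (by positivity),
        ENNReal.ofReal_add (by positivity) (by positivity),
        ENNReal.ofReal_mul (p := scale S z ^ 2) (by positivity),
        ofReal_setIntegral_ball hGc (fun x => by positivity),
        ofReal_setIntegral_ball hWc hW0] at h
      rw [one_div_mul_eq_div, one_div_mul_eq_div, weight, weight, weight, Real.rpow_natCast,
        Real.rpow_two]
      exact h
  have hJ' := hJ p R X hR hX
  rw [show (2 - q - n + n : ℝ) = 2 - q by ring, show (2 - q - 2 : ℝ) = -q by ring] at hI'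
  have hfinal : ENNReal.ofReal (∫ x in ball p R, Wpot (u x)) ≤
      ENNReal.ofReal (Cf.toReal * (ε ^ q * R ^ ((n : ℝ) - q))) := by
    rw [ofReal_setIntegral_ball hWc hW0]
    calc _ ≤ _ := setLIntegral_ball_le hn p R X _
      _ ≤ _ := hW'
      _ ≤ KW * ENNReal.ofReal (C₂ * ε ^ q) * (KI * ENNReal.ofReal C₁ *
            (CJ * ENNReal.ofReal (R ^ ((n : ℝ) - q))) + CJ * ENNReal.ofReal (R ^ ((n : ℝ) - q))) := by
          gcongr
          exact hI'.trans (by gcongr)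
      _ = _ := by
          rw [ENNReal.ofReal_mul (p := Cf.toReal) ENNReal.toReal_nonneg,
            ENNReal.ofReal_toReal hCf', ENNReal.ofReal_mul hC₂,
            ENNReal.ofReal_mul (p := ε ^ q) (by positivity), hCf]
          ring
  exact (ENNReal.ofReal_le_ofReal_iff (by positivity)).1 hfinal
end
end

noncomputable section

/-- **Decay of the potential energy for finite Morse index solutions**
(Proposition 3.22 / Theorem 1.10 of the paper, Euclidean version): with
`β = min((1-s)/2, s)`, there exist `C, ε₀` depending only on `n, s, m` such that any
solution in `B_R(p)` with index at most `m` and `ε ≤ ε₀ R` satisfies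
`ε^{-s} ∫_{B_{R/2}(p)} W(u) ≤ C R^{n-s} (ε/R)^β`. -/
theorem potential_energy_decay
    (n : ℕ) (hn : 1 ≤ n) (s : ℝ) (hs : s ∈ Set.Ioo (0 : ℝ) 1) (m : ℕ) :
    ∃ C ε₀ : ℝ, 0 < C ∧ ε₀ ∈ Set.Ioo (0 : ℝ) 1 ∧
    ∀ R : ℝ, 0 < R → ∀ ε : ℝ, 0 < ε → ε ≤ ε₀ * R → ∀ p : Rn n,
    ∀ u : Rn n → ℝ, (∀ x, u x ∈ Set.Ioo (-1 : ℝ) 1) → ContDiff ℝ 1 u →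
      (∃ K : ℝ, ∀ x, ‖fderiv ℝ u x‖ ≤ K) →
      IsACSol n s ε u (Metric.ball p R) →
      ACMorseIndexLE n s ε u (Metric.ball p R) m →
      ε ^ (-s) * (∫ x in Metric.ball p (R / 2), Wpot (u x)) ≤
        C * R ^ ((n : ℝ) - s) * (ε / R) ^ min ((1 - s) / 2) s := by
  obtain ⟨hs0, hs1⟩ := hs
  set β := min ((1 - s) / 2) s with hβ
  have hβ0 : 0 < β := lt_min (by linarith) hs0
  have hβ1 : β ≤ (1 - s) / 2 := min_le_left _ _
  have hβ2 : β ≤ s := min_le_right _ _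
  obtain ⟨C, hC, h⟩ := exists_potential_le hn ⟨hs0, hs1⟩ m (q := s + β) (by linarith)
    (by linarith) (by linarith)
  refine ⟨C + 1, 1 / 2, by linarith, by norm_num, fun R hR ε hε _ p u hu1 hu hK hsol hidx => ?_⟩
  obtain ⟨K, hK⟩ := hK
  have hu1' : ∀ x, |u x| ≤ 1 := fun x => abs_le.2 ⟨(hu1 x).1.le, (hu1 x).2.le⟩
  have h1 := h R ε p u K hR hε hu1' hu hK hsol hidx
  have h2 : ∫ x in ball p (R / 2), Wpot (u x) ≤ ∫ x in ball p R, Wpot (u x) := by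
    have hWc : Continuous fun x => Wpot (u x) := by
      have := hu.continuous
      unfold Wpot
      fun_prop
    refine setIntegral_mono_set (continuous_integrableOn_ball hWc p R)
      (ae_of_all _ fun x => ?_) (ball_subset_ball (by linarith)).eventuallyLE
    simp only [Wpot, Pi.zero_apply]
    positivity
  calc _ ≤ ε ^ (-s) * (C * (ε ^ (s + β) * R ^ ((n : ℝ) - (s + β)))) := by
        gcongr
        exact h2.trans h1
    _ = C * (R ^ ((n : ℝ) - s) * (ε / R) ^ β) := by
        have e1 : ε ^ (-s) * ε ^ (s + β) = ε ^ β := by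
          rw [← Real.rpow_add hε]
          ring_nf
        have e2 : R ^ ((n : ℝ) - (s + β)) = R ^ ((n : ℝ) - s) / R ^ β := by
          rw [← Real.rpow_sub hR]
          ring_nf
        rw [Real.div_rpow hε.le hR.le, e2, ← e1]
        ring
    _ ≤ (C + 1) * (R ^ ((n : ℝ) - s) * (ε / R) ^ β) := by
        gcongr
        linarith
    _ = _ := by ring

end
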